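/- Fix ν ∈ (0,1). There exist a sequence (a_n)_{n≥1} of real numbers with 0 ≤ a_n ≤ 2 satisfying condition R(ν) and real constants ξ_1, ξ_2, ξ_3, … with ξ_k < 1 for every k, such that for every integer k ≥ 1 one has T_k(x) → ξ_k as x → ∞. -/

import Mathlib

open Finset Filter

/-- The generalized von Mangoldt function `Λ_k(n) = ∑_{d ∣ n} μ(d) (log (n/d))^k`. -/
noncomputable def Lambdak (k : ℕ) (n : ℕ) : ℝ :=
  ∑ d ∈ n.divisors, (ArithmeticFunction.moebius d : ℝ) * (Real.log ((n : ℝ) / (d : ℝ))) ^ k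

/-- `S_k(x) = ∑_{n ≤ x} a_n Λ_k(n)`. -/
noncomputable def Ssum (a : ℕ → ℝ) (k : ℕ) (x : ℝ) : ℝ :=
  ∑ n ∈ Finset.Icc 1 ⌊x⌋₊, a n * Lambdak k n

/-- `T_k(x) = S_k(x)/(k x (log x)^{k−1})`. -/
noncomputable def Tquot (a : ℕ → ℝ) (k : ℕ) (x : ℝ) : ℝ :=
  Ssum a k x / (k * x * Real.log x ^ (k - 1))

/-- Condition `R(ν)`: for every `B > 0` there is `C_B` with
`∑_{d ≤ x^ν} |∑_{n ≤ x, d ∣ n} a_n − x/d| ≤ C_B · x (log x)^{−B}` for all `x ≥ 2`. -/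
noncomputable def Rcond (ν : ℝ) (a : ℕ → ℝ) : Prop :=
  ∀ B : ℝ, 0 < B → ∃ C : ℝ, ∀ x : ℝ, 2 ≤ x →
    ∑ d ∈ Finset.Icc 1 ⌊x ^ ν⌋₊,
      |(∑ n ∈ (Finset.Icc 1 ⌊x⌋₊).filter (fun n => d ∣ n), a n) - x / d|
      ≤ C * x * Real.log x ^ (-B)

namespace BS

/-! ### A1: zeta near the line re = 1 -/

lemma cpow_sub_le {N u : ℝ} (hN : 0 < N) (h1 : N ≤ u) (h2 : u ≤ N + 1) (w : ℂ) (hw : w.re ≤ 1) :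
    ‖(u : ℂ) ^ w - (N : ℂ) ^ w‖ ≤ ‖w‖ * N ^ (w.re - 1) := by
  rcases eq_or_ne w 0 with rfl | hw0
  · simp
  have key := Convex.norm_image_sub_le_of_norm_hasDerivWithin_le
    (f := fun y : ℝ => (y : ℂ) ^ w) (f' := fun y : ℝ => w * (y : ℂ) ^ (w - 1))
    (C := ‖w‖ * N ^ (w.re - 1)) (s := Set.Icc N u) (x := N) (y := u)
    (fun x hx => by
      have hx0 : x ≠ 0 := (hN.trans_le hx.1).ne'
      exact (hasDerivAt_ofReal_cpow_const (x := x) hx0 hw0).hasDerivWithinAt)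
    (fun x hx => by
      have hx0 : 0 < x := hN.trans_le hx.1
      rw [norm_mul, Complex.norm_cpow_eq_rpow_re_of_pos hx0]
      gcongr 
      simp only [Complex.sub_re, Complex.one_re]
      exact Real.rpow_le_rpow_of_nonpos hN hx.1 (by linarith))
    (convex_Icc N u) ⟨le_refl _, h1⟩ ⟨h1, le_refl _⟩
  refine key.trans ?_
  have : ‖u - N‖ ≤ 1 := by rw [Real.norm_eq_abs, abs_le]; constructor <;> linarith
  have h0 : 0 ≤ ‖w‖ * N ^ (w.re - 1) := by positivity
  nlinarith

noncomputable def hz (n : ℕ) (s : ℂ) : ℂ :=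
  (s - 1) * (((n + 1 : ℝ)) : ℂ) ^ (-s) + (((n + 1 + 1 : ℝ)) : ℂ) ^ (1 - s)
    - (((n + 1 : ℝ)) : ℂ) ^ (1 - s)

lemma hz_bound1 (n : ℕ) (s : ℂ) (hs : 0 ≤ s.re) :
    ‖hz n s‖ ≤ ‖s - 1‖ * (2 * (n + 1 : ℝ) ^ (-s.re)) := by
  have hN : (0:ℝ) < n + 1 := by positivity
  have h := cpow_sub_le hN (by linarith : (n + 1 : ℝ) ≤ n + 1 + 1) le_rfl (1 - s) (by simpa using hs)
  unfold hz
  rw [add_sub_assoc]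
  refine (norm_add_le _ _).trans ?_
  rw [norm_mul, Complex.norm_cpow_eq_rpow_re_of_pos hN]
  have e1 : (1 - s).re - 1 = - s.re := by simp
  rw [e1, norm_sub_rev (1:ℂ) s] at h
  simp only [Complex.neg_re]
  linarith

lemma hz_bound2 (n : ℕ) (s : ℂ) (hs : 0 ≤ s.re) :
    ‖hz n s‖ ≤ ‖s - 1‖ * (‖s‖ * (n + 1 : ℝ) ^ (-s.re - 1)) := by
  have hN : (0:ℝ) < n + 1 := by positivity
  rcases eq_or_ne s 1 with rfl | hs1
  · simp [hz]
  set N : ℝ := n + 1 with hNd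
  have key := Convex.norm_image_sub_le_of_norm_hasDerivWithin_le
    (f := fun y : ℝ => (s - 1) * (N : ℂ) ^ (-s) * ((y : ℂ) - N) + (y : ℂ) ^ (1 - s))
    (f' := fun y : ℝ => (s - 1) * ((N : ℂ) ^ (-s) - (y : ℂ) ^ (-s)))
    (C := ‖s - 1‖ * (‖s‖ * N ^ (-s.re - 1))) (s := Set.Icc N (N + 1)) (x := N) (y := N + 1)
    (fun x hx => by
      have hx0 : x ≠ 0 := (hN.trans_le hx.1).ne'
      have h1 := hasDerivAt_ofReal_cpow_const (x := x) hx0 (r := 1 - s)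
        (by intro h; apply hs1; linear_combination -h)
      have h2 : HasDerivAt (fun y : ℝ => (s - 1) * (N : ℂ) ^ (-s) * ((y : ℂ) - N))
          ((s - 1) * (N : ℂ) ^ (-s) * 1) x := by
        refine HasDerivAt.const_mul _ ?_
        exact (Complex.ofRealCLM.hasDerivAt (x := x)).sub_const _
      have h3 := (h2.add h1).hasDerivWithinAt (s := Set.Icc N (N + 1))
      have e : 1 - s - 1 = -s := by ring
      rw [e] at h3
      exact h3.congr_deriv (by ring))
    (fun x hx => by
      rw [norm_mul]
      gcongr
      have := cpow_sub_le hN hx.1 hx.2 (-s) (by simp; linarith)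
      rw [norm_sub_rev, norm_neg] at this
      simpa using this)
    (convex_Icc N (N+1)) ⟨le_refl _, by linarith⟩ ⟨by linarith, le_refl _⟩
  have : ‖(N + 1) - N‖ = 1 := by simp
  rw [this, mul_one] at key
  refine le_trans (le_of_eq ?_) key
  unfold hz
  rw [← hNd]
  congr 1
  push_cast
  ring

lemma hz_bound (n : ℕ) (s : ℂ) (θ : ℝ) (h0 : 0 < θ) (h1 : θ ≤ 1) (hs : 1 - θ / 2 ≤ s.re) :
    ‖hz n s‖ ≤ ‖s - 1‖ * (2 * ‖s‖ ^ θ * (n + 1 : ℝ) ^ (-(1 + θ / 2))) := by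
  have hs0 : 0 < s.re := by linarith
  have hN : (0:ℝ) < n + 1 := by positivity
  have hN1 : (1:ℝ) ≤ n + 1 := by linarith [Nat.cast_nonneg (α := ℝ) n]
  have hsn : 0 < ‖s‖ := hs0.trans_le (Complex.re_le_norm s)
  set N : ℝ := n + 1 with hNd
  have hle : N ^ (-s.re - θ) ≤ N ^ (-(1 + θ / 2)) :=
    Real.rpow_le_rpow_of_exponent_le hN1 (by linarith)
  have hp : 0 ≤ ‖s‖ ^ θ := by positivity
  suffices ‖hz n s‖ ≤ ‖s - 1‖ * (2 * ‖s‖ ^ θ * N ^ (-s.re - θ)) by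
    refine this.trans ?_
    gcongr
  rcases le_total N ‖s‖ with h | h
  · refine (hz_bound1 n s hs0.le).trans ?_
    rw [mul_assoc 2]
    gcongr
    have : N ^ (-s.re) = N ^ θ * N ^ (-s.re - θ) := by
      rw [← Real.rpow_add hN]; congr 1; ring
    rw [← hNd, this]
    gcongr
  · refine (hz_bound2 n s hs0.le).trans ?_
    refine mul_le_mul_of_nonneg_left ?_ (norm_nonneg _)
    have e : N ^ (-s.re - 1) = N ^ (-s.re - θ) * N ^ θ / N := by
      rw [← Real.rpow_add hN, ← Real.rpow_sub_one hN.ne']; congr 1; ring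
    have h2 : ‖s‖ / N ≤ (‖s‖ / N) ^ θ := by
      have := Real.rpow_le_rpow_of_exponent_ge (x := ‖s‖ / N) (by positivity)
        ((div_le_one hN).2 h) h1
      simpa using this
    rw [Real.div_rpow hsn.le hN.le] at h2
    have hNθ : 0 < N ^ θ := by positivity
    rw [← hNd, e]
    have h3 : ‖s‖ / N * N ^ θ ≤ ‖s‖ ^ θ := by
      rw [le_div_iff₀ hNθ] at h2; exact h2
    have h4 : 0 ≤ N ^ (-s.re - θ) := by positivity
    calc ‖s‖ * (N ^ (-s.re - θ) * N ^ θ / N) = (‖s‖ / N * N ^ θ) * N ^ (-s.re - θ) := by ring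
      _ ≤ ‖s‖ ^ θ * N ^ (-s.re - θ) := by gcongr
      _ ≤ 2 * ‖s‖ ^ θ * N ^ (-s.re - θ) := by nlinarith [mul_nonneg hp h4]

lemma summable_base (θ : ℝ) (h0 : 0 < θ) : Summable (fun n : ℕ => (n + 1 : ℝ) ^ (-(1 + θ / 2))) := by
  have := (summable_nat_add_iff 1).2 (Real.summable_nat_rpow (p := -(1 + θ / 2)).2 (by linarith))
  simpa using this

lemma hz_sum (s : ℂ) (hs : 1 < s.re) : ∑' n, hz n s = riemannZeta₁ s - 1 := by
  have hs1 : s ≠ 1 := by rintro rfl; simp at hs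
  have hz1 : riemannZeta₁ s = (s - 1) * riemannZeta s := by
    rw [riemannZeta_eq_inv_sub_mul hs1, mul_inv_cancel_left₀ (sub_ne_zero.2 hs1)]
  have hsum1 : HasSum (fun n : ℕ => (s - 1) * (((n + 1 : ℝ)) : ℂ) ^ (-s)) (riemannZeta₁ s) := by
    rw [hz1, zeta_eq_tsum_one_div_nat_add_one_cpow hs]
    have hS : Summable (fun n : ℕ => 1 / ((n : ℂ) + 1) ^ s) := by
      have := (summable_nat_add_iff 1).2 (Complex.summable_one_div_nat_cpow.2 hs)
      simpa using this
    have := hS.hasSum.mul_left (s - 1)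
    refine this.congr_fun ?_ |> fun h => h
    intro n
    rw [Complex.cpow_neg, one_div]
    push_cast
    rfl
  have hsum2 : HasSum (fun n : ℕ => (((n + 1 + 1 : ℝ)) : ℂ) ^ (1 - s) - (((n + 1 : ℝ)) : ℂ) ^ (1 - s))
      (-1) := by
    have hS : Summable (fun n : ℕ => (((n + 1 + 1 : ℝ)) : ℂ) ^ (1 - s) - (((n + 1 : ℝ)) : ℂ) ^ (1 - s)) := by
      have hb := (summable_base 1 one_pos)
      refine Summable.of_norm_bounded (g := fun n : ℕ => ‖1 - s‖ * (n + 1 : ℝ) ^ (-s.re)) ?_ ?_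
      · refine Summable.mul_left _ ?_
        have := (summable_nat_add_iff 1).2 (Real.summable_nat_rpow (p := -s.re).2 (by linarith))
        simpa using this
      · intro n
        have := cpow_sub_le (by positivity : (0:ℝ) < n + 1) (by linarith : (n + 1 : ℝ) ≤ n + 1 + 1)
          le_rfl (1 - s) (by simp; linarith)
        simpa using this
    refine (hS.hasSum_iff_tendsto_nat).2 ?_
    have : ∀ n : ℕ, ∑ i ∈ range n, ((((i + 1 + 1 : ℝ)) : ℂ) ^ (1 - s) - (((i + 1 : ℝ)) : ℂ) ^ (1 - s))
        = (((n + 1 : ℝ)) : ℂ) ^ (1 - s) - 1 := by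
      intro n
      have := Finset.sum_range_sub (fun i : ℕ => (((i + 1 : ℝ)) : ℂ) ^ (1 - s)) n
      simp only [Nat.cast_add, Nat.cast_one] at this
      rw [this]; simp
    simp_rw [this]
    have ht : Tendsto (fun n : ℕ => (((n + 1 : ℝ)) : ℂ) ^ (1 - s)) atTop (nhds 0) := by
      rw [tendsto_zero_iff_norm_tendsto_zero]
      have e : ∀ n : ℕ, ‖(((n + 1 : ℝ)) : ℂ) ^ (1 - s)‖ = (n + 1 : ℝ) ^ (-(s.re - 1)) := by
        intro n
        rw [Complex.norm_cpow_eq_rpow_re_of_pos (by positivity)]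
        congr 1; simp
      simp_rw [e]
      have := (tendsto_rpow_neg_atTop (by linarith : 0 < s.re - 1)).comp
        (tendsto_atTop_add_const_right atTop (1:ℝ) tendsto_natCast_atTop_atTop)
      exact this
    simpa using ht.sub_const 1
  have := (hsum1.add hsum2).tsum_eq
  rw [sub_eq_add_neg, ← this]
  congr 1
  funext n
  unfold hz
  ring

lemma hz_tsum_eq (θ : ℝ) (h0 : 0 < θ) (h1 : θ ≤ 1) (s : ℂ) (hs : 1 - θ / 2 < s.re) :
    ∑' n, hz n s = riemannZeta₁ s - 1 := by
  set U : Set ℂ := {s | 1 - θ / 2 < s.re} with hU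
  have hUo : IsOpen U := isOpen_lt continuous_const Complex.continuous_re
  have hd : DifferentiableOn ℂ (fun s => ∑' n, hz n s) U := by
    intro z hzU
    set R : ℝ := ‖z‖ + 1
    have hV : IsOpen (U ∩ Metric.ball 0 R) := hUo.inter Metric.isOpen_ball
    have hd' : DifferentiableOn ℂ (fun s => ∑' n, hz n s) (U ∩ Metric.ball 0 R) := by
      refine Complex.differentiableOn_tsum_of_summable_norm
        (u := fun n : ℕ => (R + 1) * (2 * R ^ θ * (n + 1 : ℝ) ^ (-(1 + θ / 2)))) ?_ ?_ hV ?_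
      · exact ((summable_base θ h0).mul_left _).mul_left _
      · intro n w hw
        have hc : (((n + 1 : ℝ)) : ℂ) ≠ 0 := by exact_mod_cast (by positivity : (n + 1 : ℝ) ≠ 0)
        have hc2 : (((n + 1 + 1 : ℝ)) : ℂ) ≠ 0 := by
          exact_mod_cast (by positivity : (n + 1 + 1 : ℝ) ≠ 0)
        unfold hz
        refine DifferentiableAt.differentiableWithinAt ?_
        refine ((DifferentiableAt.mul (by fun_prop) ?_).add ?_).sub ?_
        · exact DifferentiableAt.const_cpow (by fun_prop) (Or.inl hc)
        · exact DifferentiableAt.const_cpow (by fun_prop) (Or.inl hc2)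
        · exact DifferentiableAt.const_cpow (by fun_prop) (Or.inl hc)
      · intro n w hw
        have hwR : ‖w‖ ≤ R := by have := hw.2; simp at this; linarith
        refine (hz_bound n w θ h0 h1 hw.1.le).trans ?_
        have : ‖w - 1‖ ≤ R + 1 := (norm_sub_le _ _).trans (by simpa using hwR)
        gcongr
    exact ((hd' z ⟨hzU, by simp [R]⟩).differentiableAt
      (hV.mem_nhds ⟨hzU, by simp [R]⟩)).differentiableWithinAt
  have hA := hd.analyticOnNhd hUo
  have hB : AnalyticOnNhd ℂ (fun s => riemannZeta₁ s - 1) U :=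
    ((differentiable_riemannZeta₁.sub_const 1).differentiableOn).analyticOnNhd hUo
  have hconn : IsPreconnected U := (convex_halfSpace_re_gt _).isPreconnected
  have h2 : (2 : ℂ) ∈ U := by simp [hU]; linarith
  refine hA.eqOn_of_preconnected_of_eventuallyEq hB hconn h2 ?_ hs
  have : {s : ℂ | 1 < s.re} ∈ nhds (2 : ℂ) :=
    (isOpen_lt continuous_const Complex.continuous_re).mem_nhds (by simp)
  filter_upwards [this] with w hw
  exact hz_sum w hw

/-- Polynomial bound for `ζ(s) - 1/(s-1)` slightly to the left of the line. -/
lemma zeta0_bound (θ : ℝ) (h0 : 0 < θ) (h1 : θ ≤ 1) :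
    ∃ C : ℝ, 0 < C ∧ ∀ s : ℂ, 1 - θ / 2 < s.re → ‖riemannZeta₀ s‖ ≤ C * ‖s‖ ^ θ := by
  refine ⟨2 * (∑' n : ℕ, (n + 1 : ℝ) ^ (-(1 + θ / 2))), ?_, ?_⟩
  · have := (summable_base θ h0).tsum_pos (fun n => by positivity) 0 (by positivity)
    linarith
  have main : ∀ s : ℂ, s ≠ 1 → 1 - θ / 2 < s.re → ‖riemannZeta₀ s‖ ≤
      2 * (∑' n : ℕ, (n + 1 : ℝ) ^ (-(1 + θ / 2))) * ‖s‖ ^ θ := by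
    intro s hs1 hs
    have e := hz_tsum_eq θ h0 h1 s hs
    have hS := ((summable_base θ h0).mul_left (‖s - 1‖ * (2 * ‖s‖ ^ θ)))
    have hb : ∀ n, ‖hz n s‖ ≤ ‖s - 1‖ * (2 * ‖s‖ ^ θ) * (n + 1 : ℝ) ^ (-(1 + θ / 2)) := fun n =>
      (hz_bound n s θ h0 h1 hs.le).trans (le_of_eq (by ring))
    have h2 := tsum_of_norm_bounded hS.hasSum hb
    rw [e, tsum_mul_left] at h2
    unfold riemannZeta₁ at h2
    rw [add_sub_cancel_left, norm_mul] at h2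
    have hpos : 0 < ‖s - 1‖ := norm_pos_iff.2 (sub_ne_zero.2 hs1)
    refine le_of_mul_le_mul_left (h2.trans (le_of_eq ?_)) hpos
    ring
  intro s hs
  rcases eq_or_ne s 1 with rfl | hs1
  · have hc : ContinuousAt (fun s : ℂ => ‖riemannZeta₀ s‖ -
        2 * (∑' n : ℕ, (n + 1 : ℝ) ^ (-(1 + θ / 2))) * ‖s‖ ^ θ) 1 := by
      refine ContinuousAt.sub (differentiable_riemannZeta₀.continuous.norm.continuousAt) ?_
      refine ContinuousAt.mul continuousAt_const ?_
      exact ContinuousAt.rpow_const continuous_norm.continuousAt (by simp)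
    have h3 : ∀ᶠ s in nhdsWithin (1:ℂ) {1}ᶜ, ‖riemannZeta₀ s‖ -
        2 * (∑' n : ℕ, (n + 1 : ℝ) ^ (-(1 + θ / 2))) * ‖s‖ ^ θ ≤ 0 := by
      have hU : {s : ℂ | 1 - θ / 2 < s.re} ∈ nhds (1:ℂ) :=
        (isOpen_lt continuous_const Complex.continuous_re).mem_nhds hs
      filter_upwards [self_mem_nhdsWithin, mem_nhdsWithin_of_mem_nhds hU] with w hw1 hw2
      linarith [main w hw1 hw2]
    have := le_of_tendsto (hc.tendsto.mono_left nhdsWithin_le_nhds) h3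
    linarith
  · exact main s hs1 hs

end BS

namespace BS

/-! ### A2: functions with all derivatives of slow growth on 1 < re s ≤ 2 -/

noncomputable def tau (s : ℂ) : ℝ := |s.im| + 2

lemma tau_two (s : ℂ) : 2 ≤ tau s := by unfold tau; linarith [abs_nonneg s.im]

lemma tau_pos (s : ℂ) : 0 < tau s := by linarith [tau_two s]

def Hs : Set ℂ := {s | 1 < s.re}

lemma isOpen_Hs : IsOpen Hs := isOpen_lt continuous_const Complex.continuous_re

def PB (f : ℂ → ℂ) : Prop := ∀ ε : ℝ, 0 < ε → ∃ C : ℝ, 0 < C ∧ ∀ s : ℂ, 1 < s.re → s.re ≤ 2 →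
  ‖f s‖ ≤ C * tau s ^ ε

lemma PB.congr {f g : ℂ → ℂ} (h : Set.EqOn f g Hs) (hf : PB f) : PB g := by
  intro ε hε
  obtain ⟨C, hC, h1⟩ := hf ε hε
  exact ⟨C, hC, fun s h2 h3 => by rw [← h h2]; exact h1 s h2 h3⟩

lemma PB.add {f g : ℂ → ℂ} (hf : PB f) (hg : PB g) : PB (fun s => f s + g s) := by
  intro ε hε
  obtain ⟨C, hC, h1⟩ := hf ε hε
  obtain ⟨D, hD, h2⟩ := hg ε hε
  refine ⟨C + D, by positivity, fun s h3 h4 => ?_⟩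
  rw [add_mul]
  exact (norm_add_le _ _).trans (add_le_add (h1 s h3 h4) (h2 s h3 h4))

lemma PB.mul {f g : ℂ → ℂ} (hf : PB f) (hg : PB g) : PB (fun s => f s * g s) := by
  intro ε hε
  obtain ⟨C, hC, h1⟩ := hf (ε / 2) (by positivity)
  obtain ⟨D, hD, h2⟩ := hg (ε / 2) (by positivity)
  refine ⟨C * D, by positivity, fun s h3 h4 => ?_⟩
  have : tau s ^ ε = tau s ^ (ε / 2) * tau s ^ (ε / 2) := by
    rw [← Real.rpow_add (tau_pos s)]; congr 1; ring
  rw [this, norm_mul]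
  have := tau_pos s
  calc _ ≤ (C * tau s ^ (ε / 2)) * (D * tau s ^ (ε / 2)) :=
        mul_le_mul (h1 s h3 h4) (h2 s h3 h4) (norm_nonneg _) (by positivity)
    _ = _ := by ring

lemma PB.neg {f : ℂ → ℂ} (hf : PB f) : PB (fun s => -f s) := by
  intro ε hε
  obtain ⟨C, hC, h1⟩ := hf ε hε
  exact ⟨C, hC, fun s h3 h4 => by rw [norm_neg]; exact h1 s h3 h4⟩

def DB : ℕ → (ℂ → ℂ) → Prop
  | 0, f => DifferentiableOn ℂ f Hs ∧ PB f
  | n + 1, f => DifferentiableOn ℂ f Hs ∧ PB f ∧ DB n (deriv f)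

lemma DB.diff {n : ℕ} {f : ℂ → ℂ} (h : DB n f) : DifferentiableOn ℂ f Hs := by
  cases n <;> exact h.1

lemma DB.diffAt {n : ℕ} {f : ℂ → ℂ} (h : DB n f) {s : ℂ} (hs : s ∈ Hs) : DifferentiableAt ℂ f s :=
  (h.diff s hs).differentiableAt (isOpen_Hs.mem_nhds hs)

lemma DB.pb {n : ℕ} {f : ℂ → ℂ} (h : DB n f) : PB f := by
  cases n
  · exact h.2
  · exact h.2.1

lemma eqOn_deriv {f g : ℂ → ℂ} (h : Set.EqOn f g Hs) : Set.EqOn (deriv f) (deriv g) Hs := by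
  intro s hs
  exact Filter.EventuallyEq.deriv_eq (h.eventuallyEq_of_mem (isOpen_Hs.mem_nhds hs))

lemma DB.congr {n : ℕ} : ∀ {f g : ℂ → ℂ}, Set.EqOn f g Hs → DB n f → DB n g := by
  induction n with
  | zero => exact fun h hf => ⟨hf.1.congr (fun s hs => (h hs).symm), hf.2.congr h⟩
  | succ n ih =>
    exact fun h hf => ⟨hf.1.congr (fun s hs => (h hs).symm), hf.2.1.congr h, ih (eqOn_deriv h) hf.2.2⟩

lemma DB.down {n : ℕ} : ∀ {f : ℂ → ℂ}, DB (n + 1) f → DB n f := by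
  induction n with
  | zero => exact fun h => ⟨h.1, h.2.1⟩
  | succ n ih => exact fun h => ⟨h.1, h.2.1, ih h.2.2⟩

lemma DB.add {n : ℕ} : ∀ {f g : ℂ → ℂ}, DB n f → DB n g → DB n (fun s => f s + g s) := by
  induction n with
  | zero => exact fun hf hg => ⟨hf.1.add hg.1, hf.2.add hg.2⟩
  | succ n ih =>
    intro f g hf hg
    refine ⟨hf.1.add hg.1, hf.2.1.add hg.2.1, (ih hf.2.2 hg.2.2).congr ?_⟩
    intro s hs
    exact (deriv_fun_add (hf.diffAt hs) (hg.diffAt hs)).symm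

lemma DB.neg {n : ℕ} : ∀ {f : ℂ → ℂ}, DB n f → DB n (fun s => -f s) := by
  induction n with
  | zero => exact fun hf => ⟨hf.1.neg, hf.2.neg⟩
  | succ n ih =>
    intro f hf
    refine ⟨hf.1.neg, hf.2.1.neg, (ih hf.2.2).congr ?_⟩
    intro s hs
    exact (deriv.fun_neg).symm

lemma DB.mul {n : ℕ} : ∀ {f g : ℂ → ℂ}, DB n f → DB n g → DB n (fun s => f s * g s) := by
  induction n with
  | zero => exact fun hf hg => ⟨hf.1.mul hg.1, hf.2.mul hg.2⟩
  | succ n ih =>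
    intro f g hf hg
    refine ⟨hf.1.mul hg.1, hf.2.1.mul hg.2.1,
      ((ih hf.2.2 hg.down).add (ih hf.down hg.2.2)).congr ?_⟩
    intro s hs
    exact (deriv_fun_mul (hf.diffAt hs) (hg.diffAt hs)).symm

lemma DB.inv {n : ℕ} : ∀ {f : ℂ → ℂ}, DB n f → (∀ s ∈ Hs, f s ≠ 0) → PB (fun s => (f s)⁻¹) →
    DB n (fun s => (f s)⁻¹) := by
  induction n with
  | zero => exact fun hf h0 h => ⟨hf.1.inv h0, h⟩
  | succ n ih =>
    intro f hf h0 h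
    have hi := ih hf.down h0 h
    refine ⟨hf.1.inv h0, h, ((hf.2.2.mul (hi.mul hi)).neg).congr ?_⟩
    intro s hs
    rw [deriv_fun_inv'' (hf.diffAt hs) (h0 s hs)]
    have := h0 s hs
    field_simp

lemma DB_of_iter {n : ℕ} : ∀ {f : ℂ → ℂ}, (∀ j, DifferentiableOn ℂ (iteratedDeriv j f) Hs) →
    (∀ j, PB (iteratedDeriv j f)) → DB n f := by
  induction n with
  | zero => exact fun h1 h2 => ⟨by simpa using h1 0, by simpa using h2 0⟩
  | succ n ih =>
    intro f h1 h2
    refine ⟨by simpa using h1 0, by simpa using h2 0, ih ?_ ?_⟩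
    · intro j; rw [← iteratedDeriv_succ']; exact h1 (j + 1)
    · intro j; rw [← iteratedDeriv_succ']; exact h2 (j + 1)

lemma DB.iter {n : ℕ} : ∀ {f : ℂ → ℂ}, DB n f → PB (iteratedDeriv n f) := by
  induction n with
  | zero => intro f hf; simpa using hf.2
  | succ n ih => intro f hf; rw [iteratedDeriv_succ']; exact ih hf.2.2

/-- functions with slow growth in a strip slightly to the left -/
lemma DB_of_strip {f : ℂ → ℂ} (h : ∀ ε : ℝ, 0 < ε → ∃ δ : ℝ, 0 < δ ∧ δ ≤ 1 ∧ ∃ C : ℝ, 0 < C ∧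
    DifferentiableOn ℂ f {s | 1 - δ < s.re} ∧
    ∀ s : ℂ, 1 - δ < s.re → s.re < 3 → ‖f s‖ ≤ C * tau s ^ ε) (n : ℕ) : DB n f := by
  apply DB_of_iter
  · intro j
    obtain ⟨δ, hδ, hδ1, C, hC, hd, hb⟩ := h 1 one_pos
    have hU : IsOpen {s : ℂ | 1 - δ < s.re} := isOpen_lt continuous_const Complex.continuous_re
    have := AnalyticOnNhd.iterated_deriv (hd.analyticOnNhd hU) j
    rw [← iteratedDeriv_eq_iterate] at this
    exact this.differentiableOn.mono (fun s hs => by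
      simp only [Hs, Set.mem_setOf_eq] at hs ⊢; linarith)
  · intro j ε hε
    obtain ⟨δ, hδ, hδ1, C, hC, hd, hb⟩ := h ε hε
    refine ⟨j.factorial * (C * 2 ^ ε) / (δ / 2) ^ j, by positivity, fun s h1 h2 => ?_⟩
    have hsub : ∀ w ∈ Metric.closedBall s (δ / 2), 1 - δ < w.re := by
      intro w hw
      rw [mem_closedBall_iff_norm] at hw
      have := (Complex.abs_re_le_norm (w - s)).trans hw
      rw [abs_le, Complex.sub_re] at this
      linarith [this.1]
    have hdc : DiffContOnCl ℂ f (Metric.ball s (δ / 2)) := by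
      apply DifferentiableOn.diffContOnCl
      rw [closure_ball s (by positivity)]
      exact hd.mono hsub
    have := Complex.norm_iteratedDeriv_le_of_forall_mem_sphere_norm_le (c := s) (R := δ / 2)
      (C := C * 2 ^ ε * tau s ^ ε) j (by positivity) hdc ?_
    · refine this.trans (le_of_eq ?_); ring
    · intro w hw
      have hw' := Metric.sphere_subset_closedBall hw
      have hw3 : w.re < 3 := by
        have h5 := (Complex.abs_re_le_norm (w - s)).trans (mem_closedBall_iff_norm.1 hw')
        rw [abs_le, Complex.sub_re] at h5
        linarith [h5.2]
      refine (hb w (hsub w hw') hw3).trans ?_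
      rw [mul_assoc, ← Real.mul_rpow (by norm_num) (tau_pos s).le]
      have : tau w ≤ 2 * tau s := by
        rw [mem_closedBall_iff_norm] at hw'
        have h3 := (Complex.abs_im_le_norm (w - s)).trans hw'
        rw [Complex.sub_im] at h3
        have h4 := abs_sub_abs_le_abs_sub w.im s.im
        unfold tau
        linarith [abs_nonneg s.im]
      have := tau_pos w
      gcongr

lemma one_le_tau_rpow (s : ℂ) {ε : ℝ} (h : 0 ≤ ε) : 1 ≤ tau s ^ ε :=
  Real.one_le_rpow (by linarith [tau_two s]) h

lemma DB_const (c : ℂ) (n : ℕ) : DB n (fun _ => c) := by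
  apply DB_of_strip
  intro ε hε
  refine ⟨1, one_pos, le_rfl, ‖c‖ + 1, by positivity, differentiableOn_const _, fun s hs _ => ?_⟩
  nlinarith [one_le_tau_rpow s hε.le, norm_nonneg c]

lemma DB_inv_id (n : ℕ) : DB n (fun s => s⁻¹) := by
  apply DB_of_strip
  intro ε hε
  refine ⟨1/2, by norm_num, by norm_num, 2, by norm_num, ?_, fun s hs _ => ?_⟩
  · intro s hs
    have : s ≠ 0 := by rintro rfl; norm_num at hs
    exact (differentiableAt_inv this).differentiableWithinAt
  · have h1 := Complex.re_le_norm s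
    have : ‖s⁻¹‖ ≤ 2 := by
      rw [norm_inv]
      apply inv_le_of_inv_le₀ <;> linarith
    linarith [one_le_tau_rpow s hε.le]

end BS

namespace BS

lemma DB_zeta0 (n : ℕ) : DB n riemannZeta₀ := by
  apply DB_of_strip
  intro ε hε
  have hθ0 : 0 < min ε 1 := by positivity
  obtain ⟨C, hC, hb⟩ := zeta0_bound (min ε 1) hθ0 (min_le_right _ _)
  refine ⟨min ε 1 / 2, by positivity, by linarith [min_le_right ε 1], C * 2 ^ ε, by positivity,
    differentiable_riemannZeta₀.differentiableOn, fun s hs hs3 => ?_⟩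
  refine (hb s hs).trans ?_
  have h0 : 0 < s.re := by linarith [min_le_right ε 1]
  have h1 : ‖s‖ ≤ 2 * tau s := by
    have := Complex.norm_le_abs_re_add_abs_im s
    rw [abs_of_pos h0] at this
    unfold tau
    linarith [abs_nonneg s.im]
  have h2 := tau_two s
  rw [mul_assoc, ← Real.mul_rpow (by norm_num) (tau_pos s).le]
  have : ‖s‖ ^ min ε 1 ≤ (2 * tau s) ^ ε :=
    (Real.rpow_le_rpow (norm_nonneg _) h1 hθ0.le).trans
      (Real.rpow_le_rpow_of_exponent_le (by linarith) (min_le_left _ _))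
  gcongr

lemma zeta_bounded (s : ℂ) (hs : 3 / 2 ≤ s.re) :
    ‖riemannZeta s‖ ≤ ∑' n : ℕ, 1 / ((n : ℝ) + 1) ^ (3 / 2 : ℝ) := by
  rw [zeta_eq_tsum_one_div_nat_add_one_cpow (by linarith)]
  have hS : Summable (fun n : ℕ => 1 / ((n : ℝ) + 1) ^ (3 / 2 : ℝ)) := by
    have := (summable_nat_add_iff 1).2 (Real.summable_one_div_nat_rpow (p := 3 / 2).2 (by norm_num))
    simpa using this
  refine tsum_of_norm_bounded hS.hasSum (fun n => ?_)
  rw [norm_div, norm_one]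
  have e : ((n : ℂ) + 1) = ((n + 1 : ℝ) : ℂ) := by push_cast; rfl
  have h1 : (1:ℝ) ≤ n + 1 := by linarith [Nat.cast_nonneg (α := ℝ) n]
  rw [e, Complex.norm_cpow_eq_rpow_re_of_pos (by positivity)]
  gcongr

lemma DB_zeta_two (n : ℕ) : DB n (fun s => riemannZeta (2 * s)) := by
  apply DB_of_strip
  intro ε hε
  refine ⟨1 / 4, by norm_num, by norm_num, (∑' n : ℕ, 1 / ((n : ℝ) + 1) ^ (3 / 2 : ℝ)) + 1, 
    by positivity, ?_, fun s hs _ => ?_⟩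
  · intro s hs
    have h1 : 1 - 1 / 4 < s.re := hs
    refine DifferentiableAt.differentiableWithinAt ?_
    refine DifferentiableAt.comp (g := riemannZeta) (f := fun s : ℂ => 2 * s) s ?_ (by fun_prop)
    apply differentiableAt_riemannZeta
    intro h
    have := congrArg Complex.re h
    simp at this
    linarith
  · have h1 := zeta_bounded (2 * s) (by simp; linarith)
    have h2 := one_le_tau_rpow s hε.le
    have h3 := norm_nonneg (riemannZeta (2 * s))
    nlinarith

noncomputable def ez (s : ℂ) : ℂ := riemannZeta₁ s * s⁻¹

lemma DB_ez (n : ℕ) : DB n ez := by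
  have h1 := ((DB_zeta0 n).mul (((DB_inv_id n).neg).add (DB_const 1 n))).add (DB_inv_id n)
  refine h1.congr ?_
  intro s hs
  have hs0 : s ≠ 0 := by rintro rfl; simp [Hs] at hs; linarith
  simp only [ez, riemannZeta₁]
  field_simp
  ring

lemma zeta1_ne_zero (s : ℂ) (hs : 1 ≤ s.re) : riemannZeta₁ s ≠ 0 := by
  rcases eq_or_ne s 1 with rfl | h
  · simp
  · intro h0
    have := riemannZeta_ne_zero_of_one_le_re hs
    rw [riemannZeta_eq_inv_sub_mul h, h0] at this
    simp at this

lemma prod341 {x : ℝ} (hx : 0 < x) (y : ℝ) :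
    1 ≤ ‖riemannZeta (1 + x)‖ ^ 3 * ‖riemannZeta (1 + x + Complex.I * y)‖ ^ 4 *
      ‖riemannZeta (1 + x + 2 * Complex.I * y)‖ := by
  have := DirichletCharacter.norm_LFunction_product_ge_one (1 : DirichletCharacter ℂ 1) hx y
  simpa [DirichletCharacter.LFunctionTrivChar, DirichletCharacter.LFunction_modOne_eq] using this

lemma zeta_upper (ε : ℝ) (hε : 0 < ε) : ∃ C : ℝ, 1 ≤ C ∧ ∀ s : ℂ, 1 < s.re → s.re ≤ 2 → 1 ≤ |s.im| →
    ‖riemannZeta s‖ ≤ C * tau s ^ ε ∧ ‖deriv riemannZeta s‖ ≤ C * tau s ^ ε := by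
  obtain ⟨C, hC, h1⟩ := (DB_zeta0 0).pb ε hε
  obtain ⟨D, hD, h2⟩ := (DB_zeta0 1).2.2.pb ε hε
  refine ⟨C + D + 1, by linarith, fun s hs1 hs2 ht => ?_⟩
  have hs : s ≠ 1 := by rintro rfl; simp at hs1
  have hn : 1 ≤ ‖s - 1‖ := by
    have := Complex.abs_im_le_norm (s - 1)
    simp at this
    linarith
  have hn' : ‖s - 1‖⁻¹ ≤ 1 := inv_le_one_of_one_le₀ hn
  have h0 := one_le_tau_rpow s hε.le
  constructor
  · rw [riemannZeta_eq_inv_sub_add hs]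
    refine (norm_add_le _ _).trans ?_
    rw [norm_inv]
    have := h1 s hs1 hs2
    nlinarith
  · rw [deriv_riemannZeta_eq_neg_inv_sub_sq_add hs]
    refine (norm_add_le _ _).trans ?_
    rw [norm_neg, norm_pow, norm_inv]
    have := h2 s hs1 hs2
    have : ‖s - 1‖⁻¹ ^ 2 ≤ 1 := pow_le_one₀ (by positivity) hn'
    nlinarith

lemma zeta_real_upper : ∃ C : ℝ, 1 ≤ C ∧ ∀ x : ℝ, 0 < x → x ≤ 1 → ‖riemannZeta (1 + x)‖ ≤ C / x := by
  obtain ⟨C, hC, h1⟩ := (DB_zeta0 0).pb 1 one_pos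
  refine ⟨2 * C + 1, by linarith, fun x hx hx1 => ?_⟩
  have hne : (1 + x : ℂ) ≠ 1 := by simp [hx.ne']
  have := h1 (1 + x) (by simp [hx]) (by simp; linarith)
  simp [tau] at this
  rw [riemannZeta_eq_inv_sub_add hne]
  refine (norm_add_le _ _).trans ?_
  rw [add_sub_cancel_left, norm_inv, Complex.norm_real, Real.norm_eq_abs, abs_of_pos hx]
  rw [le_div_iff₀ hx, add_mul, inv_mul_cancel₀ hx.ne']
  nlinarith [norm_nonneg (riemannZeta₀ (1 + x))]

lemma zeta_lower (ε : ℝ) (hε : 0 < ε) : ∃ c : ℝ, 0 < c ∧ ∀ s : ℂ, 1 < s.re → s.re ≤ 2 → 1 ≤ |s.im| →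
    c ≤ ‖riemannZeta s‖ * (tau s ^ ε) ^ 4 := by
  obtain ⟨C1, hC1, hup⟩ := zeta_upper ε hε
  obtain ⟨C0, hC0, hre⟩ := zeta_real_upper
  have hC1p : 0 < C1 := by linarith
  have hC0p : 0 < C0 := by linarith
  set b : ℝ := 1 / (C0 ^ 3 * (C1 * 2 ^ ε)) with hb
  have hbp : 0 < b := by positivity
  set a : ℝ := min 1 (b / (16 * C1 ^ 4)) with ha
  have hap : 0 < a := by positivity
  have ha1 : a ≤ 1 := min_le_left _ _
  have ha2 : 16 * C1 ^ 4 * a ≤ b := by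
    have : a ≤ b / (16 * C1 ^ 4) := min_le_right _ _
    rw [le_div_iff₀ (by positivity)] at this
    linarith
  refine ⟨C1 * a, by positivity, fun s hs1 hs2 ht => ?_⟩
  set W : ℝ := tau s ^ ε with hW
  have hW1 : 1 ≤ W := one_le_tau_rpow s hε.le
  have hWp : 0 < W := by linarith
  set η : ℝ := a / W ^ 5 with hη
  have hηp : 0 < η := by positivity
  have hη1 : η ≤ 1 := by
    rw [hη, div_le_one (by positivity)]
    exact ha1.trans (one_le_pow₀ hW1)
  have hηW : W ^ 5 * η = a := by rw [hη]; field_simp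
  -- lower bound away from the line
  have far : ∀ x : ℝ, η ≤ x → x ≤ 1 → 2 * C1 * W * η ≤ ‖riemannZeta (1 + x + Complex.I * s.im)‖ := by
    intro x hx hx1
    have hxp : 0 < x := hηp.trans_le hx
    have h341 := prod341 hxp s.im
    have h1 := hre x hxp hx1
    have h2 := (hup (1 + x + 2 * Complex.I * s.im) (by simp [hxp]) (by simp; linarith)
      (by simp [abs_mul]; linarith)).1
    have h3 : tau (1 + x + 2 * Complex.I * s.im) ^ ε ≤ 2 ^ ε * W := by
      rw [hW, ← Real.mul_rpow (by norm_num) (tau_pos s).le]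
      refine Real.rpow_le_rpow (tau_pos _).le ?_ hε.le
      simp [tau, abs_mul]
      linarith
    set Z := ‖riemannZeta (1 + x + Complex.I * s.im)‖ with hZ
    have hZ0 : 0 ≤ Z := norm_nonneg _
    have h4 : 1 ≤ (C0 / x) ^ 3 * Z ^ 4 * (C1 * (2 ^ ε * W)) := by
      refine h341.trans ?_
      gcongr
      exact h2.trans (by gcongr)
    have h5 : b * x ^ 3 ≤ Z ^ 4 * W := by
      have : (C0 / x) ^ 3 * Z ^ 4 * (C1 * (2 ^ ε * W)) = (Z ^ 4 * W) / (b * x ^ 3) := by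
        rw [hb]; field_simp
      rw [this, le_div_iff₀ (by positivity)] at h4
      linarith
    have h6 : b * η ^ 3 ≤ Z ^ 4 * W := le_trans (by gcongr) h5
    by_contra hcon
    push Not at hcon
    have h7 : Z ^ 4 < (2 * C1 * W * η) ^ 4 := by gcongr
    have h8 : (2 * C1 * W * η) ^ 4 * W ≤ b * η ^ 3 := by
      calc (2 * C1 * W * η) ^ 4 * W = (16 * C1 ^ 4 * (W ^ 5 * η)) * η ^ 3 := by ring
        _ ≤ b * η ^ 3 := by rw [hηW]; gcongr
    nlinarith
  have key : C1 * W * η ≤ ‖riemannZeta s‖ := by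
    have hs : s = 1 + ((s.re - 1 : ℝ) : ℂ) + Complex.I * s.im := by
      apply Complex.ext <;> simp
    rcases le_total η (s.re - 1) with h | h
    · have := far (s.re - 1) h (by linarith)
      rw [← hs] at this
      have : 0 ≤ C1 * W * η := by positivity
      linarith
    · have h1 := far η le_rfl hη1
      set s' : ℂ := 1 + η + Complex.I * s.im with hs'
      have him : s'.im = s.im := by simp [hs']
      have hre' : s'.re = 1 + η := by simp [hs']
      -- mean value inequality on the segment
      have hseg : ∀ z ∈ segment ℝ s s', 1 < z.re ∧ z.re ≤ 2 ∧ z.im = s.im := by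
        rintro z ⟨u, v, hu, hv, huv, rfl⟩
        simp only [Complex.add_re, Complex.real_smul, Complex.mul_re, Complex.ofReal_re,
          Complex.ofReal_im, zero_mul, sub_zero, Complex.add_im, Complex.mul_im, add_zero, him, hre']
        have hu' : u = 1 - v := by linarith
        subst hu'
        refine ⟨?_, ?_, by ring⟩
        · rcases eq_or_lt_of_le hv with h0 | h0
          · rw [← h0]; linarith
          · nlinarith
        · nlinarith
      have hmv := Convex.norm_image_sub_le_of_norm_deriv_le (𝕜 := ℂ) (f := riemannZeta) (C := C1 * W)
        (s := segment ℝ s s') (x := s) (y := s') (fun z hz => by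
          obtain ⟨hz1, _, _⟩ := hseg z hz
          apply differentiableAt_riemannZeta
          rintro rfl
          simp at hz1) (fun z hz => by
          obtain ⟨hz1, hz2, hz3⟩ := hseg z hz
          have := (hup z hz1 hz2 (by rw [hz3]; exact ht)).2
          have e : tau z = tau s := by simp [tau, hz3]
          rwa [e] at this) (convex_segment s s') (left_mem_segment ℝ s s') (right_mem_segment ℝ s s')
      have hd : ‖s' - s‖ ≤ η := by
        have e : s' - s = ((η - (s.re - 1) : ℝ) : ℂ) := by
          apply Complex.ext <;> simp [hs']
          ring
        rw [e, Complex.norm_real, Real.norm_eq_abs, abs_of_nonneg (by linarith)]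
        linarith
      have h2 : ‖riemannZeta s'‖ ≤ ‖riemannZeta s‖ + ‖riemannZeta s' - riemannZeta s‖ := by
        have := norm_add_le (riemannZeta s) (riemannZeta s' - riemannZeta s)
        rwa [add_sub_cancel] at this
      have h3 : C1 * W * ‖s' - s‖ ≤ C1 * W * η := by gcongr
      linarith
  calc C1 * a = C1 * W * η * W ^ 4 := by rw [← hηW]; ring
    _ ≤ _ := by gcongr

lemma PB_ez_inv : PB (fun s => (ez s)⁻¹) := by
  intro ε hε
  obtain ⟨c, hc, hl⟩ := zeta_lower (ε / 4) (by positivity)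
  -- compact part
  obtain ⟨M, hM⟩ : ∃ M : ℝ, ∀ s ∈ (Set.Icc (1:ℝ) 2 ×ℂ Set.Icc (-1:ℝ) 1), ‖(ez s)⁻¹‖ ≤ M := by
    have hK : IsCompact (Set.Icc (1:ℝ) 2 ×ℂ Set.Icc (-1:ℝ) 1) :=
      IsCompact.reProdIm isCompact_Icc isCompact_Icc
    apply hK.exists_bound_of_continuousOn
    intro s hs
    have h1 : 1 ≤ s.re := hs.1.1
    have hs0 : s ≠ 0 := by rintro rfl; norm_num at h1
    refine ContinuousAt.continuousWithinAt ?_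
    refine ContinuousAt.inv₀ ?_ ?_
    · exact (differentiable_riemannZeta₁.continuous.continuousAt).mul (continuousAt_inv₀ hs0)
    · exact mul_ne_zero (zeta1_ne_zero s h1) (inv_ne_zero hs0)
  refine ⟨|M| + 2 / c, by positivity, fun s hs1 hs2 => ?_⟩
  have hτ := one_le_tau_rpow s hε.le
  have hp : 0 ≤ 2 / c := by positivity
  rcases le_total |s.im| 1 with h | h
  · have := hM s ⟨⟨hs1.le, hs2⟩, abs_le.1 h⟩
    have h2 := le_abs_self M
    nlinarith [abs_nonneg M]
  · have := hl s hs1 hs2 h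
    have hs : s ≠ 1 := by rintro rfl; simp at hs1
    have e4 : (tau s ^ (ε / 4)) ^ 4 = tau s ^ ε := by
      rw [← Real.rpow_natCast, ← Real.rpow_mul (tau_pos s).le]
      congr 1; push_cast; ring
    rw [e4] at this
    have hn : 1 ≤ ‖s - 1‖ := by
      have := Complex.abs_im_le_norm (s - 1)
      simp at this
      linarith
    have hs' : ‖s‖ ≤ 2 * ‖s - 1‖ := by
      have := norm_add_le (s - 1) 1
      simp at this
      linarith
    have hz1 : riemannZeta₁ s = (s - 1) * riemannZeta s := by
      rw [riemannZeta_eq_inv_sub_mul hs, mul_inv_cancel_left₀ (sub_ne_zero.2 hs)]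
    have hzp : 0 < ‖riemannZeta s‖ := norm_pos_iff.2 (riemannZeta_ne_zero_of_one_le_re hs1.le)
    have e : ‖(ez s)⁻¹‖ = ‖s‖ / ‖s - 1‖ / ‖riemannZeta s‖ := by
      rw [ez, hz1, norm_inv, norm_mul, norm_mul, norm_inv]
      field_simp
    have h2 : ‖s‖ / ‖s - 1‖ ≤ 2 := by rw [div_le_iff₀ (by linarith)]; exact hs'
    have h3 : ‖s‖ / ‖s - 1‖ / ‖riemannZeta s‖ ≤ 2 / c * tau s ^ ε := by
      rw [div_le_iff₀ hzp]
      have : 2 ≤ 2 / c * tau s ^ ε * ‖riemannZeta s‖ := by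
        calc (2:ℝ) = 2 / c * c := by field_simp
          _ ≤ 2 / c * (‖riemannZeta s‖ * tau s ^ ε) := by gcongr
          _ = _ := by ring
      linarith
    rw [e]
    nlinarith [abs_nonneg M]

lemma ez_ne_zero (s : ℂ) (hs : s ∈ Hs) : ez s ≠ 0 := by
  have h1 : 1 < s.re := hs
  have hs0 : s ≠ 0 := by rintro rfl; simp at h1; linarith
  exact mul_ne_zero (zeta1_ne_zero s h1.le) (inv_ne_zero hs0)

lemma DB_ez_inv (n : ℕ) : DB n (fun s => (ez s)⁻¹) := (DB_ez n).inv ez_ne_zero PB_ez_inv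

end BS

namespace BS

/-! ### A4: smoothed Perron formula -/

noncomputable def fK (u : ℝ) : ℂ := ((max (1 - u) 0 : ℝ) : ℂ)

noncomputable def Kf (s : ℂ) : ℂ := 1 / s - 1 / (s + 1)

lemma fK_mellin (s : ℂ) (hs : 0 < s.re) : HasMellin fK s (Kf s) := by
  have h1 := hasMellin_one_Ioc hs
  have h2 := hasMellin_cpow_Ioc 1 (s := s) (by simp; linarith)
  have h3 := hasMellin_sub h1.1 h2.1
  rw [h1.2, h2.2] at h3
  have key : Set.EqOn fK (fun t => Set.indicator (Set.Ioc 0 1) (fun _ => 1 : ℝ → ℂ) t -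
      Set.indicator (Set.Ioc 0 1) (fun t => (t : ℂ) ^ (1 : ℂ) : ℝ → ℂ) t) (Set.Ioi 0) := by
    intro t ht
    have ht0 : 0 < t := ht
    by_cases h : t ≤ 1
    · have hm : t ∈ Set.Ioc (0:ℝ) 1 := ⟨ht0, h⟩
      simp only [Set.indicator_of_mem hm, fK, Complex.cpow_one]
      rw [max_eq_left (by linarith)]
      push_cast; rfl
    · have hm : t ∉ Set.Ioc (0:ℝ) 1 := fun hh => h hh.2
      push Not at h
      simp only [Set.indicator_of_notMem hm, fK]
      rw [max_eq_right (by linarith)]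
      simp
  constructor
  · refine (MeasureTheory.integrableOn_congr_fun (fun t ht => ?_) measurableSet_Ioi).2 h3.1
    simp only [key ht]
  · rw [Kf, ← h3.2, mellin, mellin]
    refine MeasureTheory.setIntegral_congr_fun measurableSet_Ioi (fun t ht => ?_)
    simp only [key ht]

lemma Kf_bound (σ y : ℝ) (hσ : 1 ≤ σ) : ‖Kf (σ + y * Complex.I)‖ ≤ (1 + y ^ 2)⁻¹ := by
  set s : ℂ := σ + y * Complex.I with hs
  have hre : s.re = σ := by simp [hs]
  have him : s.im = y := by simp [hs]
  have hs0 : s ≠ 0 := by intro h; rw [h] at hre; simp at hre; linarith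
  have hs1 : s + 1 ≠ 0 := by
    intro h; have := congrArg Complex.re h; simp [hre] at this; linarith
  have e : Kf s = (s * (s + 1))⁻¹ := by unfold Kf; field_simp; ring
  rw [e, norm_inv, norm_mul]
  have n1 : ‖s‖ ^ 2 = σ ^ 2 + y ^ 2 := by
    rw [← Complex.normSq_eq_norm_sq, Complex.normSq_apply, hre, him]; ring
  have n2 : ‖s + 1‖ ^ 2 = (σ + 1) ^ 2 + y ^ 2 := by
    rw [← Complex.normSq_eq_norm_sq, Complex.normSq_apply]; simp [hre, him]; ring
  have h3 : ‖s‖ ≤ ‖s + 1‖ := by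
    apply (sq_le_sq₀ (norm_nonneg _) (norm_nonneg _)).1
    rw [n1, n2]; nlinarith
  gcongr
  nlinarith [norm_nonneg s]

lemma Kf_cont (σ : ℝ) (hσ : 1 ≤ σ) : Continuous (fun y : ℝ => Kf (σ + y * Complex.I)) := by
  unfold Kf
  refine Continuous.sub (Continuous.div continuous_const (by fun_prop) ?_)
    (Continuous.div continuous_const (by fun_prop) ?_)
  · intro y h
    have := congrArg Complex.re h
    simp at this; linarith
  · intro y h
    have := congrArg Complex.re h
    simp at this; linarith

lemma Kf_int (σ : ℝ) (hσ : 1 ≤ σ) :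
    MeasureTheory.Integrable (fun y : ℝ => Kf (σ + y * Complex.I)) :=
  integrable_inv_one_add_sq.mono' (Kf_cont σ hσ).aestronglyMeasurable
    (Filter.Eventually.of_forall (fun y => Kf_bound σ y hσ))

lemma kernel (σ : ℝ) (hσ : 1 ≤ σ) (u : ℝ) (hu : 0 < u) :
    ∫ y : ℝ, (u : ℂ) ^ (-((σ : ℂ) + y * Complex.I)) * Kf (σ + y * Complex.I)
      = 2 * Real.pi * fK u := by
  have hm : ∀ y : ℝ, mellin fK (σ + y * Complex.I) = Kf (σ + y * Complex.I) := fun y =>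
    (fK_mellin _ (by simp; linarith)).2
  have h := mellinInv_mellin_eq σ fK hu (fK_mellin (σ:ℂ) (by simp; linarith)).1 ?_ ?_
  · rw [mellinInv] at h
    simp_rw [hm] at h
    rw [← h]
    simp only [smul_eq_mul, Complex.real_smul]
    push_cast
    have : (Real.pi : ℂ) ≠ 0 := by exact_mod_cast Real.pi_ne_zero
    generalize (∫ y : ℝ, (u : ℂ) ^ (-((σ : ℂ) + y * Complex.I)) * Kf (σ + y * Complex.I)) = Q
    field_simp
  · rw [Complex.VerticalIntegrable]
    simp_rw [hm]
    exact Kf_int σ hσ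
  · unfold fK
    exact (Complex.continuous_ofReal.comp (by fun_prop : Continuous fun u : ℝ => max (1 - u) 0)).continuousAt

lemma riesz (b : ℕ → ℂ) (hb0 : b 0 = 0) (σ : ℝ) (hσ : 1 ≤ σ) (hs : LSeriesSummable b σ) (x : ℝ)
    (hx : 0 < x) :
    2 * Real.pi * ∑ n ∈ Finset.Icc 1 ⌊x⌋₊, b n * (1 - n / x : ℂ) =
      ∫ y : ℝ, (x : ℂ) ^ ((σ : ℂ) + y * Complex.I) * LSeries b (σ + y * Complex.I) *
        Kf (σ + y * Complex.I) := by
  set F : ℕ → ℝ → ℂ := fun n y => (x : ℂ) ^ ((σ : ℂ) + y * Complex.I) *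
    LSeries.term b (σ + y * Complex.I) n * Kf (σ + y * Complex.I) with hF
  have hxne : (x : ℂ) ≠ 0 := by exact_mod_cast hx.ne'
  have hFe : ∀ n : ℕ, n ≠ 0 → ∀ y, F n y =
      b n * (((n / x : ℝ) : ℂ) ^ (-((σ : ℂ) + y * Complex.I)) * Kf (σ + y * Complex.I)) := by
    intro n hn y
    have hn' : (0:ℝ) < n := by exact_mod_cast Nat.pos_of_ne_zero hn
    simp only [hF, LSeries.term_of_ne_zero hn]
    rw [Complex.ofReal_div, Complex.ofReal_natCast, Complex.cpow_neg]
    have : ((n : ℂ) / (x : ℂ)) ^ ((σ : ℂ) + y * Complex.I) =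
      (n : ℂ) ^ ((σ : ℂ) + y * Complex.I) / (x : ℂ) ^ ((σ : ℂ) + y * Complex.I) := by
      have := Complex.div_cpow_ofReal_nonneg hn'.le hx.le ((σ : ℂ) + y * Complex.I)
      simpa using this
    rw [this]
    have hxc : (x : ℂ) ^ ((σ : ℂ) + y * Complex.I) ≠ 0 := by
      rw [Complex.cpow_ne_zero_iff]; left; exact hxne
    have hnc : (n : ℂ) ^ ((σ : ℂ) + y * Complex.I) ≠ 0 := by
      rw [Complex.cpow_ne_zero_iff]; left; exact_mod_cast hn
    field_simp
  have hF0 : ∀ y, F 0 y = 0 := by intro y; simp [hF]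
  have hnorm : ∀ n : ℕ, ∀ y : ℝ, ‖F n y‖ = x ^ σ * ‖LSeries.term b σ n‖ * ‖Kf (σ + y * Complex.I)‖ := by
    intro n y
    simp only [hF]
    rw [norm_mul, norm_mul, Complex.norm_cpow_eq_rpow_re_of_pos hx]
    rw [LSeries.norm_term_eq, LSeries.norm_term_eq]
    simp
  have hcont : ∀ n, Continuous (F n) := by
    intro n
    rcases eq_or_ne n 0 with rfl | hn
    · have : F 0 = fun _ => 0 := funext hF0
      rw [this]; exact continuous_const
    · simp only [hF]
      refine Continuous.mul (Continuous.mul ?_ ?_) (Kf_cont σ hσ)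
      · exact Continuous.const_cpow (by fun_prop) (Or.inl hxne)
      · simp only [LSeries.term_of_ne_zero hn]
        refine Continuous.div continuous_const
          (Continuous.const_cpow (by fun_prop) (Or.inl (by exact_mod_cast hn))) ?_
        intro y
        rw [Complex.cpow_ne_zero_iff]; left; exact_mod_cast hn
  have hint : ∀ n, MeasureTheory.Integrable (F n) := by
    intro n
    refine ((Kf_int σ hσ).norm.const_mul (x ^ σ * ‖LSeries.term b σ n‖)).mono'
      (hcont n).aestronglyMeasurable (Filter.Eventually.of_forall (fun y => ?_))
    rw [hnorm]
  have hsum : Summable (fun n => ∫ y, ‖F n y‖) := by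
    simp_rw [hnorm]
    simp_rw [MeasureTheory.integral_const_mul]
    exact (hs.norm.mul_left _).mul_right _
  have main := MeasureTheory.hasSum_integral_of_summable_integral_norm hint hsum
  have e1 : ∀ n, ∫ y, F n y = 2 * Real.pi * (b n * fK (n / x)) := by
    intro n
    rcases eq_or_ne n 0 with rfl | hn
    · simp [hF0, hb0]
    · simp_rw [hFe n hn]
      rw [MeasureTheory.integral_const_mul, kernel σ hσ _ (by positivity)]
      ring
  simp_rw [e1] at main
  have e2 : ∀ y : ℝ, ∑' n, F n y = (x : ℂ) ^ ((σ : ℂ) + y * Complex.I) *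
      LSeries b (σ + y * Complex.I) * Kf (σ + y * Complex.I) := by
    intro y
    simp only [hF]
    rw [tsum_mul_right, tsum_mul_left]
    rfl
  simp_rw [e2] at main
  rw [← main.tsum_eq, tsum_mul_left]
  congr 1
  rw [tsum_eq_sum (s := Finset.Icc 1 ⌊x⌋₊)]
  · refine Finset.sum_congr rfl (fun n hn => ?_)
    rw [Finset.mem_Icc] at hn
    have : (n : ℝ) ≤ x := (Nat.le_floor_iff hx.le).1 hn.2
    rw [fK, max_eq_left (by rw [sub_nonneg, div_le_one hx]; exact this)]
    push_cast; rfl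
  · intro n hn
    rcases Nat.eq_zero_or_pos n with rfl | hn0
    · simp [hb0]
    · have : x < n := by
        by_contra h
        push Not at h
        exact hn (Finset.mem_Icc.2 ⟨hn0, Nat.le_floor h⟩)
      rw [fK, max_eq_right]
      · simp
      · rw [sub_nonpos, one_le_div hx]; exact this.le

lemma tau_half (σ y : ℝ) : tau (σ + y * Complex.I) ^ (1 / 2 : ℝ) ≤ 3 * (1 + y ^ 2) ^ (1 / 4 : ℝ) := by
  have h1 : tau (σ + y * Complex.I) ≤ 9 * (1 + y ^ 2) ^ (1 / 2 : ℝ) := by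
    have h2 : |y| ≤ (1 + y ^ 2) ^ (1 / 2 : ℝ) := by
      rw [← Real.sqrt_eq_rpow]; exact Real.abs_le_sqrt (by linarith)
    have h3 : 1 ≤ (1 + y ^ 2) ^ (1 / 2 : ℝ) := Real.one_le_rpow (by nlinarith [sq_nonneg y]) (by norm_num)
    simp [tau]
    norm_num at h2 h3
    linarith
  have h4 : (9 * (1 + y ^ 2) ^ (1 / 2 : ℝ)) ^ (1 / 2 : ℝ) = 3 * (1 + y ^ 2) ^ (1 / 4 : ℝ) := by
    rw [Real.mul_rpow (by norm_num) (by positivity), ← Real.rpow_mul (by positivity),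
      ← Real.sqrt_eq_rpow, (by norm_num : (9:ℝ) = 3 ^ 2), Real.sqrt_sq (by norm_num)]
    norm_num
  rw [← h4]
  exact Real.rpow_le_rpow (tau_pos _).le h1 (by norm_num)

lemma riesz_bound (b : ℕ → ℂ) (hb0 : b 0 = 0) (C : ℝ) (hC : 0 < C)
    (hs : ∀ σ : ℝ, 1 < σ → LSeriesSummable b σ)
    (hb : ∀ s : ℂ, 1 < s.re → s.re ≤ 2 → ‖LSeries b s‖ ≤ C * tau s ^ (1 / 2 : ℝ)) :
    ∃ D : ℝ, 0 < D ∧ ∀ x : ℝ, Real.exp 1 ≤ x →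
      ‖∑ n ∈ Finset.Icc 1 ⌊x⌋₊, b n * (1 - n / x : ℂ)‖ ≤ D * x := by
  have hI : MeasureTheory.Integrable (fun y : ℝ => (1 + y ^ 2) ^ (-(3 / 4) : ℝ)) := by
    have := integrable_rpow_neg_one_add_norm_sq (E := ℝ) (μ := MeasureTheory.volume) (r := 3 / 2)
      (by simp; norm_num)
    refine this.congr (Filter.Eventually.of_forall (fun y => ?_))
    simp only [Real.norm_eq_abs, sq_abs]
    norm_num
  set J : ℝ := ∫ y : ℝ, (1 + y ^ 2) ^ (-(3 / 4) : ℝ) with hJ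
  have hJ0 : 0 ≤ J := MeasureTheory.integral_nonneg (fun y => by positivity)
  refine ⟨Real.exp 1 * (3 * C) * J + 1, by positivity, fun x hx => ?_⟩
  have hx1 : 1 < x := lt_of_lt_of_le (by simp) hx
  have hx0 : 0 < x := by linarith
  have hl : 1 ≤ Real.log x := by rwa [Real.le_log_iff_exp_le hx0]
  set σ : ℝ := 1 + 1 / Real.log x with hσ
  have hσ1 : 1 < σ := by rw [hσ]; have : 0 < 1 / Real.log x := by positivity
                         linarith
  have hσ2 : σ ≤ 2 := by
    have : 1 / Real.log x ≤ 1 := by rw [div_le_one (by linarith)]; exact hl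
    linarith
  have hxσ : x ^ σ = Real.exp 1 * x := by
    rw [hσ, Real.rpow_add hx0, Real.rpow_one, mul_comm, Real.rpow_def_of_pos hx0]
    congr 2
    field_simp
  have h := riesz b hb0 σ hσ1.le (hs σ hσ1) x hx0
  have hbd : ‖∫ y : ℝ, (x : ℂ) ^ ((σ : ℂ) + y * Complex.I) * LSeries b (σ + y * Complex.I) *
        Kf (σ + y * Complex.I)‖ ≤ ∫ y : ℝ, Real.exp 1 * x * (3 * C) * (1 + y ^ 2) ^ (-(3 / 4) : ℝ) := by
    refine MeasureTheory.norm_integral_le_of_norm_le (hI.const_mul _)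
      (Filter.Eventually.of_forall (fun y => ?_))
    rw [norm_mul, norm_mul, Complex.norm_cpow_eq_rpow_re_of_pos hx0]
    have hre : ((σ : ℂ) + y * Complex.I).re = σ := by simp
    have h1 := hb (σ + y * Complex.I) (by rw [hre]; exact hσ1) (by rw [hre]; exact hσ2)
    have h2 := Kf_bound σ y hσ1.le
    have h3 := tau_half σ y
    rw [hre, hxσ]
    have e : (1 + y ^ 2) ^ (-(3 / 4) : ℝ) = (1 + y ^ 2) ^ (1 / 4 : ℝ) * (1 + y ^ 2)⁻¹ := by
      have : (0:ℝ) < 1 + y ^ 2 := by positivity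
      rw [← Real.rpow_neg_one, ← Real.rpow_add this]
      norm_num
    rw [e]
    calc _ ≤ Real.exp 1 * x * (C * (3 * (1 + y ^ 2) ^ (1 / 4 : ℝ))) * (1 + y ^ 2)⁻¹ := by
          gcongr
          exact h1.trans (by gcongr)
      _ = _ := by ring
  rw [← h, MeasureTheory.integral_const_mul, norm_mul] at hbd
  have hpi : ‖(2 * Real.pi : ℂ)‖ = 2 * Real.pi := by
    rw [norm_mul, Complex.norm_real, Real.norm_eq_abs, abs_of_pos Real.pi_pos]; simp
  rw [hpi] at hbd
  have := Real.pi_gt_three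
  have hn := norm_nonneg (∑ n ∈ Finset.Icc 1 ⌊x⌋₊, b n * (1 - n / x : ℂ))
  nlinarith

end BS

namespace BS

lemma abel_aux (w : ℕ → ℝ) (b : ℕ → ℂ) (hw : Antitone w) (M : ℝ) (n : ℕ)
    (hS : ∀ k ≤ n, ‖∑ i ∈ range k, b i‖ ≤ M) :
    ‖∑ i ∈ range n, (w i : ℂ) * b i - w n * ∑ i ∈ range n, b i‖ ≤ M * (w 0 - w n) := by
  induction n with
  | zero => simp
  | succ n ih =>
    have h1 := ih (fun k hk => hS k (hk.trans n.le_succ))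
    have h2 := hS (n + 1) le_rfl
    have e : ∑ i ∈ range (n + 1), (w i : ℂ) * b i - w (n + 1) * ∑ i ∈ range (n + 1), b i =
        (∑ i ∈ range n, (w i : ℂ) * b i - w n * ∑ i ∈ range n, b i) +
        ((w n - w (n + 1) : ℝ) : ℂ) * ∑ i ∈ range (n + 1), b i := by
      rw [Finset.sum_range_succ, Finset.sum_range_succ b]
      push_cast
      ring
    rw [e]
    refine (norm_add_le _ _).trans ?_
    have h3 : 0 ≤ w n - w (n + 1) := by linarith [hw n.le_succ]
    rw [norm_mul, Complex.norm_real, Real.norm_eq_abs, abs_of_nonneg h3]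
    nlinarith

lemma abel_bound (w : ℕ → ℝ) (b : ℕ → ℂ) (hw : Antitone w) (hw0 : ∀ i, 0 ≤ w i) (M : ℝ) (n : ℕ)
    (hS : ∀ k ≤ n, ‖∑ i ∈ range k, b i‖ ≤ M) :
    ‖∑ i ∈ range n, (w i : ℂ) * b i‖ ≤ M * w 0 := by
  have h1 := abel_aux w b hw M n hS
  have h2 := hS n le_rfl
  have h3 : ‖(w n : ℂ) * ∑ i ∈ range n, b i‖ ≤ w n * M := by
    rw [norm_mul, Complex.norm_real, Real.norm_eq_abs, abs_of_nonneg (hw0 n)]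
    exact mul_le_mul_of_nonneg_left h2 (hw0 n)
  have h4 := norm_add_le (∑ i ∈ range n, (w i : ℂ) * b i - w n * ∑ i ∈ range n, b i)
    ((w n : ℂ) * ∑ i ∈ range n, b i)
  rw [sub_add_cancel] at h4
  linarith

lemma log_pow_le (m : ℕ) (x : ℝ) (hx : 1 ≤ x) : Real.log x ^ m ≤ m.factorial * x := by
  have h := Real.pow_div_factorial_le_exp (Real.log x) (Real.log_nonneg hx) m
  rw [Real.exp_log (by linarith), div_le_iff₀ (by positivity)] at h
  linarith

lemma log_pow_le_sqrt (m : ℕ) (x : ℝ) (hx : 1 ≤ x) :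
    Real.log x ^ m ≤ 2 ^ m * m.factorial * Real.sqrt x := by
  have h := log_pow_le m (Real.sqrt x) (Real.one_le_sqrt.2 hx)
  rw [Real.log_sqrt (by linarith), div_pow, div_le_iff₀ (by positivity)] at h
  linarith

lemma card_Ioc_floor (x h : ℝ) (hx : 0 ≤ x) (hh : 0 ≤ h) :
    ((Finset.Ioc ⌊x⌋₊ ⌊x + h⌋₊).card : ℝ) ≤ h + 1 := by
  rw [Nat.card_Ioc, Nat.cast_sub (Nat.floor_le_floor (by linarith))]
  have h1 := Nat.floor_le (by linarith : 0 ≤ x + h)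
  have h2 := Nat.lt_floor_add_one x
  linarith

lemma logMul_iter (c : ℕ → ℂ) (j n : ℕ) :
    (LSeries.logMul^[j] c) n = (Real.log n ^ j : ℝ) * c n := by
  induction j with
  | zero => simp
  | succ j ih =>
    rw [Function.iterate_succ', Function.comp_apply, LSeries.logMul, ih, ← Complex.natCast_log]
    push_cast
    ring

lemma sum_Icc_split (f : ℕ → ℂ) {a b : ℕ} (h : a ≤ b) :
    ∑ n ∈ Icc 1 b, f n = ∑ n ∈ Icc 1 a, f n + ∑ n ∈ Ioc a b, f n := by
  have e : ∀ m, Icc 1 m = Ioc 0 m := fun m => by ext; simp [Nat.succ_le_iff]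
  rw [e, e, Finset.sum_Ioc_consecutive f (Nat.zero_le a) h]

lemma unsmooth (b : ℕ → ℂ) (j m : ℕ) (hjm : j = 2 * m) (D : ℝ) (hD : 0 < D)
    (hb : ∀ n : ℕ, 1 ≤ n → ‖b n‖ ≤ (1 + Real.log n) ^ (j + 1))
    (hP : ∀ x : ℝ, Real.exp 1 ≤ x → ‖∑ n ∈ Icc 1 ⌊x⌋₊, b n * (1 - n / x : ℂ)‖ ≤ D * x) :
    ∃ E : ℝ, 0 < E ∧ ∀ x : ℝ, Real.exp 1 ≤ x →
      ‖∑ n ∈ Icc 1 ⌊x⌋₊, b n‖ ≤ E * x * Real.log x ^ (m + 1) := by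
  refine ⟨5 * D + 3 ^ (j + 1) * (1 + m.factorial), by positivity, fun x hx => ?_⟩
  have hx1 : 1 < x := lt_of_lt_of_le (by simp) hx
  have hx0 : 0 < x := by linarith
  set L := Real.log x with hLd
  have hL : 1 ≤ L := by rwa [hLd, Real.le_log_iff_exp_le hx0]
  set h : ℝ := x / L ^ m with hh
  have hLm : 1 ≤ L ^ m := one_le_pow₀ hL
  have hhp : 0 < h := by positivity
  have hhx : h ≤ x := div_le_self hx0.le hLm
  have hp1 := hP x hx
  have hp2 := hP (x + h) (by linarith)
  set P1 := ∑ n ∈ Icc 1 ⌊x⌋₊, b n * (1 - n / x : ℂ) with hP1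
  set P2 := ∑ n ∈ Icc 1 ⌊x + h⌋₊, b n * (1 - n / (x + h : ℝ) : ℂ) with hP2
  set Bx := ∑ n ∈ Icc 1 ⌊x⌋₊, b n with hBx
  set R := ∑ n ∈ Ioc ⌊x⌋₊ ⌊x + h⌋₊, b n * (x + h - n : ℂ) with hR
  have hxc : (x : ℂ) ≠ 0 := by exact_mod_cast hx0.ne'
  have hxhc : ((x + h : ℝ) : ℂ) ≠ 0 := by exact_mod_cast (by linarith : x + h ≠ 0)
  have e1 : (x : ℂ) * P1 = ∑ n ∈ Icc 1 ⌊x⌋₊, b n * (x - n : ℂ) := by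
    rw [hP1, Finset.mul_sum]
    refine Finset.sum_congr rfl (fun n _ => ?_)
    field_simp
  have e2 : ((x + h : ℝ) : ℂ) * P2 = ∑ n ∈ Icc 1 ⌊x + h⌋₊, b n * (x + h - n : ℂ) := by
    rw [hP2, Finset.mul_sum]
    refine Finset.sum_congr rfl (fun n _ => ?_)
    field_simp
    push_cast; ring
  have e3 : (h : ℂ) * Bx = ((x + h : ℝ) : ℂ) * P2 - x * P1 - R := by
    rw [e1, e2, sum_Icc_split _ (Nat.floor_le_floor (by linarith : x ≤ x + h)), hR, hBx,
      Finset.mul_sum]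
    rw [add_sub_right_comm, add_sub_cancel_right, ← Finset.sum_sub_distrib]
    refine Finset.sum_congr rfl (fun n _ => ?_)
    ring
  have hlog : Real.log (x + h) ≤ 1 + L := by
    have : Real.log (x + h) ≤ Real.log (2 * x) := Real.log_le_log (by linarith) (by linarith)
    rw [Real.log_mul (by norm_num) hx0.ne'] at this
    linarith [Real.log_two_lt_d9]
  have hRb : ‖R‖ ≤ h * ((h + 1) * (3 * L) ^ (j + 1)) := by
    have : ∀ n ∈ Ioc ⌊x⌋₊ ⌊x + h⌋₊, ‖b n * (x + h - n : ℂ)‖ ≤ (3 * L) ^ (j + 1) * h := by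
      intro n hn
      rw [Finset.mem_Ioc] at hn
      have hn1 : x < n := (Nat.floor_lt hx0.le).1 hn.1
      have hn2 : (n : ℝ) ≤ x + h := (Nat.le_floor_iff (by linarith)).1 hn.2
      have hn0 : 1 ≤ n := by
        rcases Nat.eq_zero_or_pos n with h0 | h0
        · rw [h0] at hn1; simp at hn1; linarith
        · exact h0
      have e : (x + h - n : ℂ) = ((x + h - n : ℝ) : ℂ) := by push_cast; rfl
      rw [norm_mul, e, Complex.norm_real, Real.norm_eq_abs, abs_of_nonneg (by linarith)]
      have hln : Real.log n ≤ 1 + L := (Real.log_le_log (by linarith) hn2).trans hlog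
      have hln0 : 0 ≤ Real.log n := Real.log_natCast_nonneg n
      refine mul_le_mul ((hb n hn0).trans ?_) (by linarith) (by linarith) (by positivity)
      gcongr
      linarith
    refine (norm_sum_le_of_le _ this).trans ?_
    rw [Finset.sum_const, nsmul_eq_mul]
    have hc := card_Ioc_floor x h hx0.le hhp.le
    calc ((Ioc ⌊x⌋₊ ⌊x + h⌋₊).card : ℝ) * ((3 * L) ^ (j + 1) * h)
        ≤ (h + 1) * ((3 * L) ^ (j + 1) * h) := by gcongr
      _ = _ := by ring
  have hB : h * ‖Bx‖ ≤ (x + h) * (D * (x + h)) + x * (D * x) + h * ((h + 1) * (3 * L) ^ (j + 1)) := by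
    have e4 : h * ‖Bx‖ = ‖(h : ℂ) * Bx‖ := by
      rw [norm_mul, Complex.norm_real, Real.norm_eq_abs, abs_of_pos hhp]
    rw [e4, e3]
    refine (norm_sub_le _ _).trans (add_le_add ((norm_sub_le _ _).trans ?_) hRb)
    rw [norm_mul, norm_mul, Complex.norm_real, Complex.norm_real, Real.norm_eq_abs, Real.norm_eq_abs,
      abs_of_pos hx0, abs_of_pos (by linarith : 0 < x + h)]
    exact add_le_add (by gcongr) (by gcongr)
  have hB2 : h * ‖Bx‖ ≤ h * (5 * D * x * L ^ m + (h + 1) * (3 * L) ^ (j + 1)) := by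
    refine hB.trans ?_
    have : h * L ^ m = x := by rw [hh]; field_simp
    have e5 : h * (5 * D * x * L ^ m + (h + 1) * (3 * L) ^ (j + 1)) =
      5 * D * x * (h * L ^ m) + h * ((h + 1) * (3 * L) ^ (j + 1)) := by ring
    rw [e5, this]
    have : (x + h) * (D * (x + h)) ≤ (2 * x) * (D * (2 * x)) := by gcongr <;> linarith
    nlinarith
  have hB3 := le_of_mul_le_mul_left hB2 hhp
  refine hB3.trans ?_
  have f1 : L ^ m ≤ L ^ (m + 1) := pow_le_pow_right₀ hL (by omega)
  have f2 : h * L ^ (j + 1) = x * L ^ (m + 1) := by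
    rw [hh, hjm]
    rw [show 2 * m + 1 = m + (m + 1) by ring, pow_add]
    field_simp
  have f3 : L ^ (j + 1) ≤ m.factorial * x * L ^ (m + 1) := by
    rw [hjm, show 2 * m + 1 = m + (m + 1) by ring, pow_add]
    have := log_pow_le m x hx1.le
    gcongr
  calc 5 * D * x * L ^ m + (h + 1) * (3 * L) ^ (j + 1)
      = 5 * D * x * L ^ m + 3 ^ (j + 1) * (h * L ^ (j + 1) + L ^ (j + 1)) := by
        rw [mul_pow]; ring
    _ ≤ 5 * D * x * L ^ (m + 1) + 3 ^ (j + 1) * (x * L ^ (m + 1) + m.factorial * x * L ^ (m + 1)) := by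
        rw [f2]; gcongr
    _ = _ := by ring

theorem ST (c : ℕ → ℂ) (g : ℂ → ℂ) (hc0 : c 0 = 0) (hc : ∀ n : ℕ, 1 ≤ n → ‖c n‖ ≤ 1 + Real.log n)
    (ha : LSeries.abscissaOfAbsConv c ≤ 1) (hg : Set.EqOn (LSeries c) g Hs) (hDB : ∀ n, DB n g)
    (B : ℕ) : ∃ C : ℝ, 0 < C ∧ ∀ x : ℝ, 2 ≤ x →
      ‖∑ n ∈ Icc 1 ⌊x⌋₊, c n‖ ≤ C * x / Real.log x ^ B := by
  obtain ⟨m, hm⟩ : ∃ m, m = B + 1 := ⟨_, rfl⟩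
  obtain ⟨j, hj⟩ : ∃ j, j = 2 * m := ⟨_, rfl⟩
  set b := LSeries.logMul^[j] c with hbdef
  have hbn : ∀ n, b n = (Real.log n ^ j : ℝ) * c n := logMul_iter c j
  have hb0 : b 0 = 0 := by rw [hbn, hc0, mul_zero]
  have habs : LSeries.abscissaOfAbsConv b ≤ 1 := by
    rw [hbdef, LSeries.absicssaOfAbsConv_logPowMul]; exact ha
  have hs : ∀ σ : ℝ, 1 < σ → LSeriesSummable b σ := fun σ hσ =>
    LSeriesSummable_of_abscissaOfAbsConv_lt_re (lt_of_le_of_lt habs (by rw [Complex.ofReal_re]; exact_mod_cast hσ))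
  have hD1 : DB j (LSeries c) := (hDB j).congr (fun s hs => (hg hs).symm)
  obtain ⟨C1, hC1, hC1b⟩ := hD1.iter (1 / 2) (by norm_num)
  have hb1 : ∀ s : ℂ, 1 < s.re → s.re ≤ 2 → ‖LSeries b s‖ ≤ C1 * tau s ^ (1 / 2 : ℝ) := by
    intro s h1 h2
    have h3 := hC1b s h1 h2
    rw [LSeries_iteratedDeriv j (lt_of_le_of_lt ha (by exact_mod_cast h1))] at h3
    simpa using h3
  obtain ⟨D, hD, hP⟩ := riesz_bound b hb0 C1 hC1 hs hb1
  have hbb : ∀ n : ℕ, 1 ≤ n → ‖b n‖ ≤ (1 + Real.log n) ^ (j + 1) := by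
    intro n hn
    have hl : 0 ≤ Real.log n := Real.log_natCast_nonneg n
    rw [hbn, norm_mul, Complex.norm_real, Real.norm_eq_abs, abs_of_nonneg (by positivity), pow_succ]
    exact mul_le_mul (pow_le_pow_left₀ hl (by linarith) _) (hc n hn) (norm_nonneg _) (by positivity)
  obtain ⟨E, hE, hU⟩ := unsmooth b j m hj D hD hbb hP
  have htriv : ∀ x : ℝ, 1 ≤ x → ‖∑ n ∈ Icc 1 ⌊x⌋₊, c n‖ ≤ x * (1 + Real.log x) := by
    intro x hx
    have : ∀ n ∈ Icc 1 ⌊x⌋₊, ‖c n‖ ≤ 1 + Real.log x := by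
      intro n hn
      rw [Finset.mem_Icc] at hn
      have hn2 : (n : ℝ) ≤ x := (Nat.le_floor_iff (by linarith)).1 hn.2
      have : (1 : ℝ) ≤ n := by exact_mod_cast hn.1
      linarith [hc n hn.1, Real.log_le_log (by linarith) hn2]
    refine (norm_sum_le_of_le _ this).trans ?_
    rw [Finset.sum_const, nsmul_eq_mul, Nat.card_Icc, Nat.add_sub_cancel]
    have := Real.log_nonneg hx
    exact mul_le_mul_of_nonneg_right (Nat.floor_le (by linarith)) (by linarith)
  refine ⟨3 * 2 ^ B + (2 * (2 ^ (B + 1) * (B + 1).factorial) + 2 * E * 2 ^ j), by positivity, fun x hx => ?_⟩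
  have hx0 : 0 < x := by linarith
  have hl0 : 0 < Real.log x := Real.log_pos (by linarith)
  rw [le_div_iff₀ (by positivity)]
  rcases le_or_gt (Real.log x) 2 with hlx | hlx
  · calc ‖∑ n ∈ Icc 1 ⌊x⌋₊, c n‖ * Real.log x ^ B ≤ (x * (1 + Real.log x)) * 2 ^ B := by
          gcongr
          exact htriv x (by linarith)
      _ ≤ (x * (1 + 2)) * 2 ^ B := by gcongr
      _ = (3 * 2 ^ B) * x := by ring
      _ ≤ _ := by
          have : 0 ≤ (2 * (2 ^ (B + 1) * (B + 1).factorial) + 2 * E * 2 ^ j : ℝ) * x := by positivity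
          rw [add_mul (3 * 2 ^ B : ℝ)]
          linarith
  set L := Real.log x with hL
  set y := Real.sqrt x with hy
  have hy1 : 1 ≤ y := Real.one_le_sqrt.2 (by linarith)
  have hyx : y ≤ x := by
    rw [hy, Real.sqrt_le_left (by linarith)]; nlinarith
  have hly : Real.log y = L / 2 := Real.log_sqrt hx0.le
  have hye : Real.exp 1 ≤ y := by
    rw [← Real.le_log_iff_exp_le (by linarith), hly]; linarith
  set N := ⌊y⌋₊ with hN
  have hN2 : 2 ≤ N := Nat.le_floor (by
    have := Real.exp_one_gt_d9
    push_cast; linarith)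
  have hNx : N ≤ ⌊x⌋₊ := Nat.floor_le_floor hyx
  rw [sum_Icc_split c hNx]
  have h1 : ‖∑ n ∈ Icc 1 N, c n‖ ≤ 2 * y * L := by
    refine (htriv y hy1).trans ?_
    rw [hly]; nlinarith
  set w : ℕ → ℝ := fun i => (Real.log ((N + 1 + i : ℕ) : ℝ) ^ j)⁻¹ with hw
  have hlpos : ∀ i, 0 < Real.log ((N + 1 + i : ℕ) : ℝ) := fun i =>
    Real.log_pos (by exact_mod_cast (by omega : 1 < N + 1 + i))
  have hwanti : Antitone w := by
    intro i i' hii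
    simp only [hw]
    gcongr
    · exact pow_pos (hlpos i) _
  have h2 : ‖∑ n ∈ Ioc N ⌊x⌋₊, c n‖ ≤ (2 * E * x * L ^ (m + 1)) * w 0 := by
    have e : ∑ n ∈ Ioc N ⌊x⌋₊, c n = ∑ i ∈ range (⌊x⌋₊ - N), (w i : ℂ) * b (N + 1 + i) := by
      have e0 : Ioc N ⌊x⌋₊ = Ico (N + 1) (⌊x⌋₊ + 1) := by ext; simp only [mem_Ioc, mem_Ico]; omega
      rw [e0, Finset.sum_Ico_eq_sum_range]
      rw [show ⌊x⌋₊ + 1 - (N + 1) = ⌊x⌋₊ - N by omega]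
      refine Finset.sum_congr rfl (fun i _ => ?_)
      rw [hbn, ← mul_assoc, ← Complex.ofReal_mul, hw, inv_mul_cancel₀ (pow_pos (hlpos i) _).ne']
      simp
    rw [e]
    refine abel_bound w (fun i => b (N + 1 + i)) hwanti
      (fun i => (inv_pos.2 (pow_pos (hlpos i) _)).le) _ _ (fun k hk => ?_)
    have e1 : ∑ i ∈ range k, b (N + 1 + i) = ∑ n ∈ Icc 1 (N + k), b n - ∑ n ∈ Icc 1 N, b n := by
      rw [sum_Icc_split b (Nat.le_add_right N k), add_sub_cancel_left]
      have e0 : Ioc N (N + k) = Ico (N + 1) (N + k + 1) := by ext; simp only [mem_Ioc, mem_Ico]; omega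
      rw [e0, Finset.sum_Ico_eq_sum_range, show N + k + 1 - (N + 1) = k by omega]
    rw [e1]
    have key : ∀ z : ℝ, Real.exp 1 ≤ z → z ≤ x → ‖∑ n ∈ Icc 1 ⌊z⌋₊, b n‖ ≤ E * x * L ^ (m + 1) := by
      intro z hz hzx
      have hz1 : 1 ≤ z := (by simp : (1 : ℝ) ≤ Real.exp 1).trans hz
      refine (hU z hz).trans ?_
      have := Real.log_nonneg hz1
      have h5 : Real.log z ≤ L := Real.log_le_log (by linarith) hzx
      gcongr
    have k1 := key y hye hyx
    have k2 : ‖∑ n ∈ Icc 1 (N + k), b n‖ ≤ E * x * L ^ (m + 1) := by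
      rcases Nat.eq_zero_or_pos k with h0 | h0
      · rw [h0, add_zero]; exact k1
      · have hy2 := Nat.lt_floor_add_one y
        have h3 : ((N + k : ℕ) : ℝ) ≤ x := (Nat.le_floor_iff hx0.le).1 (by omega)
        have h4 : y ≤ ((N + k : ℕ) : ℝ) := by
          have : (1 : ℝ) ≤ k := by exact_mod_cast h0
          push_cast; linarith
        have := key ((N + k : ℕ) : ℝ) (hye.trans h4) h3
        rwa [Nat.floor_natCast] at this
    refine (norm_sub_le _ _).trans ?_
    linarith
  have h3 : w 0 ≤ 2 ^ j / L ^ j := by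
    rw [← div_pow, ← inv_div, inv_pow]
    simp only [hw]
    have : L / 2 ≤ Real.log ((N + 1 + 0 : ℕ) : ℝ) := by
      rw [← hly]
      refine Real.log_le_log (by linarith) ?_
      have := Nat.lt_floor_add_one y
      push_cast; linarith
    gcongr
  have h4 : L ^ (B + 1) ≤ 2 ^ (B + 1) * (B + 1).factorial * y := log_pow_le_sqrt _ x (by linarith)
  have hyy : y * y = x := Real.mul_self_sqrt hx0.le
  calc ‖∑ n ∈ Icc 1 N, c n + ∑ n ∈ Ioc N ⌊x⌋₊, c n‖ * L ^ B
      ≤ (2 * y * L + (2 * E * x * L ^ (m + 1)) * (2 ^ j / L ^ j)) * L ^ B := by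
        gcongr
        refine (norm_add_le _ _).trans (add_le_add h1 (h2.trans ?_))
        gcongr
    _ = 2 * y * L ^ (B + 1) + 2 * E * 2 ^ j * x := by
        have : L ^ j = L ^ (m + 1) * L ^ B := by rw [← pow_add, hj, hm]; congr 1; omega
        rw [this]; field_simp; ring
    _ ≤ 2 * y * (2 ^ (B + 1) * (B + 1).factorial * y) + 2 * E * 2 ^ j * x := by gcongr
    _ = (2 * (2 ^ (B + 1) * (B + 1).factorial) + 2 * E * 2 ^ j) * x := by rw [← hyy]; ring
    _ ≤ _ := by
        have : (0 : ℝ) ≤ 3 * 2 ^ B * x := by positivity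
        rw [add_mul (3 * 2 ^ B : ℝ)]
        linarith

end BS

namespace BS

/-- real Liouville function -/
noncomputable def lam (n : ℕ) : ℝ := (ArithmeticFunction.liouville n : ℝ)

lemma lam_zero : lam 0 = 0 := by simp [lam]
lemma lam_one : lam 1 = 1 := by simp [lam, ArithmeticFunction.liouville_apply_one]
lemma lam_mul (m n : ℕ) : lam (m * n) = lam m * lam n := by
  simp [lam, ArithmeticFunction.liouville_apply_mul]
lemma lam_prime {p : ℕ} (hp : p.Prime) : lam p = -1 := by
  rw [lam, ArithmeticFunction.liouville_apply hp.ne_zero,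
    ArithmeticFunction.cardFactors_apply_prime hp]
  simp
lemma abs_lam {n : ℕ} (hn : n ≠ 0) : |lam n| = 1 := by
  rw [lam, ArithmeticFunction.liouville_apply hn]
  simp
lemma abs_lam_le (n : ℕ) : |lam n| ≤ 1 := by
  rcases eq_or_ne n 0 with h | h
  · simp [h, lam_zero]
  · exact (abs_lam h).le

/-- hom -/
noncomputable def lamHom {s : ℂ} (hs : s ≠ 0) : ℕ →*₀ ℂ where
  toFun n := (lam n : ℂ) * (n : ℂ) ^ (-s)
  map_zero' := by simp [lam_zero]
  map_one' := by simp [lam_one]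
  map_mul' m n := by
    have := (riemannZetaSummandHom hs).map_mul' m n
    simp only [riemannZetaSummandHom] at this
    simp only [lam_mul]
    push_cast at this ⊢
    rw [this]; ring

lemma lam_summable (s : ℂ) (hs : 1 < s.re) : Summable (fun n : ℕ => ‖(lam n : ℂ) * (n : ℂ) ^ (-s)‖) := by
  refine Summable.of_nonneg_of_le (fun _ => norm_nonneg _) (fun n => ?_)
    (summable_riemannZetaSummand hs)
  rw [norm_mul, Complex.norm_real, Real.norm_eq_abs]
  exact mul_le_of_le_one_left (norm_nonneg _) (abs_lam_le n)

lemma lam_term (s : ℂ) (n : ℕ) : LSeries.term (fun n => (lam n : ℂ)) s n = (lam n : ℂ) * (n : ℂ) ^ (-s) := by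
  rcases eq_or_ne n 0 with h | h
  · simp [h, lam_zero]
  · rw [LSeries.term_of_ne_zero h, Complex.cpow_neg, div_eq_mul_inv]

lemma LSeries_lam_mul_zeta (s : ℂ) (hs : 1 < s.re) :
    LSeries (fun n => (lam n : ℂ)) s * riemannZeta s = riemannZeta (2 * s) := by
  have hs0 : s ≠ 0 := Complex.ne_zero_of_one_lt_re hs
  have h1 := EulerProduct.eulerProduct_completely_multiplicative_hasProd
    (f := lamHom hs0) (lam_summable s hs)
  have e : ∑' n, lamHom hs0 n = LSeries (fun n => (lam n : ℂ)) s := by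
    rw [LSeries]
    exact tsum_congr (fun n => (lam_term s n).symm)
  rw [e] at h1
  have h2 := h1.mul (riemannZeta_eulerProduct_hasProd hs)
  have h3 := riemannZeta_eulerProduct_hasProd (s := 2 * s) (by simp; linarith)
  refine h2.unique ?_
  convert h3 using 2 with p
  have hp : ((p : ℕ) : ℂ) ≠ 0 := by exact_mod_cast p.2.ne_zero
  rw [← mul_inv]
  congr 1
  have e1 : lamHom hs0 p = -((p : ℕ) : ℂ) ^ (-s) := by
    change (lam p : ℂ) * ((p : ℕ) : ℂ) ^ (-s) = _
    rw [lam_prime p.2]; push_cast; ring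
  rw [e1, show -(2 * s) = -s + -s by ring, Complex.cpow_add _ _ hp]
  ring

lemma abscissa_le_one (c : ℕ → ℂ) (h : ∀ σ : ℝ, 1 < σ → LSeriesSummable c σ) :
    LSeries.abscissaOfAbsConv c ≤ 1 := by
  have := LSeries.abscissaOfAbsConv_le_of_forall_lt_LSeriesSummable (f := c) (x := 1) h
  exact_mod_cast this

lemma Hs_ne {s : ℂ} (hs : s ∈ Hs) : s ≠ 1 ∧ s ≠ 0 := by
  have h : 1 < s.re := hs
  constructor
  · rintro rfl; simp at h
  · rintro rfl; simp at h; linarith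

lemma zeta_ez {s : ℂ} (hs : s ∈ Hs) : riemannZeta s = (s - 1)⁻¹ * s * ez s := by
  obtain ⟨h1, h0⟩ := Hs_ne hs
  rw [ez, show (s - 1)⁻¹ * s * (riemannZeta₁ s * s⁻¹) = (s - 1)⁻¹ * riemannZeta₁ s by field_simp]
  have := sub_ne_zero.2 h1
  rw [riemannZeta₁, riemannZeta₀, if_neg h1]
  field_simp
  ring

theorem lam_bound (B : ℕ) : ∃ C : ℝ, 0 < C ∧ ∀ x : ℝ, 2 ≤ x →
    |∑ n ∈ Icc 1 ⌊x⌋₊, lam n| ≤ C * x / Real.log x ^ B := by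
  have key := ST (fun n => (lam n : ℂ))
    (fun s => riemannZeta (2 * s) * ((1 + -s⁻¹) * (ez s)⁻¹)) (by simp [lam_zero])
    (fun n hn => by
      rw [Complex.norm_real, Real.norm_eq_abs]
      linarith [abs_lam_le n, Real.log_natCast_nonneg n])
    (abscissa_le_one _ (fun σ hσ => by
      have := (lam_summable σ (by simpa using hσ)).of_norm
      rw [LSeriesSummable]
      exact this.congr (fun n => (lam_term σ n).symm)))
    (fun s hs => by
      have h1 := LSeries_lam_mul_zeta s hs
      obtain ⟨hs1, h0⟩ := Hs_ne hs
      have := sub_ne_zero.2 hs1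
      have he := ez_ne_zero s hs
      simp only
      rw [← h1, zeta_ez hs]
      field_simp
      ring)
    (fun n => (DB_zeta_two n).mul (((DB_const 1 n).add (DB_inv_id n).neg).mul (DB_ez_inv n))) B
  obtain ⟨C, hC, h⟩ := key
  refine ⟨C, hC, fun x hx => ?_⟩
  have := h x hx
  rwa [← Complex.ofReal_sum, Complex.norm_real, Real.norm_eq_abs] at this

/-- coefficients -/
noncomputable def rr (n : ℕ) : ℝ := if n = 0 then 0 else ArithmeticFunction.vonMangoldt n - 1

lemma rr_eq : (fun n => (rr n : ℂ)) = (fun n => (ArithmeticFunction.vonMangoldt n : ℂ)) -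
    (fun n => (ArithmeticFunction.zeta n : ℂ)) := by
  ext n
  rcases eq_or_ne n 0 with h | h
  · simp [rr, h]
  · simp [rr, h]

theorem rr_bound (B : ℕ) : ∃ C : ℝ, 0 < C ∧ ∀ x : ℝ, 2 ≤ x →
    |∑ n ∈ Icc 1 ⌊x⌋₊, rr n| ≤ C * x / Real.log x ^ B := by
  have hsum : ∀ s : ℂ, 1 < s.re → LSeriesSummable (fun n => (rr n : ℂ)) s := fun s hs => by
    rw [rr_eq]
    exact (ArithmeticFunction.LSeriesSummable_vonMangoldt hs).sub
      (ArithmeticFunction.LSeriesSummable_zeta_iff.2 hs)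
  have key := ST (fun n => (rr n : ℂ))
    (fun s => (-(deriv ez s * (ez s)⁻¹) + -s⁻¹) + -riemannZeta₀ s) (by simp [rr])
    (fun n hn => by
      rw [Complex.norm_real, Real.norm_eq_abs, rr, if_neg (by omega)]
      have h1 := ArithmeticFunction.vonMangoldt_nonneg (n := n)
      have h2 := ArithmeticFunction.vonMangoldt_le_log (n := n)
      have := Real.log_natCast_nonneg n
      rw [abs_le]; constructor <;> linarith)
    (abscissa_le_one _ (fun σ hσ => hsum _ (by simpa using hσ)))
    (fun s hs => by
      have hs' : 1 < s.re := hs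
      obtain ⟨hs1, h0⟩ := Hs_ne hs
      have hs1' := sub_ne_zero.2 hs1
      have he := ez_ne_zero s hs
      simp only
      rw [rr_eq, LSeries_sub (ArithmeticFunction.LSeriesSummable_vonMangoldt hs')
        (ArithmeticFunction.LSeriesSummable_zeta_iff.2 hs'),
        ArithmeticFunction.LSeries_vonMangoldt_eq_deriv_riemannZeta_div hs',
        ArithmeticFunction.LSeries_zeta_eq_riemannZeta hs']
      have hd : deriv riemannZeta s = deriv (fun s => (s - 1)⁻¹ * s * ez s) s := by
        refine Filter.EventuallyEq.deriv_eq ?_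
        filter_upwards [isOpen_Hs.mem_nhds hs] with z hz using zeta_ez hz
      have hed : HasDerivAt ez (deriv ez s) s := ((DB_ez 1).diffAt hs).hasDerivAt
      have h3 : HasDerivAt (fun s : ℂ => (s - 1)⁻¹) (-1 / (s - 1) ^ 2) s :=
        ((hasDerivAt_id s).sub_const 1).inv hs1'
      have h4 := ((h3.mul (hasDerivAt_id s)).mul hed).deriv
      have h5 : deriv (fun s => (s - 1)⁻¹ * s * ez s) s =
        (-1 / (s - 1) ^ 2 * s + (s - 1)⁻¹ * 1) * ez s + (s - 1)⁻¹ * s * deriv ez s := h4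
      have e2 : riemannZeta s = (s - 1)⁻¹ + riemannZeta₀ s := by
        rw [riemannZeta₀, if_neg hs1]; ring
      have e3 : deriv riemannZeta s / riemannZeta s =
          deriv ez s * (ez s)⁻¹ + s⁻¹ - (s - 1)⁻¹ := by
        rw [hd, h5, zeta_ez hs]
        field_simp
        ring
      rw [neg_div, e3, e2]
      ring)
    (fun n => (((DB_ez (n + 1)).2.2.mul (DB_ez_inv n)).neg.add (DB_inv_id n).neg).add
      (DB_zeta0 n).neg) B
  obtain ⟨C, hC, h⟩ := key
  refine ⟨C, hC, fun x hx => ?_⟩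
  have := h x hx
  rwa [← Complex.ofReal_sum, Complex.norm_real, Real.norm_eq_abs] at this

end BS

namespace BS

/-- summatory function -/
noncomputable def Sm (f : ℕ → ℝ) (x : ℝ) : ℝ := ∑ n ∈ Icc 1 ⌊x⌋₊, f n

/-- `1 + log x` -/
noncomputable def el (x : ℝ) : ℝ := 1 + Real.log x

lemma one_le_el {x : ℝ} (hx : 1 ≤ x) : 1 ≤ el x := by
  have := Real.log_nonneg hx
  unfold el; linarith

lemma el_mono {x y : ℝ} (hx : 0 < x) (hxy : x ≤ y) : el x ≤ el y := by
  have := Real.log_le_log hx hxy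
  unfold el; linarith

lemma Icc_one_eq (N : ℕ) : Icc 1 N = Ioc 0 N := by ext; simp [Nat.succ_le_iff]

lemma mem_Icc_floor {x : ℝ} (hx : 0 ≤ x) {n : ℕ} : n ∈ Icc 1 ⌊x⌋₊ ↔ 1 ≤ n ∧ (n : ℝ) ≤ x := by
  rw [mem_Icc, Nat.le_floor_iff hx]

lemma Sm_conv (f g : ArithmeticFunction ℝ) (x : ℝ) :
    Sm (fun n => (f * g) n) x = Sm (fun n => f n * Sm (fun m => g m) (x / n)) x := by
  unfold Sm
  simp only [Icc_one_eq]
  rw [ArithmeticFunction.sum_Ioc_mul_eq_sum_sum]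
  refine sum_congr rfl (fun n hn => ?_)
  rw [Nat.floor_div_natCast]

lemma Sm_nonneg {f : ℕ → ℝ} (h : ∀ n, 0 ≤ f n) (x : ℝ) : 0 ≤ Sm f x := sum_nonneg (fun n _ => h n)

lemma Sm_le {f g : ℕ → ℝ} {x : ℝ} (hx : 0 ≤ x) (h : ∀ n : ℕ, 1 ≤ n → (n : ℝ) ≤ x → f n ≤ g n) :
    Sm f x ≤ Sm g x := sum_le_sum (fun n hn => by
  rw [mem_Icc_floor hx] at hn; exact h n hn.1 hn.2)

lemma Sm_congr {f g : ℕ → ℝ} {x : ℝ} (hx : 0 ≤ x) (h : ∀ n : ℕ, 1 ≤ n → (n : ℝ) ≤ x → f n = g n) :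
    Sm f x = Sm g x := sum_congr rfl (fun n hn => by
  rw [mem_Icc_floor hx] at hn; exact h n hn.1 hn.2)

lemma Sm_abs (f : ℕ → ℝ) (x : ℝ) : |Sm f x| ≤ Sm (fun n => |f n|) x := abs_sum_le_sum_abs _ _

lemma Sm_add (f g : ℕ → ℝ) (x : ℝ) : Sm (fun n => f n + g n) x = Sm f x + Sm g x := sum_add_distrib
lemma Sm_sub (f g : ℕ → ℝ) (x : ℝ) : Sm (fun n => f n - g n) x = Sm f x - Sm g x :=
  sum_sub_distrib _ _
lemma Sm_mul (c : ℝ) (f : ℕ → ℝ) (x : ℝ) : Sm (fun n => c * f n) x = c * Sm f x :=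
  (mul_sum _ _ _).symm

lemma Sm_one_le {x : ℝ} (hx : 0 ≤ x) : Sm (fun _ => 1) x ≤ x := by
  unfold Sm; simp [Nat.floor_le hx]

lemma Sm_one {x : ℝ} : Sm (fun _ => 1) x = ⌊x⌋₊ := by
  unfold Sm; simp

lemma sq_sum (I : ℕ) : ∑ i ∈ range (I + 1), (1 : ℝ) / (i + 1) ^ 2 ≤ 2 - 1 / ((I : ℝ) + 1) := by
  induction I with
  | zero => norm_num
  | succ I ih =>
    rw [sum_range_succ]
    have : (1 : ℝ) / ((I + 1 : ℕ) + 1) ^ 2 ≤ 1 / (I + 1) - 1 / ((I + 1 : ℕ) + 1) := by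
      push_cast
      rw [div_sub_div _ _ (by positivity) (by positivity), div_le_div_iff₀ (by positivity) (by positivity)]
      nlinarith [(Nat.cast_nonneg I : (0 : ℝ) ≤ I)]
    linarith

lemma el_two_pow (i : ℕ) : ((i : ℝ) + 1) / 2 ≤ el (2 ^ i) := by
  unfold el
  rw [Real.log_pow]
  have := Real.log_two_gt_d9
  nlinarith [(Nat.cast_nonneg i : (0 : ℝ) ≤ i)]

lemma conv_bound (v : ℕ → ℝ) (hv : ∀ n, 0 ≤ v n) (m : ℕ) (C : ℝ) (hC : 0 ≤ C)
    (h : ∀ y : ℝ, 1 ≤ y → Sm v y ≤ C * y * el y ^ m) (x : ℝ) (hx : 1 ≤ x) :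
    Sm (fun n => v n * ((x / n) / el (x / n) ^ 2)) x ≤ 16 * C * x * el x ^ m := by
  have hx0 : 0 < x := by linarith
  set I := Nat.log 2 ⌊x⌋₊ with hI
  have hfx : ⌊x⌋₊ ≠ 0 := by
    have := Nat.le_floor (a := x) (n := 1) (by simpa using hx); omega
  set w : ℕ → ℝ := fun i => 2 ^ (i + 1) * (4 * (1 / ((i : ℝ) + 1) ^ 2)) with hw
  have hw0 : ∀ i, 0 ≤ w i := fun i => by simp only [hw]; positivity
  have h1 : Sm (fun n => v n * ((x / n) / el (x / n) ^ 2)) x ≤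
      Sm (fun n => ∑ i ∈ range (I + 1), if n ≤ ⌊x / 2 ^ i⌋₊ then v n * w i else 0) x := by
    refine Sm_le hx0.le (fun n hn hnx => ?_)
    have hn0 : (0 : ℝ) < n := by exact_mod_cast hn
    have hz1 : 1 ≤ x / n := by rwa [one_le_div hn0]
    have hfz : ⌊x / n⌋₊ ≠ 0 := by
      have := Nat.le_floor (a := x / n) (n := 1) (by simpa using hz1); omega
    set i := Nat.log 2 ⌊x / n⌋₊ with hi
    have hi1 : (2 : ℝ) ^ i ≤ x / n := by
      have := Nat.pow_log_le_self 2 hfz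
      have h2 := (Nat.le_floor_iff (by linarith)).1 this
      exact_mod_cast h2
    have hi2 : x / n < 2 ^ (i + 1) := by
      have := Nat.lt_pow_succ_log_self (b := 2) (by norm_num) ⌊x / n⌋₊
      have h2 := (Nat.floor_lt (by linarith)).1 this
      exact_mod_cast h2
    have hiI : i ∈ range (I + 1) := by
      rw [mem_range, Nat.lt_succ_iff]
      refine Nat.log_mono_right (Nat.floor_le_floor (div_le_self hx0.le (by exact_mod_cast hn)))
    have hni : n ≤ ⌊x / 2 ^ i⌋₊ := by
      rw [Nat.le_floor_iff (by positivity), le_div_iff₀ (by positivity)]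
      rw [le_div_iff₀ hn0] at hi1
      linarith
    calc v n * ((x / n) / el (x / n) ^ 2) ≤ v n * w i := by
          refine mul_le_mul_of_nonneg_left ?_ (hv n)
          have e1 : ((i : ℝ) + 1) / 2 ≤ el (x / n) := (el_two_pow i).trans (el_mono (by positivity) hi1)
          calc (x / n) / el (x / n) ^ 2 ≤ 2 ^ (i + 1) / (((i : ℝ) + 1) / 2) ^ 2 := by
                gcongr
            _ = w i := by simp only [hw]; field_simp; norm_num
      _ = if n ≤ ⌊x / 2 ^ i⌋₊ then v n * w i else 0 := by rw [if_pos hni]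
      _ ≤ _ := single_le_sum (f := fun i => if n ≤ ⌊x / 2 ^ i⌋₊ then v n * w i else 0)
          (fun j _ => by
            split_ifs
            · exact mul_nonneg (hv n) (hw0 j)
            · exact le_rfl) hiI
  refine h1.trans ?_
  unfold Sm
  rw [sum_comm]
  have h2 : ∀ i ∈ range (I + 1), ∑ n ∈ Icc 1 ⌊x⌋₊, (if n ≤ ⌊x / 2 ^ i⌋₊ then v n * w i else 0) ≤
      8 * C * x * el x ^ m * (1 / ((i : ℝ) + 1) ^ 2) := by
    intro i hi
    rw [mem_range, Nat.lt_succ_iff] at hi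
    have h3 : (2 : ℝ) ^ i ≤ x := by
      have := (Nat.le_floor_iff hx0.le).1 ((Nat.pow_le_pow_right (by norm_num) hi).trans
        (Nat.pow_log_le_self 2 hfx))
      exact_mod_cast this
    have h4 : 1 ≤ x / 2 ^ i := by rwa [one_le_div (by positivity)]
    have e : ∑ n ∈ Icc 1 ⌊x⌋₊, (if n ≤ ⌊x / 2 ^ i⌋₊ then v n * w i else 0) = Sm v (x / 2 ^ i) * w i := by
      rw [← sum_filter, Sm, sum_mul]
      refine sum_congr ?_ (fun _ _ => rfl)
      ext n
      simp only [mem_filter, mem_Icc]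
      have : ⌊x / 2 ^ i⌋₊ ≤ ⌊x⌋₊ := Nat.floor_le_floor (div_le_self hx0.le (one_le_pow₀ (by norm_num)))
      omega
    rw [e]
    have h5 := h _ h4
    have h6 : el (x / 2 ^ i) ≤ el x := el_mono (by positivity)
      (div_le_self hx0.le (one_le_pow₀ (by norm_num)))
    have h7 := one_le_el h4
    calc Sm v (x / 2 ^ i) * w i ≤ (C * (x / 2 ^ i) * el x ^ m) * w i := by
          refine mul_le_mul_of_nonneg_right (h5.trans ?_) (hw0 i)
          gcongr
      _ = _ := by simp only [hw]; rw [pow_succ]; field_simp; ring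
  refine (sum_le_sum h2).trans ?_
  rw [← mul_sum]
  have h8 := sq_sum I
  have h9 : 0 ≤ 8 * C * x * el x ^ m := by
    have := one_le_el hx
    positivity
  have h10 : (0 : ℝ) ≤ 1 / ((I : ℝ) + 1) := by positivity
  nlinarith

lemma log_le_w {y : ℝ} (hy : 1 ≤ y) : Real.log y ≤ 27 * (y / el y ^ 2) := by
  have h1 := one_le_el hy
  have h0 := Real.log_nonneg hy
  rw [mul_div_assoc', le_div_iff₀ (by positivity)]
  have h2 := log_pow_le 1 y hy
  have h3 := log_pow_le 2 y hy
  have h4 := log_pow_le 3 y hy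
  norm_num [Nat.factorial] at h2 h3 h4
  unfold el
  nlinarith

lemma el_pow_le (m : ℕ) {y : ℝ} (hy : 1 ≤ y) : el y ^ m ≤ 3 * m.factorial * y := by
  have h := Real.pow_div_factorial_le_exp (el y) (by linarith [one_le_el hy]) m
  rw [div_le_iff₀ (by positivity)] at h
  unfold el at h ⊢
  rw [Real.exp_add, Real.exp_log (by linarith)] at h
  have := Real.exp_one_lt_d9
  have h2 : Real.exp 1 * y * m.factorial ≤ 3 * y * m.factorial := by gcongr; linarith
  linarith

lemma el_pow_le_sqrt (m : ℕ) {y : ℝ} (hy : 1 ≤ y) :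
    el y ^ m ≤ 2 ^ m * (3 * m.factorial) * Real.sqrt y := by
  have h := el_pow_le m (Real.one_le_sqrt.2 hy)
  have h1 : el y ≤ 2 * el (Real.sqrt y) := by
    unfold el; rw [Real.log_sqrt (by linarith)]; linarith
  calc el y ^ m ≤ (2 * el (Real.sqrt y)) ^ m := pow_le_pow_left₀ (by linarith [one_le_el hy]) h1 m
    _ = 2 ^ m * el (Real.sqrt y) ^ m := mul_pow _ _ _
    _ ≤ 2 ^ m * (3 * m.factorial * Real.sqrt y) := by gcongr
    _ = _ := by ring

/-- superlogarithmic saving for a summatory function -/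
def Sav (c : ℕ → ℝ) : Prop := ∀ B : ℕ, ∃ C : ℝ, 0 < C ∧ ∀ y : ℝ, 1 ≤ y → |Sm c y| ≤ C * y / el y ^ B

lemma Sav_of (c : ℕ → ℝ) (hc : |c 1| ≤ 1)
    (h : ∀ B : ℕ, ∃ C : ℝ, 0 < C ∧ ∀ x : ℝ, 2 ≤ x →
      |∑ n ∈ Icc 1 ⌊x⌋₊, c n| ≤ C * x / Real.log x ^ B) : Sav c := by
  intro B
  obtain ⟨C, hC, hb⟩ := h B
  refine ⟨C * 3 ^ B + 2 ^ B, by positivity, fun y hy => ?_⟩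
  have h1 := one_le_el hy
  rw [le_div_iff₀ (by positivity)]
  rcases lt_or_ge y 2 with h2 | h2
  · have e : ⌊y⌋₊ = 1 := by rw [Nat.floor_eq_iff (by linarith)]; norm_num; exact ⟨hy, h2⟩
    unfold Sm
    rw [e]
    have h3 : el y ≤ 2 := by
      unfold el; linarith [Real.log_le_sub_one_of_pos (by linarith : 0 < y)]
    simp only [Icc_self, sum_singleton]
    calc |c 1| * el y ^ B ≤ 1 * 2 ^ B := by gcongr
      _ ≤ 2 ^ B * y := by nlinarith [pow_pos (by norm_num : (0 : ℝ) < 2) B]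
      _ ≤ _ := by
        have : 0 ≤ C * 3 ^ B * y := by positivity
        nlinarith
  · have h3 := hb y h2
    have hl : 0 < Real.log y := Real.log_pos (by linarith)
    rw [le_div_iff₀ (by positivity)] at h3
    have h4 : el y ≤ 3 * Real.log y := by
      have := Real.log_le_log (by norm_num) h2
      unfold el; linarith [Real.log_two_gt_d9]
    calc |Sm c y| * el y ^ B ≤ |Sm c y| * (3 * Real.log y) ^ B := by gcongr
      _ = 3 ^ B * (|Sm c y| * Real.log y ^ B) := by rw [mul_pow]; ring
      _ ≤ 3 ^ B * (C * y) := mul_le_mul_of_nonneg_left h3 (by positivity)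
      _ ≤ _ := by
        have : 0 ≤ 2 ^ B * y := by positivity
        nlinarith

lemma Sav_lam : Sav lam := Sav_of _ (by simp [lam_one]) lam_bound
lemma Sav_rr : Sav rr := Sav_of _ (by simp [rr]) rr_bound

end BS

namespace BS

open ArithmeticFunction in
/-- powers of log -/
noncomputable def LL (k : ℕ) : ArithmeticFunction ℝ :=
  ⟨fun n => if n = 0 then 0 else Real.log n ^ k, by simp⟩

lemma LL_apply (k : ℕ) {n : ℕ} (hn : n ≠ 0) : LL k n = Real.log n ^ k := if_neg hn

/-- real Moebius -/
noncomputable def muR : ArithmeticFunction ℝ := (ArithmeticFunction.moebius : ArithmeticFunction ℝ)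
/-- real zeta -/
noncomputable def zeR : ArithmeticFunction ℝ := (ArithmeticFunction.zeta : ArithmeticFunction ℝ)

lemma zeR_apply {n : ℕ} (hn : n ≠ 0) : zeR n = 1 := by
  simp [zeR, ArithmeticFunction.natCoe_apply, hn]

lemma mu_ze : muR * zeR = 1 := ArithmeticFunction.coe_moebius_mul_coe_zeta
lemma ze_mu : zeR * muR = 1 := ArithmeticFunction.coe_zeta_mul_coe_moebius

/-- generalized von Mangoldt as an arithmetic function -/
noncomputable def lk (k : ℕ) : ArithmeticFunction ℝ := muR * LL k

lemma Lambdak_eq (k n : ℕ) : Lambdak k n = lk k n := by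
  rw [lk, ArithmeticFunction.mul_apply, Lambdak,
    Nat.sum_divisorsAntidiagonal (f := fun a b => muR a * LL k b)]
  refine sum_congr rfl (fun d hd => ?_)
  have hd1 := Nat.dvd_of_mem_divisors hd
  have hn : n ≠ 0 := (Nat.mem_divisors.1 hd).2
  have hd0 : d ≠ 0 := fun h => hn (by simpa [h] using hd1)
  have h1 : n / d ≠ 0 := (Nat.div_pos (Nat.le_of_dvd (Nat.pos_of_ne_zero hn) hd1)
    (Nat.pos_of_ne_zero hd0)).ne'
  rw [LL_apply k h1, Nat.cast_div hd1 (by exact_mod_cast hd0)]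
  simp [muR]

lemma ze_lk (k : ℕ) : zeR * lk k = LL k := by rw [lk, ← mul_assoc, ze_mu, one_mul]

/-- multiplication by log -/
noncomputable def Dl (f : ArithmeticFunction ℝ) : ArithmeticFunction ℝ :=
  ArithmeticFunction.log.pmul f

lemma Dl_apply (f : ArithmeticFunction ℝ) (n : ℕ) : Dl f n = Real.log n * f n := rfl

lemma Dl_mul (f g : ArithmeticFunction ℝ) : Dl (f * g) = Dl f * g + f * Dl g := by
  ext n
  rw [ArithmeticFunction.add_apply, Dl_apply, ArithmeticFunction.mul_apply, ArithmeticFunction.mul_apply,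
    ArithmeticFunction.mul_apply, mul_sum, ← sum_add_distrib]
  refine sum_congr rfl (fun x hx => ?_)
  obtain ⟨h1, h2⟩ := Nat.mem_divisorsAntidiagonal.1 hx
  have ha : (x.1 : ℝ) ≠ 0 := by
    have : x.1 ≠ 0 := fun h => h2 (by rw [← h1, h, zero_mul])
    exact_mod_cast this
  have hb : (x.2 : ℝ) ≠ 0 := by
    have : x.2 ≠ 0 := fun h => h2 (by rw [← h1, h, mul_zero])
    exact_mod_cast this
  rw [Dl_apply, Dl_apply, ← h1, Nat.cast_mul, Real.log_mul ha hb]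
  ring

lemma Dl_LL (k : ℕ) : Dl (LL k) = LL (k + 1) := by
  ext n
  rcases eq_or_ne n 0 with h | h
  · simp [h]
  · rw [Dl_apply, LL_apply k h, LL_apply _ h, pow_succ]; ring

lemma Dl_ze : Dl zeR = ArithmeticFunction.log := by
  ext n
  rcases eq_or_ne n 0 with h | h
  · simp [h]
  · rw [Dl_apply, zeR_apply h, mul_one, ArithmeticFunction.log_apply]

lemma Dl_mu : Dl muR = -(ArithmeticFunction.vonMangoldt * muR) := by
  have h1 : Dl (zeR * muR) = 0 := by
    rw [ze_mu]
    ext n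
    rw [Dl_apply]
    rcases eq_or_ne n 1 with h | h
    · simp [h]
    · simp [ArithmeticFunction.one_apply_ne h]
  rw [Dl_mul, Dl_ze] at h1
  have h2 : (ArithmeticFunction.log : ArithmeticFunction ℝ) * muR = ArithmeticFunction.vonMangoldt :=
    ArithmeticFunction.log_mul_moebius_eq_vonMangoldt
  rw [h2] at h1
  have h3 : muR * (ArithmeticFunction.vonMangoldt + zeR * Dl muR) = 0 := by rw [h1, mul_zero]
  rw [mul_add, ← mul_assoc, mu_ze, one_mul] at h3
  rw [mul_comm ArithmeticFunction.vonMangoldt]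
  exact eq_neg_of_add_eq_zero_right h3

lemma lk_succ (k : ℕ) : lk (k + 1) = Dl (lk k) + ArithmeticFunction.vonMangoldt * lk k := by
  have : Dl (lk k) = Dl muR * LL k + muR * LL (k + 1) := by rw [lk, Dl_mul, Dl_LL]
  rw [this, Dl_mu, lk, lk]
  ring

lemma lk_zero : lk 0 = 1 := by
  have : LL 0 = zeR := by
    ext n
    rcases eq_or_ne n 0 with h | h
    · simp [h]
    · rw [LL_apply 0 h, zeR_apply h, pow_zero]
  rw [lk, this, mu_ze]

lemma lk_one : lk 1 = ArithmeticFunction.vonMangoldt := by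
  rw [lk_succ, lk_zero, mul_one]
  have : Dl 1 = 0 := by
    ext n
    rw [Dl_apply]
    rcases eq_or_ne n 1 with h | h
    · simp [h]
    · simp [ArithmeticFunction.one_apply_ne h]
  rw [this, zero_add]

lemma lk_nonneg (k n : ℕ) : 0 ≤ lk k n := by
  induction k generalizing n with
  | zero =>
    rw [lk_zero, ArithmeticFunction.one_apply]; split_ifs <;> norm_num
  | succ k ih =>
    rw [lk_succ, ArithmeticFunction.add_apply, Dl_apply, ArithmeticFunction.mul_apply]
    refine add_nonneg (mul_nonneg (Real.log_natCast_nonneg n) (ih n)) (sum_nonneg (fun x _ => ?_))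
    exact mul_nonneg ArithmeticFunction.vonMangoldt_nonneg (ih _)

lemma lk_le (k : ℕ) {n : ℕ} (hn : n ≠ 0) : lk k n ≤ Real.log n ^ k := by
  rw [← LL_apply k hn, ← ze_lk, ArithmeticFunction.mul_apply]
  have := single_le_sum (f := fun x : ℕ × ℕ => zeR x.1 * lk k x.2) (s := n.divisorsAntidiagonal)
    (fun x hx => mul_nonneg (by
      rcases eq_or_ne x.1 0 with h | h
      · simp [h]
      · rw [zeR_apply h]; norm_num) (lk_nonneg _ _))
    (a := (1, n)) (Nat.mem_divisorsAntidiagonal.2 ⟨one_mul _, hn⟩)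
  simpa [zeR_apply] using this

lemma sum_div_prime (F : ℕ → ℝ) {q l : ℕ} (hq : q.Prime) (hl : l ≠ 0) (hql : ¬ q ∣ l) :
    ∑ d ∈ (q * l).divisors, F d = ∑ d ∈ l.divisors, (F d + F (q * d)) := by
  have e : (q * l).divisors = l.divisors ∪ l.divisors.image (q * ·) := by
    ext d
    simp only [mem_union, mem_image, Nat.mem_divisors]
    constructor
    · rintro ⟨h1, h2⟩
      by_cases hd : q ∣ d
      · right
        obtain ⟨e, rfl⟩ := hd
        exact ⟨e, ⟨Nat.dvd_of_mul_dvd_mul_left hq.pos h1, hl⟩, rfl⟩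
      · left
        exact ⟨((Nat.Prime.coprime_iff_not_dvd hq).2 hd).symm.dvd_of_dvd_mul_left h1, hl⟩
    · rintro (⟨h1, h2⟩ | ⟨e, ⟨h1, h2⟩, rfl⟩)
      · exact ⟨h1.mul_left q, mul_ne_zero hq.ne_zero hl⟩
      · exact ⟨Nat.mul_dvd_mul_left q h1, mul_ne_zero hq.ne_zero hl⟩
  rw [e, sum_union, sum_image, sum_add_distrib]
  · intro a _ b _ h
    exact Nat.eq_of_mul_eq_mul_left hq.pos h
  · rw [disjoint_left]
    intro d hd hd2
    obtain ⟨e, he, rfl⟩ := mem_image.1 hd2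
    exact hql ((Nat.dvd_mul_right q e).trans (Nat.dvd_of_mem_divisors hd))

/-- main formula -/
noncomputable def lk' (k q l : ℕ) : ℝ :=
  ∑ j ∈ range k, (k.choose j : ℝ) * Real.log q ^ (k - j) * lk j l

lemma lk_prime_mul (k : ℕ) {q l : ℕ} (hq : q.Prime) (hl : l ≠ 0) (hql : ¬ q ∣ l) :
    lk k (q * l) = lk' k q l := by
  have hq0 : (q : ℝ) ≠ 0 := by exact_mod_cast hq.ne_zero
  have hl0 : (l : ℝ) ≠ 0 := by exact_mod_cast hl
  rw [← Lambdak_eq, Lambdak, sum_div_prime _ hq hl hql, lk']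
  simp only [← Lambdak_eq, Lambdak, mul_sum]
  rw [sum_comm]
  refine sum_congr rfl (fun d hd => ?_)
  have hd1 := Nat.dvd_of_mem_divisors hd
  have hd0 : d ≠ 0 := fun h => hl (by simpa [h] using hd1)
  have hd0' : (d : ℝ) ≠ 0 := by exact_mod_cast hd0
  have hcop : q.Coprime d := (Nat.Prime.coprime_iff_not_dvd hq).2 (fun h => hql (h.trans hd1))
  rw [ArithmeticFunction.isMultiplicative_moebius.map_mul_of_coprime hcop,
    ArithmeticFunction.moebius_apply_prime hq]
  push_cast
  rw [mul_div_mul_left _ _ hq0, mul_div_assoc, Real.log_mul hq0 (div_ne_zero hl0 hd0'),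
    add_comm (Real.log q), add_pow, sum_range_succ, mul_add, mul_sum, Nat.sub_self, pow_zero,
    Nat.choose_self, Nat.cast_one, mul_one, mul_one]
  rw [add_assoc, add_eq_left.2 (by ring)]
  exact sum_congr rfl (fun j _ => by ring)

end BS

namespace BS

/-- rr as arithmetic function -/
noncomputable def rrA : ArithmeticFunction ℝ := ⟨rr, by simp [rr]⟩

lemma vM_eq : ArithmeticFunction.vonMangoldt = rrA + zeR := by
  ext n
  rcases eq_or_ne n 0 with h | h
  · simp [h]
  · rw [ArithmeticFunction.add_apply, zeR_apply h]
    change _ = rr n + 1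
    rw [rr, if_neg h]; ring

lemma floor_err {x : ℝ} (hx : 1 ≤ x) : |(⌊x⌋₊ : ℝ) - x| ≤ 1 := by
  have h1 := Nat.floor_le (by linarith : 0 ≤ x)
  have h2 := Nat.lt_floor_add_one x
  rw [abs_le]; constructor <;> linarith

lemma Sm_vM (x : ℝ) (hx : 1 ≤ x) :
    Sm (fun n => ArithmeticFunction.vonMangoldt n) x = Sm rr x + ⌊x⌋₊ := by
  rw [← Sm_one, ← Sm_add]
  refine Sm_congr (by linarith) (fun n hn _ => ?_)
  rw [rr, if_neg (by omega)]; ring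

lemma pow_diff_le (m : ℕ) {a b : ℝ} (ha : 0 ≤ a) (hab : a ≤ b) :
    b ^ (m + 1) - a ^ (m + 1) ≤ (m + 1) * (b - a) * b ^ m := by
  induction m with
  | zero => simp
  | succ m ih =>
    have e : b ^ (m + 1 + 1) - a ^ (m + 1 + 1) = b * (b ^ (m + 1) - a ^ (m + 1)) + (b - a) * a ^ (m + 1) := by
      ring
    have h1 : a ^ (m + 1) ≤ b ^ (m + 1) := pow_le_pow_left₀ ha hab _
    have hb : 0 ≤ b := ha.trans hab
    rw [e]
    calc b * (b ^ (m + 1) - a ^ (m + 1)) + (b - a) * a ^ (m + 1)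
        ≤ b * ((m + 1) * (b - a) * b ^ m) + (b - a) * b ^ (m + 1) := by
          have : 0 ≤ b - a := by linarith
          gcongr
      _ = _ := by push_cast; ring

lemma Sm_LL (k : ℕ) (x : ℝ) (hx : 1 ≤ x) :
    |Sm (fun n => LL (k + 1) n) x - x * el x ^ (k + 1)| ≤ (433 * (k + 1) + 3) * x * el x ^ k := by
  have hx0 : 0 < x := by linarith
  have hel := one_le_el hx
  have h1 : |(⌊x⌋₊ : ℝ) * el x ^ (k + 1) - x * el x ^ (k + 1)| ≤ 3 * x * el x ^ k := by
    rw [← sub_mul, abs_mul, abs_of_nonneg (by positivity : 0 ≤ el x ^ (k + 1))]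
    have h2 := el_pow_le 1 hx
    norm_num at h2
    calc |(⌊x⌋₊ : ℝ) - x| * el x ^ (k + 1) ≤ 1 * el x ^ (k + 1) := by
          gcongr; exact floor_err hx
      _ = el x * el x ^ k := by ring
      _ ≤ _ := by gcongr
  have h2 : |Sm (fun n => LL (k + 1) n) x - (⌊x⌋₊ : ℝ) * el x ^ (k + 1)| ≤
      433 * (k + 1) * x * el x ^ k := by
    have e : (⌊x⌋₊ : ℝ) * el x ^ (k + 1) = Sm (fun _ => el x ^ (k + 1)) x := by
      unfold Sm; simp
    rw [e, ← Sm_sub]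
    refine (Sm_abs _ _).trans ?_
    have h3 : Sm (fun n => |LL (k + 1) n - el x ^ (k + 1)|) x ≤
        Sm (fun n => (k + 1) * el x ^ k * (1 + 27 * (1 * ((x / n) / el (x / n) ^ 2)))) x := by
      refine Sm_le hx0.le (fun n hn hnx => ?_)
      have hn0 : (0 : ℝ) < n := by exact_mod_cast hn
      have hz1 : 1 ≤ x / n := by rwa [one_le_div hn0]
      rw [LL_apply _ (by omega)]
      have ha := Real.log_natCast_nonneg n
      have hab : Real.log n ≤ el x := by
        have := Real.log_le_log hn0 hnx
        unfold el; linarith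
      have h4 := pow_diff_le k ha hab
      have h5 : Real.log n ^ (k + 1) ≤ el x ^ (k + 1) := pow_le_pow_left₀ ha hab _
      rw [abs_sub_comm, abs_of_nonneg (by linarith)]
      refine h4.trans ?_
      have h6 : el x - Real.log n = 1 + Real.log (x / n) := by
        rw [Real.log_div hx0.ne' hn0.ne']; unfold el; ring
      rw [h6]
      have h7 := log_le_w hz1
      calc (k + 1 : ℝ) * (1 + Real.log (x / n)) * el x ^ k
          = (k + 1) * el x ^ k * (1 + Real.log (x / n)) := by ring
        _ ≤ _ := by gcongr; linarith
    refine h3.trans ?_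
    rw [Sm_mul, Sm_add, Sm_mul]
    have h8 := conv_bound (fun _ => 1) (fun _ => zero_le_one) 0 1 zero_le_one
      (fun y hy => by rw [pow_zero]; linarith [Sm_one_le (by linarith : 0 ≤ y)]) x hx
    have h9 := Sm_one_le hx0.le
    rw [pow_zero] at h8
    calc (k + 1 : ℝ) * el x ^ k * (Sm (fun _ => 1) x + 27 * Sm (fun n => 1 * ((x / n) / el (x / n) ^ 2)) x)
        ≤ (k + 1) * el x ^ k * (x + 27 * (16 * 1 * x * 1)) := by gcongr
      _ = _ := by ring
  have h3 := abs_add_le (Sm (fun n => LL (k + 1) n) x - (⌊x⌋₊ : ℝ) * el x ^ (k + 1))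
    ((⌊x⌋₊ : ℝ) * el x ^ (k + 1) - x * el x ^ (k + 1))
  rw [sub_add_sub_cancel] at h3
  linarith


lemma conv_abs (v : ℕ → ℝ) (m : ℕ) (C : ℝ) (hC : 0 ≤ C)
    (h : ∀ y : ℝ, 1 ≤ y → Sm (fun n => |v n|) y ≤ C * y * el y ^ m) (G : ℝ → ℝ) (D : ℝ) (hD : 0 ≤ D)
    (hG : ∀ y : ℝ, 1 ≤ y → |G y| ≤ D * (y / el y ^ 2)) (x : ℝ) (hx : 1 ≤ x) :
    |Sm (fun n => v n * G (x / n)) x| ≤ 16 * D * C * x * el x ^ m := by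
  have h1 := conv_bound (fun n => |v n|) (fun _ => abs_nonneg _) m C hC h x hx
  refine (Sm_abs _ _).trans ?_
  have h2 : Sm (fun n => |v n * G (x / n)|) x ≤
      Sm (fun n => D * (|v n| * ((x / n) / el (x / n) ^ 2))) x := by
    refine Sm_le (by linarith) (fun n hn hnx => ?_)
    have hn0 : (0 : ℝ) < n := by exact_mod_cast hn
    have hz1 : 1 ≤ x / n := by rwa [one_le_div hn0]
    rw [abs_mul]
    calc |v n| * |G (x / n)| ≤ |v n| * (D * ((x / n) / el (x / n) ^ 2)) := by gcongr; exact hG _ hz1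
      _ = _ := by ring
  refine h2.trans ?_
  rw [Sm_mul]
  calc D * Sm (fun n => |v n| * ((x / n) / el (x / n) ^ 2)) x ≤ D * (16 * C * x * el x ^ m) := by gcongr
    _ = _ := by ring

set_option maxHeartbeats 1000000 in
theorem VK (k : ℕ) : ∃ C : ℝ, 0 < C ∧ ∀ x : ℝ, 1 ≤ x →
    |Sm (fun n => lk (k + 1) n) x - (k + 1) * x * el x ^ k| * el x ≤ C * x * el x ^ k := by
  obtain ⟨C1, hC1, hr⟩ := Sav_rr 2
  induction k with
  | zero =>
    refine ⟨C1 + 3, by positivity, fun x hx => ?_⟩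
    have hel := one_le_el hx
    rw [zero_add, lk_one, Sm_vM x hx]
    have h1 := hr x hx
    have h2 := floor_err hx
    have h3 := el_pow_le 1 hx
    norm_num at h3 ⊢
    have h4 : |Sm rr x| * el x ≤ C1 * x := by
      rw [le_div_iff₀ (by positivity)] at h1
      refine le_trans ?_ h1
      gcongr
      nlinarith
    have h5 : |Sm rr x + ⌊x⌋₊ - x| ≤ |Sm rr x| + 1 := by
      rw [add_sub_assoc]; exact (abs_add_le _ _).trans (by linarith)
    calc |Sm rr x + ⌊x⌋₊ - x| * el x ≤ (|Sm rr x| + 1) * el x := by gcongr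
      _ ≤ _ := by linarith
  | succ k ih =>
    obtain ⟨C, hC, h⟩ := ih
    obtain ⟨D, hD⟩ : ∃ D : ℝ, D = k + 1 + C := ⟨_, rfl⟩
    have hD0 : 0 < D := by rw [hD]; positivity
    have hv : ∀ x : ℝ, 1 ≤ x → Sm (fun n => |lk (k + 1) n|) x ≤ D * x * el x ^ k := by
      intro x hx
      have hel := one_le_el hx
      have h1 := h x hx
      simp only [abs_of_nonneg (lk_nonneg _ _)]
      have h2 : |Sm (fun n => lk (k + 1) n) x - (k + 1) * x * el x ^ k| ≤ C * x * el x ^ k :=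
        (le_mul_of_one_le_right (abs_nonneg _) hel).trans h1
      rw [hD]
      have := (abs_le.1 h2).2
      linarith
    refine ⟨C + D + 16 * 27 * D + (433 * (k + 1) + 3) + 16 * C1 * D, by positivity, fun x hx => ?_⟩
    have hx0 : 0 < x := by linarith
    have hel := one_le_el hx
    clear hD
    have hrA : Sm (fun m => rrA m) = Sm rr := rfl
    have e0 : Sm (fun n => lk (k + 1 + 1) n) x =
        (el x * Sm (fun n => lk (k + 1) n) x - Sm (fun n => lk (k + 1) n) x
          - Sm (fun n => lk (k + 1) n * Real.log (x / n)) x) +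
        (Sm (fun n => lk (k + 1) n * Sm rr (x / n)) x + Sm (fun n => LL (k + 1) n) x) := by
      rw [lk_succ (k + 1), vM_eq, add_mul, ze_lk, mul_comm rrA]
      have e1 : Sm (fun n => lk (k + 1) n * Sm rr (x / n)) x = Sm (fun n => (lk (k + 1) * rrA) n) x :=
        by rw [Sm_conv (lk (k+1)) rrA x, hrA]
      rw [e1, ← Sm_add, ← Sm_mul, ← Sm_sub, ← Sm_sub, ← Sm_add]
      refine Sm_congr hx0.le (fun n hn _ => ?_)
      have hn0 : (0 : ℝ) < n := by exact_mod_cast hn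
      rw [ArithmeticFunction.add_apply, ArithmeticFunction.add_apply, Dl_apply,
        Real.log_div hx0.ne' hn0.ne', el]
      ring
    have b1 := conv_abs (fun n => lk (k + 1) n) k D hD0.le hv Real.log 27 (by norm_num)
      (fun y hy => by rw [abs_of_nonneg (Real.log_nonneg hy)]; exact log_le_w hy) x hx
    have b2 := conv_abs (fun n => lk (k + 1) n) k D hD0.le hv (Sm rr) C1 hC1.le
      (fun y hy => by rw [mul_div_assoc']; exact hr y hy) x hx
    have b3 := Sm_LL k x hx
    have b4 := hv x hx
    simp only [abs_of_nonneg (lk_nonneg _ _)] at b4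
    have b5 : 0 ≤ Sm (fun n => lk (k + 1) n) x := Sm_nonneg (fun n => lk_nonneg _ n) x
    have b6 : |el x * Sm (fun n => lk (k + 1) n) x - (k + 1) * x * el x ^ (k + 1)| ≤ C * x * el x ^ k := by
      have := h x hx
      rw [show el x * Sm (fun n => lk (k + 1) n) x - (k + 1) * x * el x ^ (k + 1) =
        (Sm (fun n => lk (k + 1) n) x - (k + 1) * x * el x ^ k) * el x by ring, abs_mul,
        abs_of_nonneg (by linarith : 0 ≤ el x)]
      exact this
    have b7 : |Sm (fun n => lk (k + 1 + 1) n) x - ((k + 1 : ℕ) + 1) * x * el x ^ (k + 1)| ≤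
        (C + D + 16 * 27 * D + (433 * (k + 1) + 3) + 16 * C1 * D) * x * el x ^ k := by
      rw [e0, abs_le]
      rw [abs_le] at b1 b2 b3 b6
      push_cast
      obtain ⟨c1, c2⟩ := b1
      obtain ⟨c3, c4⟩ := b2
      obtain ⟨c5, c6⟩ := b3
      obtain ⟨c7, c8⟩ := b6
      generalize Sm (fun n => lk (k + 1) n * Real.log (x / n)) x = s1 at *
      generalize Sm (fun n => lk (k + 1) n * Sm rr (x / n)) x = s2 at *
      generalize Sm (fun n => LL (k + 1) n) x = s3 at *
      generalize Sm (fun n => lk (k + 1) n) x = s4 at *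
      clear hv h e0 hr hrA
      constructor <;> linarith
    calc _ ≤ ((C + D + 16 * 27 * D + (433 * (k + 1) + 3) + 16 * C1 * D) * x * el x ^ k) * el x := by
          gcongr
      _ = _ := by ring

lemma Sm_lt_one (c : ℕ → ℝ) {z : ℝ} (hz : z < 1) : Sm c z = 0 := by
  unfold Sm
  rw [Nat.floor_eq_zero.2 hz]; simp

lemma Sav_sup {c : ℕ → ℝ} (h : Sav c) (B : ℕ) : ∃ C : ℝ, 0 < C ∧ ∀ y : ℝ, 1 ≤ y → ∀ z ≤ y,
    |Sm c z| ≤ C * y / el y ^ B := by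
  obtain ⟨C0, hC0, h0⟩ := h 0
  obtain ⟨C, hC, hb⟩ := h B
  refine ⟨C0 * (2 ^ B * (3 * B.factorial)) + C * 2 ^ B, by positivity, fun y hy z hz => ?_⟩
  have hel := one_le_el hy
  rw [le_div_iff₀ (by positivity)]
  rcases lt_or_ge z 1 with h1 | h1
  · rw [Sm_lt_one c h1, abs_zero, zero_mul]; positivity
  rcases le_or_gt z (Real.sqrt y) with h2 | h2
  · have h3 := h0 z h1
    rw [pow_zero, div_one] at h3
    have h4 := el_pow_le_sqrt B hy
    have h5 := Real.mul_self_sqrt (by linarith : 0 ≤ y)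
    calc |Sm c z| * el y ^ B ≤ (C0 * Real.sqrt y) * (2 ^ B * (3 * B.factorial) * Real.sqrt y) := by
          gcongr
          exact h3.trans (by gcongr)
      _ = C0 * (2 ^ B * (3 * B.factorial)) * (Real.sqrt y * Real.sqrt y) := by ring
      _ = C0 * (2 ^ B * (3 * B.factorial)) * y := by rw [h5]
      _ ≤ _ := by
        have : 0 ≤ C * 2 ^ B * y := by positivity
        nlinarith
  · have h3 := hb z h1
    have h6 := one_le_el h1
    rw [le_div_iff₀ (by positivity)] at h3
    have h4 : el y ≤ 2 * el z := by
      have := Real.log_le_log (Real.sqrt_pos.2 (by linarith)) h2.le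
      rw [Real.log_sqrt (by linarith)] at this
      unfold el; linarith
    calc |Sm c z| * el y ^ B ≤ |Sm c z| * (2 * el z) ^ B := by gcongr
      _ = 2 ^ B * (|Sm c z| * el z ^ B) := by rw [mul_pow]; ring
      _ ≤ 2 ^ B * (C * z) := mul_le_mul_of_nonneg_left h3 (by positivity)
      _ ≤ 2 ^ B * (C * y) := by gcongr
      _ ≤ _ := by
        have : 0 ≤ C0 * (2 ^ B * (3 * B.factorial)) * y := by positivity
        nlinarith

lemma abel_mono (g b : ℕ → ℝ) (hg : Monotone g) (hg0 : ∀ i, 0 ≤ g i) (M : ℝ) (n : ℕ)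
    (hS : ∀ k ≤ n, |∑ i ∈ range k, b i| ≤ M) :
    |∑ i ∈ range n, g i * b i| ≤ 2 * M * g n := by
  have hM : 0 ≤ M := (abs_nonneg _).trans (hS 0 (Nat.zero_le _))
  have h1 := abel_bound (fun i => g n - g (min i n)) (fun i => (b i : ℂ))
    (fun i j hij => by
      have := hg (min_le_min_right n hij)
      simp only; linarith)
    (fun i => by have := hg (min_le_right i n); linarith) M n (fun k hk => by
      rw [← Complex.ofReal_sum, Complex.norm_real, Real.norm_eq_abs]; exact hS k hk)
  simp only [← Complex.ofReal_mul] at h1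
  rw [← Complex.ofReal_sum, Complex.norm_real, Real.norm_eq_abs] at h1
  have e : ∑ i ∈ range n, (g n - g (min i n)) * b i = g n * ∑ i ∈ range n, b i - ∑ i ∈ range n, g i * b i := by
    rw [mul_sum, ← sum_sub_distrib]
    refine sum_congr rfl (fun i hi => ?_)
    rw [min_eq_left (mem_range.1 hi).le]; ring
  rw [e] at h1
  have h2 : |g n * ∑ i ∈ range n, b i| ≤ g n * M := by
    rw [abs_mul, abs_of_nonneg (hg0 n)]; exact mul_le_mul_of_nonneg_left (hS n le_rfl) (hg0 n)
  have h3 : M * (g n - g (min 0 n)) ≤ M * g n := by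
    have := hg0 (min 0 n)
    exact mul_le_mul_of_nonneg_left (by linarith) hM
  rw [abs_le] at h1 h2 ⊢
  constructor <;> linarith

lemma Sav_mul_log {c : ℕ → ℝ} (h : Sav c) (k : ℕ) : Sav (fun n => c n * Real.log n ^ k) := by
  intro B
  obtain ⟨C, hC, hb⟩ := Sav_sup h (B + k)
  refine ⟨2 * C, by positivity, fun y hy => ?_⟩
  have hel := one_le_el hy
  have e : ∀ (f : ℕ → ℝ) (N : ℕ), ∑ n ∈ Icc 1 N, f n = ∑ i ∈ range N, f (i + 1) := by
    intro f N
    rw [range_eq_Ico, Finset.sum_Ico_add' f 0 N 1]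
    refine sum_congr ?_ (fun _ _ => rfl)
    ext; simp only [mem_Icc, mem_Ico]; omega
  rcases Nat.eq_zero_or_pos ⌊y⌋₊ with h0 | h0
  · exfalso
    have := Nat.le_floor (a := y) (n := 1) (by simpa using hy); omega
  set N := ⌊y⌋₊ with hN
  have hNy : (N : ℝ) ≤ y := Nat.floor_le (by linarith)
  have h1 := abel_mono (fun i => Real.log ((min (i + 1) N : ℕ) : ℝ) ^ k) (fun i => c (i + 1))
    (fun i j hij => by
      simp only
      have : min (i + 1) N ≤ min (j + 1) N := min_le_min_right _ (by omega)
      have h2 : (0 : ℝ) < (min (i + 1) N : ℕ) := by exact_mod_cast lt_min (by omega) h0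
      exact pow_le_pow_left₀ (Real.log_natCast_nonneg _)
        (Real.log_le_log h2 (by exact_mod_cast this)) k)
    (fun i => pow_nonneg (Real.log_natCast_nonneg _) _) (C * y / el y ^ (B + k)) N
    (fun m hm => by
      rw [← e]
      have := hb y hy (m : ℝ) (le_trans (by exact_mod_cast hm) hNy)
      rwa [Sm, Nat.floor_natCast] at this)
  have e2 : Sm (fun n => c n * Real.log n ^ k) y =
      ∑ i ∈ range N, Real.log ((min (i + 1) N : ℕ) : ℝ) ^ k * c (i + 1) := by
    rw [Sm, e]
    refine sum_congr rfl (fun i hi => ?_)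
    rw [min_eq_left (by have := mem_range.1 hi; omega), mul_comm]
  rw [e2]
  refine h1.trans ?_
  rw [min_eq_right (by omega)]
  have h3 : Real.log N ^ k ≤ el y ^ k := by
    refine pow_le_pow_left₀ (Real.log_natCast_nonneg _) ?_ k
    have := Real.log_le_log (by exact_mod_cast h0 : (0 : ℝ) < N) hNy
    unfold el; linarith
  calc 2 * (C * y / el y ^ (B + k)) * Real.log N ^ k ≤ 2 * (C * y / el y ^ (B + k)) * el y ^ k := by
        gcongr
    _ = 2 * C * y / el y ^ B := by rw [pow_add]; field_simp

end BS

namespace BS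

/-- von Mangoldt off primes -/
noncomputable def np (n : ℕ) : ℝ := if n.Prime then 0 else ArithmeticFunction.vonMangoldt n

lemma np_nonneg (n : ℕ) : 0 ≤ np n := by
  unfold np; split_ifs
  · exact le_rfl
  · exact ArithmeticFunction.vonMangoldt_nonneg

lemma Sm_np (x : ℝ) : Sm np x = Chebyshev.psi x - Chebyshev.theta x := by
  rw [Chebyshev.psi_sub_theta_eq_sum_not_prime, Sm, Icc_one_eq, sum_filter]
  refine sum_congr rfl (fun n _ => ?_)
  unfold np; split_ifs <;> simp_all

lemma Sav_np : Sav np := by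
  intro B
  refine ⟨2 * (2 ^ (B + 1) * (3 * (B + 1).factorial)), by positivity, fun y hy => ?_⟩
  have hel := one_le_el hy
  rw [le_div_iff₀ (by positivity), abs_of_nonneg (Sm_nonneg np_nonneg y), Sm_np]
  have h1 := Chebyshev.psi_sub_theta_le hy
  have h2 := el_pow_le_sqrt (B + 1) hy
  have h5 := Real.mul_self_sqrt (by linarith : 0 ≤ y)
  have h3 : Real.log y ≤ el y := by unfold el; linarith
  calc (Chebyshev.psi y - Chebyshev.theta y) * el y ^ B ≤ (2 * Real.sqrt y * el y) * el y ^ B := by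
        gcongr; exact h1.trans (by gcongr)
    _ = 2 * Real.sqrt y * el y ^ (B + 1) := by ring
    _ ≤ 2 * Real.sqrt y * (2 ^ (B + 1) * (3 * (B + 1).factorial) * Real.sqrt y) := by gcongr
    _ = 2 * (2 ^ (B + 1) * (3 * (B + 1).factorial)) * (Real.sqrt y * Real.sqrt y) := by ring
    _ = _ := by rw [h5]

lemma Sav_of_le {c d : ℕ → ℝ} (M : ℝ) (h : Sav c) (hc : ∀ y : ℝ, 1 ≤ y → |Sm d y| ≤ M * |Sm c y|) : Sav d := by
  intro B
  obtain ⟨C, hC, hb⟩ := h B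
  refine ⟨(|M| + 1) * C, by positivity, fun y hy => ?_⟩
  have := hb y hy
  have hel := one_le_el hy
  refine (hc y hy).trans ?_
  calc M * |Sm c y| ≤ (|M| + 1) * (C * y / el y ^ B) := by
        gcongr; linarith [le_abs_self M]
    _ = _ := by ring

lemma Sav_add {c d : ℕ → ℝ} (h : Sav c) (h' : Sav d) : Sav (fun n => c n + d n) := by
  intro B
  obtain ⟨C, hC, hb⟩ := h B
  obtain ⟨D, hD, hb2⟩ := h' B
  refine ⟨C + D, by positivity, fun y hy => ?_⟩
  rw [Sm_add]
  refine (abs_add_le _ _).trans ((add_le_add (hb y hy) (hb2 y hy)).trans_eq ?_)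
  ring

lemma Sav_sub {c d : ℕ → ℝ} (h : Sav c) (h' : Sav d) : Sav (fun n => c n - d n) := by
  intro B
  obtain ⟨C, hC, hb⟩ := h B
  obtain ⟨D, hD, hb2⟩ := h' B
  refine ⟨C + D, by positivity, fun y hy => ?_⟩
  rw [Sm_sub]
  refine (abs_sub _ _).trans ((add_le_add (hb y hy) (hb2 y hy)).trans_eq ?_)
  ring

lemma Sav_congr {c d : ℕ → ℝ} (h : Sav c) (hcd : ∀ n ≠ 0, c n = d n) : Sav d := by
  refine Sav_of_le 1 h (fun y hy => ?_)
  rw [one_mul, Sm_congr (by linarith) (fun n hn _ => hcd n (by omega))]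

/-- prime weights minus one -/
noncomputable def pr (n : ℕ) : ℝ := (if n.Prime then Real.log n else 0) - 1

lemma Sav_pr : Sav pr := by
  refine Sav_congr (Sav_sub Sav_rr Sav_np) (fun n hn => ?_)
  unfold rr np pr
  rw [if_neg hn]
  split_ifs with h
  · rw [ArithmeticFunction.vonMangoldt_apply_prime h]; ring
  · ring

lemma Sav_lv : Sav (fun n => (lam n + 1) * ArithmeticFunction.vonMangoldt n) := by
  refine Sav_of_le 2 Sav_np (fun y hy => ?_)
  rw [abs_of_nonneg (Sm_nonneg np_nonneg y), ← Sm_mul]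
  refine (Sm_abs _ _).trans (Sm_le (by linarith) (fun n hn _ => ?_))
  unfold np
  split_ifs with h
  · rw [lam_prime h]; simp
  · rw [abs_mul, abs_of_nonneg ArithmeticFunction.vonMangoldt_nonneg]
    gcongr
    have := abs_lam_le n
    exact (abs_add_le _ _).trans (by rw [abs_one]; linarith)

lemma Sav_lamv : Sav (fun n => lam n * ArithmeticFunction.vonMangoldt n + 1) := by
  refine Sav_congr (Sav_sub Sav_lv Sav_rr) (fun n hn => ?_)
  unfold rr
  rw [if_neg hn]; ring

/-- lambda times mu -/
noncomputable def lmA : ArithmeticFunction ℝ := ⟨fun n => lam n * muR n, by simp⟩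
/-- lambda times log power -/
noncomputable def llA (k : ℕ) : ArithmeticFunction ℝ := ⟨fun n => lam n * LL k n, by simp⟩

lemma lam_lk (k n : ℕ) : lam n * lk k n = (lmA * llA k) n := by
  rw [lk, ArithmeticFunction.mul_apply, ArithmeticFunction.mul_apply, mul_sum]
  refine sum_congr rfl (fun p hp => ?_)
  obtain ⟨h1, h2⟩ := Nat.mem_divisorsAntidiagonal.1 hp
  change _ = (lam p.1 * muR p.1) * (lam p.2 * LL k p.2)
  rw [← h1, lam_mul]; ring

lemma abs_mu_le (n : ℕ) : |muR n| ≤ 1 := by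
  unfold muR
  rw [ArithmeticFunction.intCoe_apply]
  exact_mod_cast ArithmeticFunction.abs_moebius_le_one

theorem VL (k : ℕ) : ∃ C : ℝ, 0 < C ∧ ∀ x : ℝ, 1 ≤ x →
    |Sm (fun n => lam n * lk k n) x + (if k = 1 then x else 0)| * el x ^ 2 ≤ C * x * el x ^ k := by
  rcases Nat.lt_or_ge k 2 with hk | hk
  · interval_cases k
    · refine ⟨6, by norm_num, fun x hx => ?_⟩
      have h1 := el_pow_le 2 hx
      have h2 : |Sm (fun n => lam n * lk 0 n) x| ≤ 1 := by
        rw [lk_zero]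
        refine (Sm_abs _ _).trans ?_
        have : Sm (fun n => |lam n * (1 : ArithmeticFunction ℝ) n|) x ≤ Sm (fun n => if n = 1 then 1 else 0) x := by
          refine Sm_le (by linarith) (fun n hn _ => ?_)
          rw [ArithmeticFunction.one_apply]
          split_ifs with h
          · rw [mul_one]; exact abs_lam_le n
          · simp
        refine this.trans ?_
        unfold Sm
        rw [sum_ite_eq']
        split_ifs <;> norm_num
      norm_num [Nat.factorial] at h1 ⊢
      have h3 : 0 ≤ el x ^ 2 := by positivity
      nlinarith
    · obtain ⟨C, hC, hb⟩ := Sav_lamv 1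
      refine ⟨C + 3, by positivity, fun x hx => ?_⟩
      have h0 := hb x hx
      have h1 := el_pow_le 1 hx
      have hel := one_le_el hx
      rw [Sm_add, Sm_one, pow_one, le_div_iff₀ (by positivity)] at h0
      have h2 := floor_err hx
      norm_num at h1
      simp only [if_true, lk_one, pow_one]
      have h3 : |Sm (fun n => lam n * ArithmeticFunction.vonMangoldt n) x + x| ≤
        |Sm (fun n => lam n * ArithmeticFunction.vonMangoldt n) x + ⌊x⌋₊| + 1 := by
        rw [show Sm (fun n => lam n * ArithmeticFunction.vonMangoldt n) x + x =
          (Sm (fun n => lam n * ArithmeticFunction.vonMangoldt n) x + ⌊x⌋₊) - (⌊x⌋₊ - x) by ring]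
        exact (abs_sub _ _).trans (by linarith)
      calc _ ≤ (|Sm (fun n => lam n * ArithmeticFunction.vonMangoldt n) x + ⌊x⌋₊| + 1) * el x ^ 2 := by
            gcongr
        _ = (|Sm (fun n => lam n * ArithmeticFunction.vonMangoldt n) x + ⌊x⌋₊| * el x + el x) * el x := by ring
        _ ≤ (C * x + 3 * x) * el x := by gcongr
        _ = _ := by ring
  · obtain ⟨C, hC, hb⟩ := Sav_mul_log Sav_lam k 2
    refine ⟨16 * C, by positivity, fun x hx => ?_⟩
    have hel := one_le_el hx
    rw [if_neg (by omega), add_zero]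
    simp only [lam_lk]
    rw [Sm_conv]
    have h1 := conv_abs (fun n => lmA n) 0 1 zero_le_one (fun y hy => by
      rw [pow_zero, mul_one, one_mul]
      refine le_trans (Sm_le (by linarith) (fun n _ _ => ?_)) (Sm_one_le (by linarith))
      change |lam n * muR n| ≤ 1
      rw [abs_mul]
      exact mul_le_one₀ (abs_lam_le n) (abs_nonneg _) (abs_mu_le n)) (Sm (fun m => llA k m)) C hC.le
      (fun y hy => by
        rw [mul_div_assoc']
        refine le_trans (le_of_eq ?_) (hb y hy)
        congr 1
        refine Sm_congr (by linarith) (fun n hn _ => ?_)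
        change lam n * LL k n = _
        rw [LL_apply k (by omega)]) x hx
    calc _ ≤ (16 * C * 1 * x * el x ^ 0) * el x ^ 2 := by gcongr
      _ = 16 * C * x * el x ^ 2 := by ring
      _ ≤ _ := by gcongr

end BS

namespace BS

/-- pr as arithmetic function -/
noncomputable def prA : ArithmeticFunction ℝ := ⟨fun n => if n = 0 then 0 else pr n, by simp⟩

/-- prime log power weights -/
noncomputable def pw (r n : ℕ) : ℝ := if n.Prime then Real.log n ^ r / n else 0

lemma pw_nonneg (r n : ℕ) : 0 ≤ pw r n := by
  unfold pw; split_ifs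
  · have := Real.log_natCast_nonneg n
    positivity
  · exact le_rfl

lemma Sm_inv_le {x : ℝ} (hx : 1 ≤ x) : Sm (fun n => 1 / (n : ℝ)) x ≤ el x := by
  have h := harmonic_floor_le_one_add_log x hx
  rw [harmonic_eq_sum_Icc] at h
  push_cast at h
  unfold Sm el
  simpa [one_div] using h

lemma Sm_inv_ge {x : ℝ} (hx : 0 ≤ x) : Real.log x ≤ Sm (fun n => 1 / (n : ℝ)) x := by
  have h := log_le_harmonic_floor x hx
  rw [harmonic_eq_sum_Icc] at h
  push_cast at h
  unfold Sm
  simpa [one_div] using h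

lemma pr_div_bound : ∃ C : ℝ, 0 < C ∧ ∀ x : ℝ, 1 ≤ x → |Sm (fun n => pr n / n) x| ≤ C := by
  obtain ⟨D, hD, h2⟩ := Sav_pr 2
  obtain ⟨E, hE, h0⟩ := Sav_pr 0
  refine ⟨16 * D + (E + 2), by positivity, fun x hx => ?_⟩
  have hx0 : 0 < x := by linarith
  have e1 : ∀ y : ℝ, 0 ≤ y → Sm (fun m => prA m) y = Sm pr y := fun y hy =>
    Sm_congr hy (fun n hn _ => by change (if n = 0 then 0 else pr n) = _; rw [if_neg (by omega)])
  have b1 := conv_abs (fun n => zeR n) 0 1 zero_le_one (fun y hy => by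
      rw [pow_zero, mul_one, one_mul]
      refine le_trans (Sm_le (by linarith) (fun n hn _ => ?_)) (Sm_one_le (by linarith))
      rw [zeR_apply (by omega)]; simp) (Sm (fun m => prA m)) D hD.le
      (fun y hy => by rw [mul_div_assoc', e1 y (by linarith)]; exact h2 y hy) x hx
  rw [← Sm_conv, mul_comm zeR, Sm_conv] at b1
  have e2 : Sm (fun n => prA n * Sm (fun m => zeR m) (x / n)) x = Sm (fun n => pr n * (⌊x / n⌋₊ : ℝ)) x := by
    refine Sm_congr hx0.le (fun n hn _ => ?_)
    have : prA n = pr n := by change (if n = 0 then 0 else pr n) = _; rw [if_neg (by omega)]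
    rw [this, ← Sm_one]
    congr 1
    refine Sm_congr (by positivity) (fun n hn _ => ?_)
    exact zeR_apply (by omega)
  rw [e2] at b1
  have b2 : |Sm (fun n => pr n * (⌊x / n⌋₊ : ℝ)) x - x * Sm (fun n => pr n / n) x| ≤ (E + 2) * x := by
    rw [← Sm_mul, ← Sm_sub]
    refine (Sm_abs _ _).trans ?_
    have : Sm (fun n => |pr n * (⌊x / n⌋₊ : ℝ) - x * (pr n / n)|) x ≤ Sm (fun n => pr n + 2 * 1) x := by
      refine Sm_le hx0.le (fun n hn hnx => ?_)
      have hn0 : (0 : ℝ) < n := by exact_mod_cast hn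
      have hz1 : 1 ≤ x / n := by rwa [one_le_div hn0]
      rw [show pr n * (⌊x / n⌋₊ : ℝ) - x * (pr n / n) = pr n * ((⌊x / n⌋₊ : ℝ) - x / n) by ring, abs_mul]
      have h3 := floor_err hz1
      have h4 : |pr n| ≤ pr n + 2 * 1 := by
        unfold pr
        have := Real.log_natCast_nonneg n
        split_ifs <;> rw [abs_le] <;> constructor <;> linarith
      calc |pr n| * |(⌊x / n⌋₊ : ℝ) - x / n| ≤ |pr n| * 1 := by gcongr
        _ ≤ _ := by rw [mul_one]; exact h4
    refine this.trans ?_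
    rw [Sm_add, Sm_mul]
    have h5 := h0 x hx
    rw [pow_zero, div_one] at h5
    have h6 := Sm_one_le hx0.le
    have := (abs_le.1 h5).2
    linarith
  have b3 : x * |Sm (fun n => pr n / n) x| ≤ x * (16 * D + (E + 2)) := by
    rw [← abs_of_pos hx0, ← abs_mul, abs_of_pos hx0]
    rw [abs_le] at b1 b2 ⊢
    norm_num at b1
    constructor <;> linarith [b1.1, b1.2, b2.1, b2.2]
  exact le_of_mul_le_mul_left b3 hx0

lemma mertens : ∃ C : ℝ, 0 < C ∧ ∀ x : ℝ, 1 ≤ x → |Sm (pw 1) x - Real.log x| ≤ C := by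
  obtain ⟨C, hC, h⟩ := pr_div_bound
  refine ⟨C + 1, by positivity, fun x hx => ?_⟩
  have e : Sm (pw 1) x = Sm (fun n => pr n / n) x + Sm (fun n => 1 / (n : ℝ)) x := by
    rw [← Sm_add]
    refine Sm_congr (by linarith) (fun n hn _ => ?_)
    unfold pw pr
    split_ifs <;> ring
  have h1 := Sm_inv_le hx
  have h2 := Sm_inv_ge (by linarith : 0 ≤ x)
  have h3 := h x hx
  unfold el at h1
  rw [e]
  rw [abs_le] at h3 ⊢
  constructor <;> linarith

lemma Icc_range (f : ℕ → ℝ) (N : ℕ) : ∑ n ∈ Icc 1 N, f n = ∑ i ∈ range N, f (i + 1) := by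
  rw [range_eq_Ico, Finset.sum_Ico_add' f 0 N 1]
  refine sum_congr ?_ (fun _ _ => rfl)
  ext; simp only [mem_Icc, mem_Ico]; omega

lemma logpow_mono (r : ℕ) : Monotone (fun i : ℕ => Real.log ((i + 1 : ℕ) : ℝ) ^ r) := by
  intro i j hij
  simp only
  refine pow_le_pow_left₀ (Real.log_natCast_nonneg _) (Real.log_le_log ?_ ?_) r
  · positivity
  · exact_mod_cast (by omega : i + 1 ≤ j + 1)

lemma logdiff (n : ℕ) : Real.log ((n + 1 : ℕ) : ℝ) - Real.log n ≤ 1 := by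
  rcases Nat.eq_zero_or_pos n with h | h
  · simp [h]
  · have hn : (1 : ℝ) ≤ n := by exact_mod_cast h
    rw [← Real.log_div (by positivity) (by positivity)]
    have h1 : ((n + 1 : ℕ) : ℝ) / n ≤ 2 := by
      rw [div_le_iff₀ (by positivity)]; push_cast; linarith
    have := Real.log_le_log (by positivity) h1
    have := Real.log_two_lt_d9
    linarith

lemma logpow_tel (r N : ℕ) : |∑ i ∈ range N, Real.log ((i + 1 : ℕ) : ℝ) ^ r *
    (Real.log ((i + 1 : ℕ) : ℝ) - Real.log i) - Real.log N ^ (r + 1) / (r + 1)| ≤ Real.log N ^ r := by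
  have hl : ∀ i : ℕ, Real.log (i : ℝ) ≤ Real.log ((i + 1 : ℕ) : ℝ) := by
    intro i
    rcases Nat.eq_zero_or_pos i with h | h
    · simp [h]
    · exact Real.log_le_log (by exact_mod_cast h) (by push_cast; linarith)
  have t1 : Real.log (N : ℝ) ^ (r + 1) = ∑ i ∈ range N, (Real.log ((i + 1 : ℕ) : ℝ) ^ (r + 1) - Real.log (i : ℝ) ^ (r + 1)) := by
    rw [Finset.sum_range_sub (fun i : ℕ => Real.log (i : ℝ) ^ (r + 1))]; simp
  have t2 : ∑ i ∈ range N, (Real.log ((i + 1 : ℕ) : ℝ) ^ r - Real.log (i : ℝ) ^ r) ≤ Real.log (N : ℝ) ^ r := by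
    rw [Finset.sum_range_sub (fun i : ℕ => Real.log (i : ℝ) ^ r)]
    simp only [CharP.cast_eq_zero, Real.log_zero]
    have : (0 : ℝ) ≤ 0 ^ r := by positivity
    linarith
  have hr : (0 : ℝ) < r + 1 := by positivity
  rw [t1, sum_div, ← sum_sub_distrib]
  refine (abs_sum_le_sum_abs _ _).trans (le_trans (sum_le_sum (fun i _ => ?_)) t2)
  have ha := Real.log_natCast_nonneg i
  have hab := hl i
  have hd := logdiff i
  set a := Real.log (i : ℝ)
  set b := Real.log ((i + 1 : ℕ) : ℝ)
  have h1 := pow_diff_le r ha hab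
  have h2 : (r + 1) * (b - a) * a ^ r ≤ b ^ (r + 1) - a ^ (r + 1) := by
    have hb := ha.trans hab
    clear h1 hd t1 t2 hr
    induction r with
    | zero => simp
    | succ m ih =>
      have e : b ^ (m + 1 + 1) - a ^ (m + 1 + 1) = a * (b ^ (m + 1) - a ^ (m + 1)) + (b - a) * b ^ (m + 1) := by
        ring
      rw [e]
      have h1 : a ^ (m + 1) ≤ b ^ (m + 1) := pow_le_pow_left₀ ha hab _
      calc ((m + 1 : ℕ) + 1) * (b - a) * a ^ (m + 1)
          = a * ((m + 1) * (b - a) * a ^ m) + (b - a) * a ^ (m + 1) := by push_cast; ring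
        _ ≤ _ := by
          have : 0 ≤ b - a := by linarith
          gcongr
  have h3 : a ^ r ≤ b ^ r := pow_le_pow_left₀ ha hab _
  have h4 : b ^ r * (b - a) - (b ^ (r + 1) - a ^ (r + 1)) / (r + 1) ≤ b ^ r - a ^ r := by
    have : (b - a) * a ^ r ≤ (b ^ (r + 1) - a ^ (r + 1)) / (r + 1) := by
      rw [le_div_iff₀ hr]; linarith
    nlinarith
  have h5 : 0 ≤ b ^ r * (b - a) - (b ^ (r + 1) - a ^ (r + 1)) / (r + 1) := by
    rw [sub_nonneg, div_le_iff₀ hr]; linarith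
  rw [abs_of_nonneg h5]; exact h4

theorem mertens_pow (r : ℕ) : ∃ C : ℝ, 0 < C ∧ ∀ x : ℝ, 1 ≤ x →
    |Sm (pw (r + 1)) x - Real.log x ^ (r + 1) / (r + 1)| ≤ C * el x ^ r := by
  obtain ⟨C, hC, h⟩ := mertens
  refine ⟨2 * C + 2, by positivity, fun x hx => ?_⟩
  have hx0 : 0 < x := by linarith
  set N := ⌊x⌋₊ with hN
  have hN1 : 1 ≤ N := Nat.le_floor (by simpa using hx)
  have hNr : (1 : ℝ) ≤ N := by exact_mod_cast hN1
  have hNx : (N : ℝ) ≤ x := Nat.floor_le hx0.le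
  have hxN := Nat.lt_floor_add_one x
  rw [← hN] at hxN
  have hel := one_le_el hx
  have tel : ∀ k : ℕ, ∑ i ∈ range k, (Real.log ((i + 1 : ℕ) : ℝ) - Real.log (i : ℝ)) = Real.log k := by
    intro k; rw [Finset.sum_range_sub (fun i : ℕ => Real.log (i : ℝ))]; simp
  have a1 := abel_mono (fun i => Real.log ((min (i + 1) N : ℕ) : ℝ) ^ r)
    (fun i => pw 1 (i + 1) - (Real.log ((i + 1 : ℕ) : ℝ) - Real.log (i : ℝ)))
    (fun i j hij => by
      have h1 : min (i + 1) N ≤ min (j + 1) N := min_le_min_right _ (by omega)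
      have h2 := logpow_mono r (by omega : min (i + 1) N - 1 ≤ min (j + 1) N - 1)
      simp only at h2 ⊢
      rwa [Nat.sub_add_cancel (by omega), Nat.sub_add_cancel (by omega)] at h2)
    (fun i => pow_nonneg (Real.log_natCast_nonneg _) _) C N
    (fun k hk => by
      rw [sum_sub_distrib, tel, ← Icc_range]
      rcases Nat.eq_zero_or_pos k with h0 | h0
      · simp [h0, hC.le]
      · have := h k (by exact_mod_cast h0)
        rwa [Sm, Nat.floor_natCast] at this)
  have a2 := logpow_tel r N
  have e : ∑ i ∈ range N, Real.log ((min (i + 1) N : ℕ) : ℝ) ^ r *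
      (pw 1 (i + 1) - (Real.log ((i + 1 : ℕ) : ℝ) - Real.log (i : ℝ))) =
      Sm (pw (r + 1)) x - ∑ i ∈ range N, Real.log ((i + 1 : ℕ) : ℝ) ^ r *
    (Real.log ((i + 1 : ℕ) : ℝ) - Real.log i) := by
    rw [Sm, Icc_range, ← sum_sub_distrib]
    refine sum_congr rfl (fun i hi => ?_)
    rw [min_eq_left (by have := mem_range.1 hi; omega), mul_sub]
    congr 1
    unfold pw
    split_ifs
    · rw [pow_one, pow_succ]; ring
    · simp
  rw [e, min_eq_right (by omega)] at a1
  have hlN := Real.log_natCast_nonneg N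
  have hl1 := Real.log_le_log (by linarith) hNx
  have h5 : Real.log N ^ r ≤ el x ^ r := by
    refine pow_le_pow_left₀ hlN ?_ r
    unfold el; linarith
  have h6 : |Real.log N ^ (r + 1) / (r + 1) - Real.log x ^ (r + 1) / (r + 1)| ≤ el x ^ r := by
    have hr : (0 : ℝ) < r + 1 := by positivity
    have h7 : Real.log N ^ (r + 1) ≤ Real.log x ^ (r + 1) := pow_le_pow_left₀ hlN hl1 _
    rw [← sub_div, abs_div, abs_of_pos hr, abs_sub_comm, abs_of_nonneg (by linarith), div_le_iff₀ hr]
    refine (pow_diff_le r hlN hl1).trans ?_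
    have h8 : Real.log x - Real.log N ≤ 1 := by
      have := logdiff N
      have := Real.log_le_log hx0 hxN.le
      push_cast at *
      linarith
    have h9 : Real.log x ≤ el x := by unfold el; linarith
    have h10 := Real.log_nonneg hx
    calc (r + 1) * (Real.log x - Real.log N) * Real.log x ^ r ≤ (r + 1) * 1 * el x ^ r := by
          gcongr
      _ = _ := by ring
  have h11 : 2 * C * Real.log N ^ r ≤ 2 * C * el x ^ r := by gcongr
  rw [abs_le] at a1 a2 h6 ⊢
  constructor <;> linarith

end BS

namespace BS

lemma lk'_nonneg (k q l : ℕ) : 0 ≤ lk' k q l := by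
  unfold lk'
  refine sum_nonneg (fun j _ => ?_)
  have h1 := Real.log_natCast_nonneg q
  have h2 := lk_nonneg j l
  positivity

lemma lk'_le (k : ℕ) {q l : ℕ} (hq : q ≠ 0) (hl : l ≠ 0) : lk' k q l ≤ Real.log ((q * l : ℕ) : ℝ) ^ k := by
  have h1 := Real.log_natCast_nonneg q
  have h2 := Real.log_natCast_nonneg l
  rw [Nat.cast_mul, Real.log_mul (by exact_mod_cast hq) (by exact_mod_cast hl), add_comm, add_pow,
    sum_range_succ]
  have h3 : lk' k q l ≤ ∑ m ∈ range k, Real.log l ^ m * Real.log q ^ (k - m) * (k.choose m : ℝ) := by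
    unfold lk'
    refine sum_le_sum (fun j _ => ?_)
    have := lk_le j hl
    calc (k.choose j : ℝ) * Real.log q ^ (k - j) * lk j l ≤ (k.choose j : ℝ) * Real.log q ^ (k - j) * Real.log l ^ j := by
          gcongr
      _ = _ := by ring
  have h4 : 0 ≤ Real.log l ^ k * Real.log q ^ (k - k) * (k.choose k : ℝ) := by positivity
  linarith

lemma lk_diff (k : ℕ) {q l : ℕ} (hq : q.Prime) (hl : l ≠ 0) :
    |lk k (q * l) - lk' k q l| ≤ if q ∣ l then Real.log ((q * l : ℕ) : ℝ) ^ k else 0 := by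
  split_ifs with h
  · have h1 := lk_le k (mul_ne_zero hq.ne_zero hl)
    have h2 := lk'_le k hq.ne_zero hl
    have h3 := lk_nonneg k (q * l)
    have h4 := lk'_nonneg k q l
    rw [abs_le]; constructor <;> linarith
  · rw [lk_prime_mul k hq hl h]; simp

lemma Sm_lk' (h : ℕ → ℝ) (k q : ℕ) (y : ℝ) : Sm (fun l => h l * lk' k q l) y =
    ∑ j ∈ range k, (k.choose j : ℝ) * Real.log q ^ (k - j) * Sm (fun l => h l * lk j l) y := by
  unfold Sm lk'
  simp only [mul_sum]
  rw [sum_comm]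
  refine sum_congr rfl (fun j _ => sum_congr rfl (fun l _ => ?_))
  ring

lemma Sm_dvd {q : ℕ} (hq : 0 < q) {y : ℝ} (hy : 0 ≤ y) : Sm (fun l => if q ∣ l then 1 else 0) y ≤ y / q := by
  unfold Sm
  rw [Icc_one_eq, ← sum_filter, sum_const, nsmul_eq_mul, mul_one, Nat.Ioc_filter_dvd_card_eq_div]
  have hq0 : (0 : ℝ) < q := by exact_mod_cast hq
  refine Nat.cast_div_le.trans ?_
  gcongr
  exact Nat.floor_le hy

lemma VU (j : ℕ) : ∃ C : ℝ, 0 < C ∧ ∀ y : ℝ, 1 ≤ y → Sm (fun n => lk j n) y * el y ≤ C * y * el y ^ j := by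
  cases j with
  | zero =>
    refine ⟨3, by norm_num, fun y hy => ?_⟩
    have h1 := el_pow_le 1 hy
    have hel := one_le_el hy
    have h2 : Sm (fun n => lk 0 n) y ≤ 1 := by
      rw [lk_zero]
      simp only [ArithmeticFunction.one_apply]
      unfold Sm
      rw [sum_ite_eq']
      split_ifs <;> norm_num
    norm_num at h1 ⊢
    nlinarith
  | succ k =>
    obtain ⟨C, hC, h⟩ := VK k
    refine ⟨k + 1 + C, by positivity, fun y hy => ?_⟩
    have h1 := h y hy
    have hel := one_le_el hy
    have h2 : Sm (fun n => lk (k + 1) n) y ≤ (k + 1) * y * el y ^ k + |Sm (fun n => lk (k + 1) n) y - (k + 1) * y * el y ^ k| := by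
      linarith [le_abs_self (Sm (fun n => lk (k + 1) n) y - (k + 1) * y * el y ^ k)]
    calc _ ≤ ((k + 1) * y * el y ^ k + |Sm (fun n => lk (k + 1) n) y - (k + 1) * y * el y ^ k|) * el y := by gcongr
      _ ≤ (k + 1) * y * el y ^ (k + 1) + C * y * el y ^ k := by
        rw [add_mul]; exact add_le_add (le_of_eq (by ring)) h1
      _ ≤ (k + 1) * y * el y ^ (k + 1) + C * y * el y ^ (k + 1) := by
        gcongr
        omega
      _ = _ := by ring

lemma el_pow' (m : ℕ) {q : ℝ} (hq : 1 ≤ q) : el (q ^ m) ≤ (m + 1) * el q := by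
  have := Real.log_nonneg hq
  unfold el; rw [Real.log_pow]
  have : (0 : ℝ) ≤ m := by positivity
  nlinarith

lemma log_le_el {x : ℝ} : Real.log x ≤ el x := by unfold el; linarith

lemma ZZ (k m : ℕ) (hm : m ≠ 0) : ∃ C : ℝ, 0 < C ∧ ∀ q : ℕ, q.Prime →
    Sm (fun l => lk k (q * l)) ((q : ℝ) ^ m) * el q ≤ C * (q : ℝ) ^ m * el q ^ k := by
  choose V hV hb using VU
  refine ⟨3 * (m + 2) ^ k + ∑ j ∈ range k, (k.choose j : ℝ) * (V j * (m + 1) ^ j), ?_, fun q hq => ?_⟩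
  · have : 0 ≤ ∑ j ∈ range k, (k.choose j : ℝ) * (V j * (m + 1) ^ j) :=
      sum_nonneg (fun j _ => by have := hV j; positivity)
    positivity
  have hq1 : (1 : ℝ) ≤ q := by exact_mod_cast hq.one_le
  have hq0 : (0 : ℝ) < q := by linarith
  have hel := one_le_el hq1
  have hlq := Real.log_nonneg hq1
  have hqm : (1 : ℝ) ≤ (q : ℝ) ^ m := one_le_pow₀ hq1
  have h1 : Sm (fun l => lk k (q * l)) ((q : ℝ) ^ m) ≤
      Sm (fun l => ((m + 2) * el q) ^ k * (if q ∣ l then 1 else 0) + 1 * lk' k q l) ((q : ℝ) ^ m) := by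
    refine Sm_le (by positivity) (fun l hl hlx => ?_)
    have h2 := (abs_le.1 (lk_diff k hq (by omega : l ≠ 0))).2
    have hl0 : (0 : ℝ) < l := by exact_mod_cast hl
    have h3 : Real.log ((q * l : ℕ) : ℝ) ^ k ≤ ((m + 2) * el q) ^ k := by
      refine pow_le_pow_left₀ (Real.log_natCast_nonneg _) ?_ k
      rw [Nat.cast_mul, Real.log_mul hq0.ne' hl0.ne']
      have h4 := Real.log_le_log hl0 hlx
      have h5 : Real.log ((q : ℝ) ^ m) ≤ (m + 1) * el q := log_le_el.trans (el_pow' m hq1)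
      have h6 : Real.log q ≤ el q := log_le_el
      linarith
    split_ifs at h2 ⊢ <;> linarith
  rw [Sm_add, Sm_mul, Sm_lk'] at h1
  have h2 := Sm_dvd hq.pos (by positivity : 0 ≤ (q : ℝ) ^ m)
  have h3 : (((m + 2) * el q) ^ k * Sm (fun l => if q ∣ l then 1 else 0) ((q : ℝ) ^ m)) * el q ≤
      3 * (m + 2) ^ k * (q : ℝ) ^ m * el q ^ k := by
    have h4 := el_pow_le 1 hq1
    norm_num at h4
    calc _ ≤ (((m + 2) * el q) ^ k * ((q : ℝ) ^ m / q)) * (3 * q) := by gcongr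
      _ = _ := by rw [mul_pow]; field_simp
  have h5 : (∑ j ∈ range k, (k.choose j : ℝ) * Real.log q ^ (k - j) * Sm (fun l => 1 * lk j l) ((q : ℝ) ^ m)) * el q ≤
      (∑ j ∈ range k, (k.choose j : ℝ) * (V j * (m + 1) ^ j)) * ((q : ℝ) ^ m * el q ^ k) := by
    rw [sum_mul, sum_mul]
    refine sum_le_sum (fun j hj => ?_)
    simp only [one_mul]
    have h6 := hb j _ hqm
    have h7 : 0 ≤ Sm (fun l => lk j l) ((q : ℝ) ^ m) := Sm_nonneg (fun l => lk_nonneg j l) _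
    have h8 : el (q : ℝ) ≤ el ((q : ℝ) ^ m) := el_mono hq0 (le_self_pow₀ hq1 hm)
    have hVj := hV j
    have h9 : Sm (fun l => lk j l) ((q : ℝ) ^ m) * el q ≤ V j * (q : ℝ) ^ m * ((m + 1) * el q) ^ j := by
      calc _ ≤ Sm (fun l => lk j l) ((q : ℝ) ^ m) * el ((q : ℝ) ^ m) := by gcongr
        _ ≤ _ := h6
        _ ≤ _ := by
          have := el_pow' m hq1
          have := one_le_el hqm
          gcongr
    have h10 : Real.log q ^ (k - j) ≤ el q ^ (k - j) := pow_le_pow_left₀ hlq log_le_el _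
    calc _ = (k.choose j : ℝ) * Real.log q ^ (k - j) * (Sm (fun l => lk j l) ((q : ℝ) ^ m) * el q) := by ring
      _ ≤ (k.choose j : ℝ) * el q ^ (k - j) * (V j * (q : ℝ) ^ m * ((m + 1) * el q) ^ j) := by gcongr
      _ = (k.choose j : ℝ) * (V j * (m + 1) ^ j) * ((q : ℝ) ^ m * (el q ^ (k - j) * el q ^ j)) := by
        rw [mul_pow]; ring
      _ = _ := by rw [← pow_add, Nat.sub_add_cancel (mem_range.1 hj).le]
  calc _ ≤ _ := mul_le_mul_of_nonneg_right h1 (by linarith)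
    _ ≤ 3 * (m + 2) ^ k * (q : ℝ) ^ m * el q ^ k + (∑ j ∈ range k, (k.choose j : ℝ) * (V j * (m + 1) ^ j)) * ((q : ℝ) ^ m * el q ^ k) := by
      rw [add_mul]; exact add_le_add h3 h5
    _ = _ := by ring

end BS

namespace BS

lemma Sm_restrict (g : ℕ → ℝ) {x y : ℝ} (hy : 0 ≤ y) (hxy : y ≤ x) :
    Sm (fun n => if (n : ℝ) ≤ y then g n else 0) x = Sm g y := by
  unfold Sm
  rw [← sum_filter]
  refine sum_congr ?_ (fun _ _ => rfl)
  ext n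
  rw [mem_filter, mem_Icc_floor (hy.trans hxy), mem_Icc_floor hy]
  constructor
  · rintro ⟨⟨h1, h2⟩, h3⟩; exact ⟨h1, h3⟩
  · rintro ⟨h1, h2⟩; exact ⟨⟨h1, h2.trans hxy⟩, h2⟩

/-- root -/
noncomputable def rt (m : ℕ) (x : ℝ) : ℝ := x ^ ((1 : ℝ) / (m + 1))

lemma rt_pow (m : ℕ) {x : ℝ} (hx : 1 ≤ x) : rt m x ^ (m + 1) = x := by
  unfold rt
  rw [← Real.rpow_natCast, ← Real.rpow_mul (by linarith)]
  push_cast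
  rw [one_div_mul_cancel (by positivity), Real.rpow_one]

lemma one_le_rt (m : ℕ) {x : ℝ} (hx : 1 ≤ x) : 1 ≤ rt m x := Real.one_le_rpow hx (by positivity)

lemma rt_le (m : ℕ) {x : ℝ} (hx : 1 ≤ x) : rt m x ≤ x := by
  conv_rhs => rw [← rt_pow m hx]
  exact le_self_pow₀ (one_le_rt m hx) (by omega)

lemma le_rt_iff (m : ℕ) {x q : ℝ} (hx : 1 ≤ x) (hq : 0 ≤ q) : q ≤ rt m x ↔ q ^ (m + 1) ≤ x := by
  conv_rhs => rw [← rt_pow m hx]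
  rw [pow_le_pow_iff_left₀ hq (by linarith [one_le_rt m hx]) (by omega)]

lemma log_rt (m : ℕ) {x : ℝ} (hx : 1 ≤ x) : Real.log (rt m x) = Real.log x / (m + 1) := by
  unfold rt; rw [Real.log_rpow (by linarith)]; ring

lemma el_le_rt (m : ℕ) {x : ℝ} (hx : 1 ≤ x) : el x ≤ (m + 2) * el (rt m x) := by
  have := el_pow' (m + 1) (one_le_rt m hx)
  rw [rt_pow m hx] at this
  push_cast at this
  linarith

lemma el_le_three_log {q : ℕ} (hq : 2 ≤ q) : el q ≤ 3 * Real.log q := by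
  have h1 : Real.log 2 ≤ Real.log q := Real.log_le_log (by norm_num) (by exact_mod_cast hq)
  have := Real.log_two_gt_d9
  unfold el; linarith

lemma pi_el : ∃ C : ℝ, 0 < C ∧ ∀ y : ℝ, 1 ≤ y → Sm (fun n => if n.Prime then 1 else 0) y * el y ≤ C * y := by
  refine ⟨18, by norm_num, fun y hy => ?_⟩
  rcases lt_or_ge y 2 with h2 | h2
  · have : Sm (fun n => if n.Prime then (1 : ℝ) else 0) y = 0 := by
      unfold Sm
      refine sum_eq_zero (fun n hn => ?_)
      rw [mem_Icc_floor (by linarith)] at hn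
      rw [if_neg]
      intro hp
      have : (2 : ℝ) ≤ n := by exact_mod_cast hp.two_le
      linarith [hn.2]
    rw [this]; linarith
  have h1 := Chebyshev.pi_le_log4_mul_div (by linarith : 1 < y)
  have e : Sm (fun n => if n.Prime then (1 : ℝ) else 0) y = (Nat.primeCounting ⌊y⌋₊ : ℝ) := by
    unfold Sm
    rw [← sum_filter, sum_const, nsmul_eq_mul, mul_one, Nat.primeCounting, Nat.primeCounting',
      Nat.count_eq_card_filter_range]
    congr 2
    ext n
    simp only [mem_filter, mem_Icc, mem_range]
    constructor
    · rintro ⟨⟨_, h⟩, hp⟩; exact ⟨by omega, hp⟩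
    · rintro ⟨h, hp⟩; exact ⟨⟨hp.one_le, by omega⟩, hp⟩
  rw [e]
  have hl2 := Real.log_two_gt_d9
  have hl2' := Real.log_two_lt_d9
  have hly : Real.log 2 ≤ Real.log y := Real.log_le_log (by norm_num) h2
  have hel : el y ≤ 3 * Real.log y := by unfold el; linarith
  have hel1 := one_le_el hy
  have hl4 : Real.log 4 ≤ 2 := by
    rw [show (4 : ℝ) = 2 ^ 2 by norm_num, Real.log_pow]; push_cast; linarith
  have hl40 : 0 ≤ Real.log 4 := Real.log_nonneg (by norm_num)
  have h3 := el_pow_le_sqrt 1 hy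
  norm_num at h3
  have h5 := Real.mul_self_sqrt (by linarith : 0 ≤ y)
  rw [Real.log_sqrt (by linarith)] at h1
  calc _ ≤ (Real.log 4 * y / (Real.log y / 2) + Real.sqrt y) * el y := by gcongr
    _ = Real.log 4 * y / (Real.log y / 2) * el y + Real.sqrt y * el y := by ring
    _ ≤ 2 * y / (Real.log y / 2) * (3 * Real.log y) + Real.sqrt y * (6 * Real.sqrt y) := by
      have : 0 < Real.log y := by linarith
      gcongr
    _ = 12 * y + 6 * (Real.sqrt y * Real.sqrt y) := by
      have : Real.log y ≠ 0 := by linarith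
      field_simp; ring
    _ = _ := by rw [h5]; ring

lemma ppow_sum (m : ℕ) : ∃ C : ℝ, 0 < C ∧ ∀ x : ℝ, 1 ≤ x →
    Sm (fun q => if q.Prime ∧ (q : ℝ) ^ (m + 1) ≤ x then (q : ℝ) ^ m else 0) x * el x ≤ C * x := by
  obtain ⟨C, hC, h⟩ := pi_el
  refine ⟨C * (m + 2), by positivity, fun x hx => ?_⟩
  have hy := one_le_rt m hx
  have h1 : Sm (fun q => if q.Prime ∧ (q : ℝ) ^ (m + 1) ≤ x then (q : ℝ) ^ m else 0) x ≤
      rt m x ^ m * Sm (fun n => if n.Prime then 1 else 0) (rt m x) := by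
    rw [← Sm_mul, ← Sm_restrict _ (by linarith) (rt_le m hx)]
    refine Sm_le (by linarith) (fun q hq _ => ?_)
    have hq0 : (0 : ℝ) ≤ q := by positivity
    simp only [← le_rt_iff m hx hq0]
    by_cases h2 : (q : ℝ) ≤ rt m x
    · by_cases h3 : q.Prime
      · simp only [h2, h3, and_self, if_true, mul_one]
        gcongr
      · simp [h3]
    · simp [h2]
  have h2 := h _ hy
  have h3 := el_le_rt m hx
  have h4 : 0 ≤ Sm (fun n => if n.Prime then (1 : ℝ) else 0) (rt m x) :=
    Sm_nonneg (fun n => by split_ifs <;> norm_num) _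
  have hel := one_le_el hx
  calc _ ≤ (rt m x ^ m * Sm (fun n => if n.Prime then 1 else 0) (rt m x)) * ((m + 2) * el (rt m x)) := by
        gcongr
    _ = (m + 2) * rt m x ^ m * (Sm (fun n => if n.Prime then 1 else 0) (rt m x) * el (rt m x)) := by ring
    _ ≤ (m + 2) * rt m x ^ m * (C * rt m x) := by gcongr
    _ = C * (m + 2) * (rt m x ^ (m + 1)) := by ring
    _ = _ := by rw [rt_pow m hx]

lemma el_le_of_lt_pow (m : ℕ) {x : ℝ} {q : ℕ} (hx : 1 ≤ x) (hq : 1 ≤ q) (h : x < (q : ℝ) ^ m) :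
    el x ≤ (m + 1) * el q :=
  (el_mono (by linarith) h.le).trans (el_pow' m (by exact_mod_cast hq))

lemma inv_sum (m : ℕ) : ∃ C : ℝ, 0 < C ∧ ∀ x : ℝ, 1 ≤ x →
    Sm (fun q => if q.Prime ∧ x < (q : ℝ) ^ m then 1 / (q : ℝ) else 0) x ≤ C := by
  obtain ⟨C, hC, h⟩ := mertens
  refine ⟨(m + 1) * 3 * (1 + C), by positivity, fun x hx => ?_⟩
  have hel := one_le_el hx
  have h1 : el x * Sm (fun q => if q.Prime ∧ x < (q : ℝ) ^ m then 1 / (q : ℝ) else 0) x ≤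
      (m + 1) * 3 * Sm (pw 1) x := by
    rw [← Sm_mul, ← Sm_mul]
    refine Sm_le (by linarith) (fun q hq _ => ?_)
    split_ifs with hc
    · have h2 := el_le_of_lt_pow m hx hq hc.2
      have h3 := el_le_three_log hc.1.two_le
      unfold pw
      rw [if_pos hc.1, pow_one]
      have h4 : el x ≤ (m + 1) * (3 * Real.log q) := h2.trans (by gcongr)
      calc el x * (1 / (q : ℝ)) ≤ (m + 1) * (3 * Real.log q) * (1 / (q : ℝ)) := by gcongr
        _ = _ := by ring
    · rw [mul_zero]
      have := pw_nonneg 1 q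
      positivity
  have h2 := (abs_le.1 (h x hx)).2
  have h3 : Sm (pw 1) x ≤ el x * (1 + C) := by
    have : Real.log x ≤ el x := log_le_el
    nlinarith
  refine le_of_mul_le_mul_left (h1.trans ?_) (by linarith : 0 < el x)
  calc _ ≤ (m + 1) * 3 * (el x * (1 + C)) := by gcongr
    _ = _ := by ring

end BS

namespace BS

/-- truncated Liouville -/
noncomputable def ww (K q l : ℕ) : ℝ := if q ^ K < l ∧ l ≤ q ^ (2 * K) then lam l else 0

/-- the perturbation before normalisation -/
noncomputable def f0 (K n : ℕ) : ℝ := ∑ q ∈ n.primeFactors, ww K q (n / q)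

lemma abs_ww_le (K q l : ℕ) : |ww K q l| ≤ 1 := by
  unfold ww; split_ifs
  · exact abs_lam_le l
  · simp

lemma f0_abs (K n : ℕ) : |f0 K n| ≤ 2 * K + 1 := by
  rcases Nat.lt_or_ge n 2 with hn | hn
  · have : n.primeFactors = ∅ := by interval_cases n <;> simp
    rw [f0, this, sum_empty, abs_zero]; positivity
  have h1 : |f0 K n| ≤ ∑ q ∈ n.primeFactors, (if n / q ≤ q ^ (2 * K) then (1 : ℝ) else 0) := by
    refine (abs_sum_le_sum_abs _ _).trans (sum_le_sum (fun q _ => ?_))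
    split_ifs with h
    · exact abs_ww_le _ _ _
    · rw [ww, if_neg (fun h' => h h'.2), abs_zero]
  refine h1.trans ?_
  rw [← sum_filter, sum_const, nsmul_eq_mul, mul_one]
  set F := n.primeFactors.filter (fun q => n / q ≤ q ^ (2 * K)) with hF
  have h2 : n ^ F.card ≤ n ^ (2 * K + 1) := by
    calc n ^ F.card = ∏ q ∈ F, n := by simp
      _ ≤ ∏ q ∈ F, q ^ (2 * K + 1) := by
        refine prod_le_prod' (fun q hq => ?_)
        rw [hF, mem_filter] at hq
        have hd := Nat.dvd_of_mem_primeFactors hq.1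
        calc n = q * (n / q) := (Nat.mul_div_cancel' hd).symm
          _ ≤ q * q ^ (2 * K) := Nat.mul_le_mul_left _ hq.2
          _ = _ := by ring
      _ = (∏ q ∈ F, q) ^ (2 * K + 1) := by rw [prod_pow]
      _ ≤ n ^ (2 * K + 1) := by
        refine Nat.pow_le_pow_left (Nat.le_of_dvd (by omega) ?_) _
        exact (prod_dvd_prod_of_subset _ _ _ (filter_subset _ _)).trans (Nat.prod_primeFactors_dvd n)
  have h3 := (Nat.pow_le_pow_iff_right (by omega : 1 < n)).1 h2
  exact_mod_cast h3

lemma swap (K : ℕ) (g : ℕ → ℝ) {x : ℝ} (hx : 0 ≤ x) : Sm (fun n => g n * f0 K n) x =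
    Sm (fun q => if q.Prime then Sm (fun l => ww K q l * g (q * l)) (x / q) else 0) x := by
  unfold Sm f0
  rw [← sum_filter]
  simp only [mul_sum]
  rw [sum_sigma', sum_sigma']
  refine sum_bij' (fun p _ => ⟨p.2, p.1 / p.2⟩) (fun p _ => ⟨p.1 * p.2, p.1⟩) ?_ ?_ ?_ ?_ ?_
  · rintro ⟨n, q⟩ h
    simp only [mem_sigma, mem_filter, mem_Icc_floor hx, Nat.mem_primeFactors] at h ⊢
    obtain ⟨⟨h1, h2⟩, hq, hd, h0⟩ := h
    have hq0 : (0 : ℝ) < q := by exact_mod_cast hq.pos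
    obtain ⟨l, rfl⟩ := hd
    have hl : 1 ≤ l := Nat.pos_of_ne_zero (fun h => h0 (by simp [h]))
    rw [Nat.mul_div_cancel_left _ hq.pos, mem_Icc_floor (by positivity), le_div_iff₀ hq0]
    have hle : (q : ℝ) ≤ ((q * l : ℕ) : ℝ) := by exact_mod_cast Nat.le_mul_of_pos_right q hl
    push_cast at h2 hle
    exact ⟨⟨⟨hq.one_le, hle.trans h2⟩, hq⟩, hl, by linarith⟩
  · rintro ⟨q, l⟩ h
    simp only [mem_sigma, mem_filter, mem_Icc_floor hx, Nat.mem_primeFactors] at h ⊢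
    obtain ⟨⟨⟨h1, h2⟩, hq⟩, h3⟩ := h
    have hq0 : (0 : ℝ) < q := by exact_mod_cast hq.pos
    rw [mem_Icc_floor (by positivity), le_div_iff₀ hq0] at h3
    have : q * l ≠ 0 := mul_ne_zero hq.ne_zero (by omega)
    exact ⟨⟨by omega, by push_cast; linarith [h3.2]⟩, hq, dvd_mul_right _ _, this⟩
  · rintro ⟨n, q⟩ h
    simp only [mem_sigma, Nat.mem_primeFactors] at h
    rw [Sigma.mk.injEq]
    exact ⟨Nat.mul_div_cancel' h.2.2.1, HEq.rfl⟩
  · rintro ⟨q, l⟩ h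
    simp only [mem_sigma, mem_filter] at h
    rw [Sigma.mk.injEq]
    exact ⟨rfl, heq_of_eq (Nat.mul_div_cancel_left _ h.1.2.pos)⟩
  · rintro ⟨n, q⟩ h
    simp only [mem_sigma, Nat.mem_primeFactors] at h
    simp only
    rw [Nat.mul_div_cancel' h.2.2.1, mul_comm]

/-- inner sum -/
noncomputable def II (K k q : ℕ) (x : ℝ) : ℝ := Sm (fun l => ww K q l * lk k (q * l)) (x / q)

lemma II_zero (K k : ℕ) {q : ℕ} (hq : 1 ≤ q) {x : ℝ} (hx : 1 ≤ x) (h : x < (q : ℝ) ^ (K + 1)) :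
    II K k q x = 0 := by
  have hq0 : (0 : ℝ) < q := by exact_mod_cast hq
  unfold II Sm
  refine sum_eq_zero (fun l hl => ?_)
  rw [mem_Icc_floor (by positivity), le_div_iff₀ hq0] at hl
  rw [ww, if_neg, zero_mul]
  rintro ⟨h1, _⟩
  have h2 : ((q : ℝ) ^ K) < l := by exact_mod_cast h1
  have : (q : ℝ) ^ (K + 1) = q ^ K * q := by ring
  nlinarith [hl.2]

lemma II_A (K k : ℕ) {q : ℕ} (hq : 1 ≤ q) {x : ℝ} (hx : 1 ≤ x) (h : (q : ℝ) ^ (2 * K + 1) ≤ x) :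
    |II K k q x| ≤ Sm (fun l => lk k (q * l)) ((q : ℝ) ^ (2 * K)) := by
  have hq0 : (0 : ℝ) < q := by exact_mod_cast hq
  have hy : (q : ℝ) ^ (2 * K) ≤ x / q := by rw [le_div_iff₀ hq0]; rwa [pow_succ] at h
  rw [← Sm_restrict _ (by positivity) hy]
  refine (Sm_abs _ _).trans (Sm_le (by positivity) (fun l hl _ => ?_))
  have h0 := lk_nonneg k (q * l)
  split_ifs with h1
  · rw [abs_mul, abs_of_nonneg h0]
    exact mul_le_of_le_one_left h0 (abs_ww_le _ _ _)
  · rw [ww, if_neg, zero_mul, abs_zero]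
    rintro ⟨_, h2⟩
    exact h1 (by exact_mod_cast h2)

lemma II_B1 (K k : ℕ) {q : ℕ} (hq : 1 ≤ q) {x : ℝ} (hx : 1 ≤ x) (h : (q : ℝ) ^ (K + 1) ≤ x)
    (h' : x < (q : ℝ) ^ (2 * K + 1)) :
    |II K k q x - Sm (fun l => lam l * lk k (q * l)) (x / q)| ≤ Sm (fun l => lk k (q * l)) ((q : ℝ) ^ K) := by
  have hq0 : (0 : ℝ) < q := by exact_mod_cast hq
  have hy : (q : ℝ) ^ K ≤ x / q := by rw [le_div_iff₀ hq0]; rwa [pow_succ] at h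
  rw [← Sm_restrict _ (by positivity) hy, II, ← Sm_sub]
  refine (Sm_abs _ _).trans (Sm_le (by positivity) (fun l hl hlx => ?_))
  have h0 := lk_nonneg k (q * l)
  rw [← sub_mul, abs_mul, abs_of_nonneg h0]
  have h3 : l ≤ q ^ (2 * K) := by
    have : (l : ℝ) ≤ (q : ℝ) ^ (2 * K) := by
      refine hlx.trans ?_
      rw [div_le_iff₀ hq0, ← pow_succ]; exact h'.le
    exact_mod_cast this
  split_ifs with h1
  · have h2 : ¬ (q ^ K < l) := by
      rw [not_lt]; exact_mod_cast h1
    rw [ww, if_neg (fun h => h2 h.1), zero_sub, abs_neg]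
    exact mul_le_of_le_one_left h0 (abs_lam_le l)
  · have h2 : q ^ K < l := by
      have := not_le.1 h1
      exact_mod_cast this
    rw [ww, if_pos ⟨h2, h3⟩, sub_self, abs_zero, zero_mul]

lemma II_B2 (K k : ℕ) (hK : 1 ≤ K) : ∃ C : ℝ, 0 < C ∧ ∀ x : ℝ, 1 ≤ x → ∀ q : ℕ, q.Prime →
    (q : ℝ) ^ (K + 1) ≤ x → x < (q : ℝ) ^ (2 * K + 1) →
    |Sm (fun l => lam l * lk k (q * l)) (x / q) - Sm (fun l => lam l * lk' k q l) (x / q)| * el x ^ 2 ≤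
      C * (x * (1 / q)) * el x ^ k := by
  refine ⟨(2 * K + 2) ^ 2 * 6, by positivity, fun x hx q hq h1 h2 => ?_⟩
  have hx0 : 0 < x := by linarith
  have hq1 : (1 : ℝ) ≤ q := by exact_mod_cast hq.one_le
  have hq0 : (0 : ℝ) < q := by linarith
  have hel := one_le_el hx
  have helq := one_le_el hq1
  have e1 := el_le_of_lt_pow (2 * K + 1) hx hq.one_le h2
  push_cast at e1
  have e2 := el_pow_le 2 hq1
  norm_num [Nat.factorial] at e2
  have b1 : |Sm (fun l => lam l * lk k (q * l)) (x / q) - Sm (fun l => lam l * lk' k q l) (x / q)| ≤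
      el x ^ k * (x / q / q) := by
    rw [← Sm_sub]
    refine (Sm_abs _ _).trans ?_
    refine le_trans ?_ (mul_le_mul_of_nonneg_left (Sm_dvd hq.pos (by positivity : 0 ≤ x / q)) (by positivity))
    rw [← Sm_mul]
    refine Sm_le (by positivity) (fun l hl hlx => ?_)
    rw [← mul_sub, abs_mul]
    refine (mul_le_of_le_one_left (abs_nonneg _) (abs_lam_le l)).trans ?_
    refine (lk_diff k hq (by omega)).trans ?_
    split_ifs
    · rw [mul_one]
      refine pow_le_pow_left₀ (Real.log_natCast_nonneg _) (le_trans (Real.log_le_log ?_ ?_) log_le_el) k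
      · exact_mod_cast Nat.mul_pos hq.pos hl
      · rw [le_div_iff₀ hq0] at hlx
        push_cast; linarith
    · simp
  calc _ ≤ el x ^ k * (x / q / q) * el x ^ 2 := by gcongr
    _ ≤ el x ^ k * (x / q / q) * ((2 * K + 1 + 1) * el q) ^ 2 := by gcongr
    _ = el x ^ k * (x / q / q) * ((2 * K + 1 + 1) ^ 2 * el q ^ 2) := by rw [mul_pow]
    _ ≤ el x ^ k * (x / q / q) * ((2 * K + 1 + 1) ^ 2 * (6 * q)) := by gcongr
    _ = _ := by field_simp; ring

/-- main-term coefficient -/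
noncomputable def mk (k : ℕ) : ℝ := if 2 ≤ k then k else 0

lemma II_B3 (K k : ℕ) (hK : 1 ≤ K) : ∃ C : ℝ, 0 < C ∧ ∀ x : ℝ, 1 ≤ x → ∀ q : ℕ, q.Prime →
    (q : ℝ) ^ (K + 1) ≤ x →
    |Sm (fun l => lam l * lk' k q l) (x / q) + mk k * x * (Real.log q ^ (k - 1) / q)| * el x ^ 2 ≤
      C * (x * (1 / q)) * el x ^ k := by
  choose V hV hb using VL
  refine ⟨1 + ∑ j ∈ range k, (k.choose j : ℝ) * (4 * V j), ?_, fun x hx q hq h1 => ?_⟩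
  · have : 0 ≤ ∑ j ∈ range k, (k.choose j : ℝ) * (4 * V j) :=
      sum_nonneg (fun j _ => by have := hV j; positivity)
    positivity
  have hx0 : 0 < x := by linarith
  have hq1 : (1 : ℝ) ≤ q := by exact_mod_cast hq.one_le
  have hq0 : (0 : ℝ) < q := by linarith
  have hel := one_le_el hx
  have hlq := Real.log_nonneg hq1
  have hqq : (q : ℝ) ^ 2 ≤ x := (pow_le_pow_right₀ hq1 (by omega)).trans h1
  have hqx : (q : ℝ) ≤ x := by nlinarith
  have hy1 : 1 ≤ x / q := by rwa [one_le_div hq0]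
  have hyx : x / q ≤ x := div_le_self hx0.le hq1
  have hely := one_le_el hy1
  have e1 : el (x / q) ≤ el x := el_mono (by positivity) hyx
  have e2 : el x ≤ 2 * el (x / q) := by
    have := Real.log_le_log (by positivity) hqq
    rw [Real.log_pow] at this
    push_cast at this
    unfold el
    rw [Real.log_div hx0.ne' hq0.ne']
    linarith
  have e3 : Real.log q ≤ el x := (Real.log_le_log hq0 hqx).trans log_le_el
  have hmain : mk k * x * (Real.log q ^ (k - 1) / q) =
      ∑ j ∈ range k, (k.choose j : ℝ) * Real.log q ^ (k - j) * (if j = 1 then x / q else 0) := by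
    simp only [mul_ite, mul_zero]
    rw [sum_ite_eq']
    unfold mk
    simp only [mem_range]
    by_cases h : 2 ≤ k
    · rw [if_pos h, if_pos (by omega), Nat.choose_one_right]; ring
    · rw [if_neg h, if_neg (by omega)]; ring
  rw [hmain, Sm_lk', ← sum_add_distrib]
  have h3 : |∑ j ∈ range k, ((k.choose j : ℝ) * Real.log q ^ (k - j) * Sm (fun l => lam l * lk j l) (x / q) +
      (k.choose j : ℝ) * Real.log q ^ (k - j) * (if j = 1 then x / q else 0))| * el x ^ 2 ≤
      (∑ j ∈ range k, (k.choose j : ℝ) * (4 * V j)) * ((x * (1 / q)) * el x ^ k) := by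
    refine (mul_le_mul_of_nonneg_right (abs_sum_le_sum_abs _ _) (by positivity)).trans ?_
    rw [sum_mul, sum_mul]
    refine sum_le_sum (fun j hj => ?_)
    rw [← mul_add, abs_mul, abs_of_nonneg (by positivity)]
    have h4 := hb j (x / q) hy1
    set A := |Sm (fun l => lam l * lk j l) (x / q) + (if j = 1 then x / q else 0)| with hA
    have hA0 : 0 ≤ A := abs_nonneg _
    have hVj := hV j
    calc (k.choose j : ℝ) * Real.log q ^ (k - j) * A * el x ^ 2
        ≤ (k.choose j : ℝ) * el x ^ (k - j) * A * (2 * el (x / q)) ^ 2 := by gcongr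
      _ = (k.choose j : ℝ) * el x ^ (k - j) * 4 * (A * el (x / q) ^ 2) := by ring
      _ ≤ (k.choose j : ℝ) * el x ^ (k - j) * 4 * (V j * (x / q) * el (x / q) ^ j) := by gcongr
      _ ≤ (k.choose j : ℝ) * el x ^ (k - j) * 4 * (V j * (x / q) * el x ^ j) := by gcongr
      _ = (k.choose j : ℝ) * (4 * V j) * ((x * (1 / q)) * (el x ^ (k - j) * el x ^ j)) := by ring
      _ = _ := by rw [← pow_add, Nat.sub_add_cancel (mem_range.1 hj).le]
  refine h3.trans ?_
  have : 0 ≤ (x * (1 / q)) * el x ^ k := by positivity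
  nlinarith

end BS

namespace BS

lemma ZZ' (k m : ℕ) (hm : m ≠ 0) (hk : 1 ≤ k) : ∃ C : ℝ, 0 < C ∧ ∀ x : ℝ, 1 ≤ x → ∀ q : ℕ, q.Prime → (q : ℝ) ≤ x →
    Sm (fun l => lk k (q * l)) ((q : ℝ) ^ m) * el x ^ 2 ≤ C * el x ^ (k + 1) * (q : ℝ) ^ m := by
  obtain ⟨C, hC, h⟩ := ZZ k m hm
  refine ⟨C, hC, fun x hx q hq hqx => ?_⟩
  have hq1 : (1 : ℝ) ≤ q := by exact_mod_cast hq.one_le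
  have hel := one_le_el hq1
  have helx := el_mono (by linarith) hqx
  have h1 := h q hq
  obtain ⟨j, rfl⟩ : ∃ j, k = j + 1 := ⟨k - 1, by omega⟩
  have h2 : Sm (fun l => lk (j + 1) (q * l)) ((q : ℝ) ^ m) ≤ C * (q : ℝ) ^ m * el q ^ j := by
    refine le_of_mul_le_mul_right (h1.trans_eq ?_) (by linarith : 0 < el q)
    ring
  calc _ ≤ (C * (q : ℝ) ^ m * el x ^ j) * el x ^ 2 := by
        gcongr
        exact h2.trans (by gcongr)
    _ = _ := by ring

/-- main sum summand -/
noncomputable def ms (K r : ℕ) (x : ℝ) (q : ℕ) : ℝ :=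
  if q.Prime ∧ (q : ℝ) ^ (K + 1) ≤ x ∧ x < (q : ℝ) ^ (2 * K + 1) then Real.log q ^ r / q else 0

lemma SF (K k : ℕ) (hK : 1 ≤ K) (hk : 1 ≤ k) : ∃ C : ℝ, 0 < C ∧ ∀ x : ℝ, 1 ≤ x →
    |Sm (fun n => lk k n * f0 K n) x + mk k * x * Sm (ms K (k - 1) x) x| * el x ^ 2 ≤ C * x * el x ^ k := by
  obtain ⟨C1, hC1, hA⟩ := ZZ' k (2 * K) (by omega) hk
  obtain ⟨C2, hC2, hB⟩ := ZZ' k K (by omega) hk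
  obtain ⟨C3, hC3, hB2⟩ := II_B2 K k hK
  obtain ⟨C4, hC4, hB3⟩ := II_B3 K k hK
  obtain ⟨D1, hD1, s1⟩ := ppow_sum (2 * K)
  obtain ⟨D2, hD2, s2⟩ := ppow_sum K
  obtain ⟨D3, hD3, s3⟩ := inv_sum (2 * K + 1)
  refine ⟨C1 * D1 + C2 * D2 + (C3 + C4) * D3, by positivity, fun x hx => ?_⟩
  have hx0 : 0 < x := by linarith
  have hel := one_le_el hx
  have key : ∀ q : ℕ, 1 ≤ q → (q : ℝ) ≤ x →
      |(if q.Prime then II K k q x else 0) + mk k * x * ms K (k - 1) x q| * el x ^ 2 ≤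
      C1 * el x ^ (k + 1) * (if q.Prime ∧ (q : ℝ) ^ (2 * K + 1) ≤ x then (q : ℝ) ^ (2 * K) else 0) +
      C2 * el x ^ (k + 1) * (if q.Prime ∧ (q : ℝ) ^ (K + 1) ≤ x then (q : ℝ) ^ K else 0) +
      (C3 + C4) * x * el x ^ k * (if q.Prime ∧ x < (q : ℝ) ^ (2 * K + 1) then 1 / (q : ℝ) else 0) := by
    intro q hq1 hqx
    by_cases hq : q.Prime
    swap
    · simp [hq, ms]
    have hq1r : (1 : ℝ) ≤ q := by exact_mod_cast hq1
    have n1 : 0 ≤ C1 * el x ^ (k + 1) * (if q.Prime ∧ (q : ℝ) ^ (2 * K + 1) ≤ x then (q : ℝ) ^ (2 * K) else 0) := by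
      split_ifs <;> positivity
    have n2 : 0 ≤ C2 * el x ^ (k + 1) * (if q.Prime ∧ (q : ℝ) ^ (K + 1) ≤ x then (q : ℝ) ^ K else 0) := by
      split_ifs <;> positivity
    have n3 : 0 ≤ (C3 + C4) * x * el x ^ k * (if q.Prime ∧ x < (q : ℝ) ^ (2 * K + 1) then 1 / (q : ℝ) else 0) := by
      split_ifs <;> positivity
    rw [if_pos hq]
    rcases lt_or_ge x ((q : ℝ) ^ (K + 1)) with h1 | h1
    · rw [II_zero K k hq1 hx h1, ms, if_neg (fun h => absurd h.2.1 (not_le.2 h1))]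
      rw [mul_zero, add_zero, abs_zero, zero_mul]
      linarith
    rcases le_or_gt ((q : ℝ) ^ (2 * K + 1)) x with h2 | h2
    · rw [ms, if_neg (fun h => absurd h.2.2 (not_lt.2 h2)), mul_zero, add_zero]
      have h3 := II_A K k hq1 hx h2
      have h4 := hA x hx q hq hqx
      have h5 : |II K k q x| * el x ^ 2 ≤ C1 * el x ^ (k + 1) * (q : ℝ) ^ (2 * K) :=
        (mul_le_mul_of_nonneg_right h3 (by positivity)).trans h4
      rw [if_pos ⟨hq, h2⟩]
      linarith
    · rw [ms, if_pos ⟨hq, h1, h2⟩, if_pos (⟨hq, h1⟩ : q.Prime ∧ (q : ℝ) ^ (K + 1) ≤ x),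
        if_pos (⟨hq, h2⟩ : q.Prime ∧ x < (q : ℝ) ^ (2 * K + 1))]
      have h3 := II_B1 K k hq1 hx h1 h2
      have h4 := hB x hx q hq hqx
      have h5 := hB2 x hx q hq h1 h2
      have h6 := hB3 x hx q hq h1
      have h7 := (mul_le_mul_of_nonneg_right h3 (by positivity : 0 ≤ el x ^ 2)).trans h4
      generalize Sm (fun l => lam l * lk k (q * l)) (x / q) = a1 at *
      generalize Sm (fun l => lam l * lk' k q l) (x / q) = a2 at *
      generalize mk k * x * (Real.log q ^ (k - 1) / q) = a3 at *
      generalize II K k q x = a0 at *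
      have h8 : |a0 + a3| ≤ |a0 - a1| + |a1 - a2| + |a2 + a3| := by
        rw [show a0 + a3 = (a0 - a1) + (a1 - a2) + (a2 + a3) by ring]
        exact abs_add_three _ _ _
      have h9 := mul_le_mul_of_nonneg_right h8 (by positivity : 0 ≤ el x ^ 2)
      linarith
  rw [swap K _ hx0.le, ← Sm_mul, ← Sm_add]
  have h1 := mul_le_mul_of_nonneg_right (Sm_abs (fun q => (if q.Prime then II K k q x else 0) + mk k * x * ms K (k - 1) x q) x)
    (by positivity : 0 ≤ el x ^ 2)
  refine h1.trans ?_
  rw [mul_comm, ← Sm_mul]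
  have h2 := Sm_le (f := fun q => el x ^ 2 * |(if q.Prime then II K k q x else 0) + mk k * x * ms K (k - 1) x q|) hx0.le
    (fun q hq hqx => (mul_comm _ _).trans_le (key q hq hqx))
  refine h2.trans ?_
  rw [Sm_add, Sm_add, Sm_mul, Sm_mul, Sm_mul]
  have t1 := s1 x hx
  have t2 := s2 x hx
  have t3 := s3 x hx
  have u1 : C1 * el x ^ (k + 1) * Sm (fun q => if q.Prime ∧ (q : ℝ) ^ (2 * K + 1) ≤ x then (q : ℝ) ^ (2 * K) else 0) x ≤
      C1 * D1 * x * el x ^ k := by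
    calc _ = C1 * el x ^ k * (Sm (fun q => if q.Prime ∧ (q : ℝ) ^ (2 * K + 1) ≤ x then (q : ℝ) ^ (2 * K) else 0) x * el x) := by ring
      _ ≤ C1 * el x ^ k * (D1 * x) := by gcongr
      _ = _ := by ring
  have u2 : C2 * el x ^ (k + 1) * Sm (fun q => if q.Prime ∧ (q : ℝ) ^ (K + 1) ≤ x then (q : ℝ) ^ K else 0) x ≤
      C2 * D2 * x * el x ^ k := by
    calc _ = C2 * el x ^ k * (Sm (fun q => if q.Prime ∧ (q : ℝ) ^ (K + 1) ≤ x then (q : ℝ) ^ K else 0) x * el x) := by ring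
      _ ≤ C2 * el x ^ k * (D2 * x) := by gcongr
      _ = _ := by ring
  have u3 : (C3 + C4) * x * el x ^ k * Sm (fun q => if q.Prime ∧ x < (q : ℝ) ^ (2 * K + 1) then 1 / (q : ℝ) else 0) x ≤
      (C3 + C4) * x * el x ^ k * D3 := by gcongr
  linarith

lemma ms_eq (K r : ℕ) {x : ℝ} (hx : 1 ≤ x) :
    Sm (ms K r x) x = Sm (pw r) (rt K x) - Sm (pw r) (rt (2 * K) x) := by
  have hle : rt (2 * K) x ≤ rt K x := by
    rw [le_rt_iff K hx (by linarith [one_le_rt (2 * K) hx])]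
    conv_rhs => rw [← rt_pow (2 * K) hx]
    exact pow_le_pow_right₀ (one_le_rt _ hx) (by omega)
  have h1 := one_le_rt K hx
  have h2 := one_le_rt (2 * K) hx
  rw [← Sm_restrict (pw r) (by linarith) (rt_le K hx), ← Sm_restrict (pw r) (by linarith) (rt_le (2 * K) hx),
    ← Sm_sub]
  refine Sm_congr (by linarith) (fun q hq _ => ?_)
  have hq0 : (0 : ℝ) ≤ q := by positivity
  simp only [ms, ← not_le, ← le_rt_iff K hx hq0]
  have h3 := le_rt_iff (2 * K) hx hq0
  simp only [← h3]
  by_cases hp : q.Prime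
  · by_cases a1 : (q : ℝ) ≤ rt (2 * K) x
    · have a2 := a1.trans hle
      simp [a1, a2]
    · by_cases a2 : (q : ℝ) ≤ rt K x
      · simp [a1, a2, hp, pw]
      · simp [a1, a2]
  · simp [hp, pw]

/-- density constant -/
noncomputable def dc (K r : ℕ) : ℝ := ((1 / ((K : ℝ) + 1)) ^ r - (1 / (2 * (K : ℝ) + 1)) ^ r) / r

lemma dc_pos (K r : ℕ) (hK : 1 ≤ K) (hr : 1 ≤ r) : 0 < dc K r := by
  unfold dc
  have hK' : (1 : ℝ) ≤ K := by exact_mod_cast hK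
  have hr' : (1 : ℝ) ≤ r := by exact_mod_cast hr
  have h1 : (1 / (2 * (K : ℝ) + 1)) < 1 / ((K : ℝ) + 1) := by
    apply one_div_lt_one_div_of_lt <;> linarith
  have h2 := pow_lt_pow_left₀ h1 (by positivity) (by omega : r ≠ 0)
  apply div_pos <;> linarith

lemma ms_main (K r : ℕ) : ∃ C : ℝ, 0 < C ∧ ∀ x : ℝ, 1 ≤ x →
    |Sm (ms K (r + 1) x) x - dc K (r + 1) * Real.log x ^ (r + 1)| ≤ C * el x ^ r := by
  obtain ⟨C, hC, h⟩ := mertens_pow r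
  refine ⟨2 * C, by positivity, fun x hx => ?_⟩
  have h1 := one_le_rt K hx
  have h2 := one_le_rt (2 * K) hx
  have a1 := h _ h1
  have a2 := h _ h2
  have b1 : el (rt K x) ^ r ≤ el x ^ r :=
    pow_le_pow_left₀ (by linarith [one_le_el h1]) (el_mono (by linarith) (rt_le K hx)) r
  have b2 : el (rt (2 * K) x) ^ r ≤ el x ^ r :=
    pow_le_pow_left₀ (by linarith [one_le_el h2]) (el_mono (by linarith) (rt_le (2 * K) hx)) r
  have c1 : C * el (rt K x) ^ r ≤ C * el x ^ r := by gcongr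
  have c2 : C * el (rt (2 * K) x) ^ r ≤ C * el x ^ r := by gcongr
  rw [log_rt K hx] at a1
  rw [log_rt (2 * K) hx] at a2
  rw [ms_eq K _ hx]
  have e : dc K (r + 1) * Real.log x ^ (r + 1) = (Real.log x / (K + 1)) ^ (r + 1) / (r + 1) -
      (Real.log x / ((2 * K : ℕ) + 1)) ^ (r + 1) / (r + 1) := by
    unfold dc
    push_cast
    rw [div_pow, div_pow, div_pow, div_pow]
    ring
  rw [e]
  rw [abs_le] at a1 a2 ⊢
  constructor <;> linarith

end BS

namespace BS

/-- the sequence -/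
noncomputable def aa (K n : ℕ) : ℝ := 1 + 1 / 2 * lam n + 1 / (2 * (2 * K + 1)) * f0 K n

/-- deficits -/
noncomputable def dd (K j : ℕ) : ℝ := if j = 0 then 1 / 2 else 1 / (2 * (2 * K + 1)) * dc K j

lemma dd_pos (K j : ℕ) (hK : 1 ≤ K) : 0 < dd K j := by
  unfold dd
  split_ifs with h
  · norm_num
  · have := dc_pos K j hK (by omega)
    positivity

lemma aa_bd (K n : ℕ) : 0 ≤ aa K n ∧ aa K n ≤ 2 := by
  have h1 := abs_le.1 (abs_lam_le n)
  have h2 : |1 / (2 * (2 * (K : ℝ) + 1)) * f0 K n| ≤ 1 / 2 := by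
    rw [abs_mul, abs_of_nonneg (by positivity)]
    calc 1 / (2 * (2 * (K : ℝ) + 1)) * |f0 K n| ≤ 1 / (2 * (2 * (K : ℝ) + 1)) * (2 * K + 1) := by
          gcongr; exact f0_abs K n
      _ = _ := by field_simp
  have h3 := abs_le.1 h2
  unfold aa
  constructor <;> linarith

lemma Ssum_eq (K k : ℕ) (x : ℝ) : Ssum (aa K) k x = Sm (fun n => lk k n) x + 1 / 2 * Sm (fun n => lam n * lk k n) x
    + 1 / (2 * (2 * K + 1)) * Sm (fun n => lk k n * f0 K n) x := by
  rw [← Sm_mul, ← Sm_mul, ← Sm_add, ← Sm_add]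
  unfold Ssum Sm
  refine sum_congr rfl (fun n _ => ?_)
  rw [Lambdak_eq, aa]; ring

lemma msdiff (K j : ℕ) : ∃ C : ℝ, 0 < C ∧ ∀ x : ℝ, 1 ≤ x →
    |1 / 2 * (if j + 1 = 1 then x else 0) + 1 / (2 * (2 * K + 1)) * (mk (j + 1) * x * Sm (ms K (j + 1 - 1) x) x)
      - (j + 1) * x * (dd K j * Real.log x ^ j)| * el x ≤ C * x * el x ^ j := by
  cases j with
  | zero =>
    refine ⟨1, one_pos, fun x hx => ?_⟩
    have hel := one_le_el hx
    simp only [mk, dd]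
    norm_num
    ring_nf
    norm_num
    linarith
  | succ r =>
    obtain ⟨C, hC, h⟩ := ms_main K r
    refine ⟨(r + 2) * C, by positivity, fun x hx => ?_⟩
    have hel := one_le_el hx
    have h1 := h x hx
    rw [if_neg (by omega), mk, if_pos (by omega), dd, if_neg (by omega), Nat.add_sub_cancel]
    rw [show 1 / 2 * 0 + 1 / (2 * (2 * (K : ℝ) + 1)) * (((r + 1 + 1 : ℕ) : ℝ) * x * Sm (ms K (r + 1) x) x)
      - ((r + 1 : ℕ) + 1) * x * (1 / (2 * (2 * K + 1)) * dc K (r + 1) * Real.log x ^ (r + 1)) =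
      1 / (2 * (2 * (K : ℝ) + 1)) * ((r + 2) * x) * (Sm (ms K (r + 1) x) x - dc K (r + 1) * Real.log x ^ (r + 1)) by
        push_cast; ring, abs_mul, abs_of_nonneg (by positivity)]
    have h2 : 1 / (2 * (2 * (K : ℝ) + 1)) ≤ 1 := by
      rw [div_le_one (by positivity)]
      have : (0 : ℝ) ≤ K := by positivity
      linarith
    calc _ ≤ 1 * ((r + 2) * x) * (C * el x ^ r) * el x := by gcongr
      _ = _ := by ring

lemma SS (K j : ℕ) (hK : 1 ≤ K) : ∃ C : ℝ, 0 < C ∧ ∀ x : ℝ, 1 ≤ x →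
    |Ssum (aa K) (j + 1) x - (j + 1) * x * (el x ^ j - dd K j * Real.log x ^ j)| * el x ≤ C * x * el x ^ j := by
  obtain ⟨C1, hC1, h1⟩ := VK j
  obtain ⟨C2, hC2, h2⟩ := VL (j + 1)
  obtain ⟨C3, hC3, h3⟩ := SF K (j + 1) hK (by omega)
  obtain ⟨C4, hC4, h4⟩ := msdiff K j
  refine ⟨C1 + C2 + C3 + C4, by positivity, fun x hx => ?_⟩
  have hel := one_le_el hx
  have h1 := h1 x hx
  have h2 := h2 x hx
  have h3 := h3 x hx
  have h4 := h4 x hx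
  rw [Ssum_eq]
  generalize Sm (fun n => lk (j + 1) n) x = s1 at *
  generalize Sm (fun n => lam n * lk (j + 1) n) x = s2 at *
  generalize Sm (fun n => lk (j + 1) n * f0 K n) x = s3 at *
  generalize (if j + 1 = 1 then x else 0) = t2 at *
  generalize mk (j + 1) * x * Sm (ms K (j + 1 - 1) x) x = t3 at *
  have h2' : |s2 + t2| * el x ≤ C2 * x * el x ^ j := by
    refine le_of_mul_le_mul_right (le_trans (le_of_eq (by ring)) (h2.trans_eq ?_)) (by linarith : 0 < el x)
    ring
  have h3' : |s3 + t3| * el x ≤ C3 * x * el x ^ j := by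
    refine le_of_mul_le_mul_right (le_trans (le_of_eq (by ring)) (h3.trans_eq ?_)) (by linarith : 0 < el x)
    ring
  have hc : 1 / (2 * (2 * (K : ℝ) + 1)) ≤ 1 := by
    rw [div_le_one (by positivity)]
    have : (0 : ℝ) ≤ K := by positivity
    linarith
  have hc0 : 0 ≤ 1 / (2 * (2 * (K : ℝ) + 1)) := by positivity
  generalize 1 / (2 * (2 * (K : ℝ) + 1)) = c at *
  have key : |s1 + 1 / 2 * s2 + c * s3 - (j + 1) * x * (el x ^ j - dd K j * Real.log x ^ j)| ≤
      |s1 - (j + 1) * x * el x ^ j| + |s2 + t2| + |s3 + t3| +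
        |1 / 2 * t2 + c * t3 - (j + 1) * x * (dd K j * Real.log x ^ j)| := by
    rw [show s1 + 1 / 2 * s2 + c * s3 - (j + 1) * x * (el x ^ j - dd K j * Real.log x ^ j) =
      (s1 - (j + 1) * x * el x ^ j) + 1 / 2 * (s2 + t2) + c * (s3 + t3) +
        -(1 / 2 * t2 + c * t3 - (j + 1) * x * (dd K j * Real.log x ^ j)) by ring]
    have q1 : |1 / 2 * (s2 + t2)| ≤ |s2 + t2| := by
      rw [abs_mul]; norm_num
      linarith [abs_nonneg (s2 + t2)]
    have q2 : |c * (s3 + t3)| ≤ |s3 + t3| := by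
      rw [abs_mul, abs_of_nonneg hc0]; exact mul_le_of_le_one_left (abs_nonneg _) hc
    refine (abs_add_le _ _).trans ?_
    rw [abs_neg]
    refine add_le_add ((abs_add_three _ _ _).trans ?_) le_rfl
    linarith
  have := mul_le_mul_of_nonneg_right key (by linarith : 0 ≤ el x)
  linarith

lemma tend_T (K j : ℕ) (hK : 1 ≤ K) :
    Tendsto (fun x : ℝ => Tquot (aa K) (j + 1) x) atTop (nhds (1 - dd K j)) := by
  obtain ⟨C, hC, h⟩ := SS K j hK
  have hlog := Real.tendsto_log_atTop
  have hinv : Tendsto (fun x : ℝ => (Real.log x)⁻¹) atTop (nhds 0) := tendsto_inv_atTop_zero.comp hlog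
  have hrho : Tendsto (fun x : ℝ => el x / Real.log x) atTop (nhds 1) := by
    have : Tendsto (fun x : ℝ => (Real.log x)⁻¹ + 1) atTop (nhds (0 + 1)) := hinv.add_const 1
    rw [zero_add] at this
    refine this.congr' ?_
    filter_upwards [eventually_gt_atTop 1] with x hx
    have := Real.log_pos hx
    unfold el; field_simp
  have hM : Tendsto (fun x : ℝ => (el x / Real.log x) ^ j - dd K j) atTop (nhds (1 - dd K j)) := by
    have := (hrho.pow j).sub_const (dd K j)
    rwa [one_pow] at this
  have hE : Tendsto (fun x : ℝ => C * (el x / Real.log x) ^ j * (Real.log x)⁻¹) atTop (nhds 0) := by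
    have := ((hrho.pow j).const_mul C).mul hinv
    simpa using this
  have hD : Tendsto (fun x : ℝ => Tquot (aa K) (j + 1) x - ((el x / Real.log x) ^ j - dd K j)) atTop (nhds 0) := by
    refine squeeze_zero_norm' ?_ hE
    filter_upwards [eventually_gt_atTop 1] with x hx
    have hl := Real.log_pos hx
    have hx0 : 0 < x := by linarith
    have h1 := h x hx.le
    have hel := one_le_el hx.le
    have e : Tquot (aa K) (j + 1) x - ((el x / Real.log x) ^ j - dd K j) =
        (Ssum (aa K) (j + 1) x - (j + 1) * x * (el x ^ j - dd K j * Real.log x ^ j)) / ((j + 1) * x * Real.log x ^ j) := by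
      unfold Tquot
      rw [Nat.add_sub_cancel, div_pow]
      push_cast
      field_simp
    rw [e, Real.norm_eq_abs, abs_div, abs_of_pos (by positivity : 0 < (j + 1) * x * Real.log x ^ j),
      div_le_iff₀ (by positivity)]
    have hle : Real.log x ≤ el x := log_le_el
    generalize Ssum (aa K) (j + 1) x - (j + 1) * x * (el x ^ j - dd K j * Real.log x ^ j) = D at *
    have h2 : |D| * Real.log x ≤ C * x * el x ^ j :=
      (mul_le_mul_of_nonneg_left hle (abs_nonneg _)).trans h1
    rw [← le_div_iff₀ hl] at h2
    have hj : (1 : ℝ) ≤ j + 1 := by linarith [(Nat.cast_nonneg j : (0 : ℝ) ≤ j)]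
    calc |D| ≤ 1 * (C * x * el x ^ j / Real.log x) := by rw [one_mul]; exact h2
      _ ≤ (j + 1) * (C * x * el x ^ j / Real.log x) := by gcongr
      _ = _ := by rw [div_pow]; field_simp
  have := hD.add hM
  simpa using this

end BS

namespace BS

lemma Sm_mult {e : ℕ} (he : 0 < e) (h : ℕ → ℝ) {y : ℝ} (hy : 0 ≤ y) :
    Sm (fun l => if e ∣ l then h l else 0) y = Sm (fun m => h (e * m)) (y / e) := by
  have he0 : (0 : ℝ) < e := by exact_mod_cast he
  unfold Sm
  rw [← sum_filter]
  refine sum_bij' (fun l _ => l / e) (fun m _ => e * m) ?_ ?_ ?_ ?_ ?_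
  · intro l hl
    rw [mem_filter, mem_Icc_floor hy] at hl
    obtain ⟨⟨h1, h2⟩, m, rfl⟩ := hl
    rw [Nat.mul_div_cancel_left _ he, mem_Icc_floor (by positivity), le_div_iff₀ he0]
    push_cast at h2
    exact ⟨Nat.pos_of_ne_zero (fun h => by simp [h] at h1), by linarith⟩
  · intro m hm
    rw [mem_Icc_floor (by positivity), le_div_iff₀ he0] at hm
    rw [mem_filter, mem_Icc_floor hy]
    push_cast
    exact ⟨⟨Nat.mul_pos he hm.1, by linarith⟩, dvd_mul_right _ _⟩
  · intro l hl
    rw [mem_filter] at hl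
    exact Nat.mul_div_cancel' hl.2
  · intro m hm
    exact Nat.mul_div_cancel_left _ he
  · intro l hl
    rw [mem_filter] at hl
    rw [Nat.mul_div_cancel' hl.2]

lemma el_rpow_ge {δ : ℝ} (hδ : δ ≤ 1) {x : ℝ} (hx : 1 ≤ x) : δ * el x ≤ el (x ^ δ) := by
  unfold el
  rw [Real.log_rpow (by linarith)]
  linarith

lemma GG (B : ℕ) {δ : ℝ} (h0 : 0 < δ) (h1 : δ ≤ 1) : ∃ C : ℝ, 0 < C ∧ ∀ x : ℝ, 1 ≤ x → ∀ y : ℝ, x ^ δ ≤ y →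
    ∀ z ≤ y, |Sm lam z| ≤ C * y / el x ^ B := by
  obtain ⟨C, hC, hb⟩ := Sav_sup Sav_lam B
  refine ⟨C / δ ^ B, by positivity, fun x hx y hy z hz => ?_⟩
  have hx1 : 1 ≤ x ^ δ := Real.one_le_rpow hx h0.le
  have hy1 := hx1.trans hy
  refine (hb y hy1 z hz).trans ?_
  have e1 := one_le_el hx
  have : δ * el x ≤ el y := (el_rpow_ge h1 hx).trans (el_mono (by linarith) hy)
  calc C * y / el y ^ B ≤ C * y / (δ * el x) ^ B := by gcongr
    _ = _ := by rw [mul_pow]; field_simp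

lemma trunc_bd {y A M : ℝ} (hy : 0 ≤ y) (hA : 0 ≤ A) (h : ∀ z ≤ y, |Sm lam z| ≤ M) :
    |Sm (fun m => if (m : ℝ) ≤ A then lam m else 0) y| ≤ M := by
  have : Sm (fun m => if (m : ℝ) ≤ A then lam m else 0) y = Sm lam (min y A) := by
    rw [← Sm_restrict lam (le_min hy hA) (min_le_left y A)]
    refine Sm_congr hy (fun n _ hn => ?_)
    simp [hn]
  rw [this]
  exact h _ (min_le_left _ _)

lemma inner_bd (K : ℕ) {q e : ℕ} (hq : 1 ≤ q) (he : 1 ≤ e) {u M : ℝ} (hu : 0 ≤ u)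
    (h : ∀ z ≤ u / e, |Sm lam z| ≤ M) :
    |Sm (fun l => if e ∣ l then ww K q l else 0) u| ≤ 2 * M := by
  have he0 : (0 : ℝ) < e := by exact_mod_cast he
  rw [Sm_mult he _ hu]
  have hy : 0 ≤ u / e := by positivity
  have : Sm (fun m => ww K q (e * m)) (u / e) = lam e *
      (Sm (fun m => if (m : ℝ) ≤ (q : ℝ) ^ (2 * K) / e then lam m else 0) (u / e) -
       Sm (fun m => if (m : ℝ) ≤ (q : ℝ) ^ K / e then lam m else 0) (u / e)) := by
    rw [← Sm_sub, ← Sm_mul]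
    refine Sm_congr hy (fun n _ _ => ?_)
    have a1 : (n : ℝ) ≤ (q : ℝ) ^ (2 * K) / e ↔ e * n ≤ q ^ (2 * K) := by
      rw [le_div_iff₀ he0, mul_comm]; exact_mod_cast Iff.rfl
    have a2 : (n : ℝ) ≤ (q : ℝ) ^ K / e ↔ e * n ≤ q ^ K := by
      rw [le_div_iff₀ he0, mul_comm]; exact_mod_cast Iff.rfl
    simp only [a1, a2, ww, lam_mul]
    have hk : q ^ K ≤ q ^ (2 * K) := Nat.pow_le_pow_right hq (by omega)
    by_cases b2 : e * n ≤ q ^ K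
    · have b1 := b2.trans hk
      simp [b1, b2, not_lt.2 b2]
    · by_cases b1 : e * n ≤ q ^ (2 * K)
      · simp [b1, b2, not_le.1 b2]
      · simp [b1, b2]
  rw [this, abs_mul]
  have t1 := trunc_bd (A := (q : ℝ) ^ (2 * K) / e) hy (by positivity) h
  have t2 := trunc_bd (A := (q : ℝ) ^ K / e) hy (by positivity) h
  have t3 := abs_lam_le e
  have t4 := abs_sub (Sm (fun m => if (m : ℝ) ≤ (q : ℝ) ^ (2 * K) / e then lam m else 0) (u / e))
    (Sm (fun m => if (m : ℝ) ≤ (q : ℝ) ^ K / e then lam m else 0) (u / e))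
  calc _ ≤ 1 * |(Sm (fun m => if (m : ℝ) ≤ (q : ℝ) ^ (2 * K) / e then lam m else 0) (u / e) -
       Sm (fun m => if (m : ℝ) ≤ (q : ℝ) ^ K / e then lam m else 0) (u / e))| := by gcongr
    _ ≤ _ := by linarith

lemma inner_zero (K : ℕ) {q : ℕ} (hq : 1 ≤ q) {x : ℝ} (hx : 1 ≤ x) (g : ℕ → ℝ) (h : ¬ (q : ℝ) ≤ rt K x) :
    Sm (fun l => ww K q l * g (q * l)) (x / q) = 0 := by
  have hq0 : (0 : ℝ) < q := by exact_mod_cast hq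
  rw [le_rt_iff K hx hq0.le, not_le] at h
  unfold Sm
  refine sum_eq_zero (fun l hl => ?_)
  rw [mem_Icc_floor (by positivity), le_div_iff₀ hq0] at hl
  rw [ww, if_neg, zero_mul]
  rintro ⟨h1, -⟩
  have h1 : (q : ℝ) ^ K < l := by exact_mod_cast h1
  rw [pow_succ] at h
  have : (q : ℝ) ^ K * q ≤ l * q := by gcongr
  linarith [hl.2]

lemma f0_part (K B : ℕ) {ν : ℝ} (h0 : 0 < ν) (hK : (1 : ℝ) / (K + 1) < 1 - ν) : ∃ C : ℝ, 0 < C ∧ ∀ x : ℝ, 1 ≤ x →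
    ∀ d : ℕ, 1 ≤ d → (d : ℝ) ≤ x ^ ν → |Sm (fun n => (if d ∣ n then 1 else 0) * f0 K n) x| ≤
      C * x / el x ^ B * Sm (fun q => 1 / (d : ℝ) * (1 / q) + if q ∣ d then 1 / (d : ℝ) else 0) x := by
  have hKp : (0 : ℝ) < 1 / (K + 1) := by positivity
  obtain ⟨C, hC, hb⟩ := GG B (δ := 1 - ν - 1 / (K + 1)) (by linarith) (by linarith)
  refine ⟨2 * C, by positivity, fun x hx d hd hdx => ?_⟩
  have hx0 : 0 < x := by linarith
  have hd0 : (0 : ℝ) < d := by exact_mod_cast hd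
  have e1 := one_le_el hx
  rw [swap K (fun n => if d ∣ n then 1 else 0) hx0.le, ← Sm_mul]
  refine (Sm_abs _ _).trans (Sm_le hx0.le (fun q hq1 hqx => ?_))
  have hq0 : (0 : ℝ) < q := by exact_mod_cast hq1
  have hnn : 0 ≤ (if q ∣ d then 1 / (d : ℝ) else 0) := by split_ifs <;> positivity
  have hnn2 : 0 ≤ 1 / (d : ℝ) * (1 / q) := by positivity
  have hW : 0 ≤ 2 * C * x / el x ^ B := by positivity
  split_ifs with hp hqd hqd
  rotate_left 2
  · rw [abs_zero]; positivity
  · rw [abs_zero]; positivity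
  all_goals
    by_cases hr : (q : ℝ) ≤ rt K x
    swap
    · rw [inner_zero K hq1 hx (fun n => if d ∣ n then 1 else 0) hr, abs_zero]; positivity
  · have hlow : x ^ (1 - ν - 1 / ((K : ℝ) + 1)) ≤ x / d := by
      rw [le_div_iff₀ hd0]
      calc x ^ (1 - ν - 1 / ((K : ℝ) + 1)) * d ≤ x ^ (1 - ν) * x ^ ν := by
            refine mul_le_mul (Real.rpow_le_rpow_of_exponent_le hx (by linarith)) hdx hd0.le (by positivity)
        _ = x := by rw [← Real.rpow_add hx0]; simp
    obtain ⟨e, rfl⟩ := hqd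
    have he : 1 ≤ e := Nat.pos_of_ne_zero (fun h => by simp [h] at hd)
    have he0 : (0 : ℝ) < e := by exact_mod_cast he
    have hc : Sm (fun l => ww K q l * (if q * e ∣ q * l then 1 else 0)) (x / q) =
        Sm (fun l => if e ∣ l then ww K q l else 0) (x / q) := by
      refine Sm_congr (by positivity) (fun l _ _ => ?_)
      simp [Nat.mul_dvd_mul_iff_left hq1]
    rw [hc]
    refine (inner_bd K hq1 he (u := x / q) (by positivity)
      (fun z hz => hb x hx _ hlow z (by rw [Nat.cast_mul, ← div_div]; exact hz))).trans ?_
    have : 2 * (C * (x / ((q * e : ℕ) : ℝ)) / el x ^ B) = 2 * C * x / el x ^ B * (1 / ((q * e : ℕ) : ℝ)) := by ring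
    rw [this]
    gcongr
    linarith
  · have hlow : x ^ (1 - ν - 1 / ((K : ℝ) + 1)) ≤ x / q / d := by
      rw [le_div_iff₀ hd0, le_div_iff₀ hq0]
      calc x ^ (1 - ν - 1 / ((K : ℝ) + 1)) * d * q ≤ x ^ (1 - ν - 1 / ((K : ℝ) + 1)) * x ^ ν * x ^ (1 / ((K : ℝ) + 1)) := by
            gcongr
            exact hr
        _ = x := by 
          rw [← Real.rpow_add hx0, ← Real.rpow_add hx0,
            show 1 - ν - 1 / ((K : ℝ) + 1) + ν + 1 / ((K : ℝ) + 1) = 1 by ring, Real.rpow_one]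
    have hcop : Nat.Coprime d q := ((Nat.Prime.coprime_iff_not_dvd hp).2 hqd).symm
    have hc : Sm (fun l => ww K q l * (if d ∣ q * l then 1 else 0)) (x / q) =
        Sm (fun l => if d ∣ l then ww K q l else 0) (x / q) := by
      refine Sm_congr (by positivity) (fun l _ _ => ?_)
      simp [hcop.dvd_mul_left]
    rw [hc]
    refine (inner_bd K hq1 hd (u := x / q) (by positivity)
      (fun z hz => hb x hx _ hlow z hz)).trans ?_
    rw [add_zero]
    apply le_of_eq
    field_simp

lemma dq_sum {x : ℝ} (hx : 1 ≤ x) :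
    Sm (fun d => Sm (fun q => 1 / (d : ℝ) * (1 / q) + if q ∣ d then 1 / (d : ℝ) else 0) x) x ≤ 2 * el x ^ 2 := by
  have e1 := one_le_el hx
  have hi := Sm_inv_le hx
  have hi0 : 0 ≤ Sm (fun n => 1 / (n : ℝ)) x := Sm_nonneg (fun n => by positivity) x
  simp only [Sm_add, Sm_mul]
  have a1 : Sm (fun d => 1 / (d : ℝ) * Sm (fun q => 1 / (q : ℝ)) x) x ≤ el x ^ 2 := by
    simp only [mul_comm (1 / (_ : ℝ)) (Sm _ _)]
    rw [Sm_mul, sq]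
    gcongr
  have a2 : Sm (fun d => Sm (fun q => if q ∣ d then 1 / (d : ℝ) else 0) x) x ≤ el x ^ 2 := by
    have : Sm (fun d => Sm (fun q => if q ∣ d then 1 / (d : ℝ) else 0) x) x =
      Sm (fun q => Sm (fun d => if q ∣ d then 1 / (d : ℝ) else 0) x) x := by
      unfold Sm; exact sum_comm
    rw [this, sq]
    calc _ ≤ Sm (fun q => el x * (1 / q)) x := by
          refine Sm_le (by linarith) (fun q hq hqx => ?_)
          have hq0 : (0 : ℝ) < q := by exact_mod_cast hq
          rw [Sm_mult hq (fun d => 1 / (d : ℝ)) (by linarith)]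
          have hxq : 1 ≤ x / q := by rw [le_div_iff₀ hq0]; linarith
          have b := Sm_inv_le hxq
          have b2 : el (x / q) ≤ el x := el_mono (by positivity) (div_le_self (by linarith) (by exact_mod_cast hq))
          have : Sm (fun m => 1 / ((q * m : ℕ) : ℝ)) (x / q) = 1 / q * Sm (fun m => 1 / (m : ℝ)) (x / q) := by
            rw [← Sm_mul]
            congr 1; ext m; push_cast; rw [one_div_mul_one_div]
          rw [this, mul_comm]
          gcongr
          linarith
      _ ≤ _ := by rw [Sm_mul]; gcongr
  linarith

lemma pow_small (B : ℕ) {ν : ℝ} (h0 : 0 < ν) (h1 : ν < 1) : ∃ C : ℝ, 0 < C ∧ ∀ x : ℝ, 1 ≤ x →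
    x ^ ν ≤ C * x / el x ^ B := by
  have hδ : 0 < 1 - ν := by linarith
  refine ⟨3 * B.factorial / (1 - ν) ^ B, by positivity, fun x hx => ?_⟩
  have e1 := one_le_el hx
  have hx0 : 0 < x := by linarith
  rw [le_div_iff₀ (by positivity)]
  have b := el_pow_le B (Real.one_le_rpow hx hδ.le)
  have b1 : ((1 - ν) * el x) ^ B ≤ el (x ^ (1 - ν)) ^ B := by
    gcongr
    exact el_rpow_ge (by linarith) hx
  rw [mul_pow] at b1
  have b2 : x ^ ν * x ^ (1 - ν) = x := by rw [← Real.rpow_add hx0]; simp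
  have b3 : el x ^ B ≤ 3 * B.factorial / (1 - ν) ^ B * x ^ (1 - ν) := by
    rw [div_mul_eq_mul_div, le_div_iff₀ (by positivity)]
    linarith
  calc x ^ ν * el x ^ B ≤ x ^ ν * (3 * B.factorial / (1 - ν) ^ B * x ^ (1 - ν)) := by gcongr
    _ = 3 * B.factorial / (1 - ν) ^ B * (x ^ ν * x ^ (1 - ν)) := by ring
    _ = _ := by rw [b2]

lemma R_nat (K B : ℕ) {ν : ℝ} (h0 : 0 < ν) (hK : (1 : ℝ) / (K + 1) < 1 - ν) : ∃ C : ℝ, 0 < C ∧ ∀ x : ℝ, 1 ≤ x →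
    Sm (fun d => |Sm (fun n => if d ∣ n then aa K n else 0) x - x / d|) (x ^ ν) ≤ C * x / el x ^ B := by
  have hKp : (0 : ℝ) < 1 / (K + 1) := by positivity
  obtain ⟨C1, hC1, hb1⟩ := pow_small B h0 (by linarith)
  obtain ⟨C2, hC2, hb2⟩ := GG (B + 2) (δ := 1 - ν) (by linarith) (by linarith)
  obtain ⟨C3, hC3, hb3⟩ := f0_part K (B + 2) h0 hK
  refine ⟨C1 + C2 + 2 * C3, by positivity, fun x hx => ?_⟩
  have hx0 : 0 < x := by linarith
  have e1 := one_le_el hx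
  have hxν : 1 ≤ x ^ ν := Real.one_le_rpow hx h0.le
  have hxν2 : x ^ ν ≤ x := by
    calc x ^ ν ≤ x ^ (1 : ℝ) := Real.rpow_le_rpow_of_exponent_le hx (by linarith)
      _ = x := Real.rpow_one x
  set Q : ℕ → ℝ := fun d => Sm (fun q => 1 / (d : ℝ) * (1 / q) + if q ∣ d then 1 / (d : ℝ) else 0) x with hQ
  have hQ0 : ∀ d, 0 ≤ Q d := fun d => Sm_nonneg (fun q => by split_ifs <;> positivity) x
  have ext : ∀ f : ℕ → ℝ, (∀ n, 0 ≤ f n) → Sm f (x ^ ν) ≤ Sm f x := by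
    intro f hf
    unfold Sm
    refine sum_le_sum_of_subset_of_nonneg (Icc_subset_Icc le_rfl (Nat.floor_mono hxν2)) (fun n _ _ => hf n)
  have key : ∀ d : ℕ, 1 ≤ d → (d : ℝ) ≤ x ^ ν →
      |Sm (fun n => if d ∣ n then aa K n else 0) x - x / d| ≤
        (1 + C2 * x / el x ^ (B + 2) * (1 / d)) + C3 * x / el x ^ (B + 2) * Q d := by
    intro d hd hdx
    have hd0 : (0 : ℝ) < d := by exact_mod_cast hd
    have hxd : 1 ≤ x / d := by rw [le_div_iff₀ hd0]; linarith
    have hdec : Sm (fun n => if d ∣ n then aa K n else 0) x = (⌊x / d⌋₊ : ℝ) + 1 / 2 * (lam d * Sm lam (x / d))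
        + 1 / (2 * (2 * K + 1)) * Sm (fun n => (if d ∣ n then 1 else 0) * f0 K n) x := by
      rw [← Sm_one, ← Sm_mult hd (fun _ => 1) hx0.le, ← Sm_mul (lam d)]
      simp only [← lam_mul]
      rw [← Sm_mult hd lam hx0.le, ← Sm_mul, ← Sm_mul, ← Sm_add, ← Sm_add]
      congr 1; ext n
      split_ifs <;> simp [aa]
    have c1 := floor_err hxd
    have hlow : x ^ (1 - ν) ≤ x / d := by
      rw [le_div_iff₀ hd0]
      calc x ^ (1 - ν) * d ≤ x ^ (1 - ν) * x ^ ν := by gcongr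
        _ = x := by rw [← Real.rpow_add hx0]; simp
    have c2 := hb2 x hx _ hlow _ le_rfl
    have c3 := hb3 x hx d hd hdx
    have c4 : |lam d * Sm lam (x / d)| ≤ |Sm lam (x / d)| := by
      rw [abs_mul]; exact mul_le_of_le_one_left (abs_nonneg _) (abs_lam_le d)
    rw [hdec]
    have hcc : (1 : ℝ) / (2 * (2 * K + 1)) ≤ 1 := by
      rw [div_le_one (by positivity)]; linarith [(Nat.cast_nonneg K : (0 : ℝ) ≤ K)]
    have c5 : |1 / (2 * (2 * (K : ℝ) + 1)) * Sm (fun n => (if d ∣ n then 1 else 0) * f0 K n) x| ≤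
        |Sm (fun n => (if d ∣ n then 1 else 0) * f0 K n) x| := by
      rw [abs_mul, abs_of_nonneg (by positivity : (0 : ℝ) ≤ 1 / (2 * (2 * K + 1)))]
      exact mul_le_of_le_one_left (abs_nonneg _) hcc
    have c6 : C2 * (x / d) / el x ^ (B + 2) = C2 * x / el x ^ (B + 2) * (1 / d) := by ring
    rw [c6] at c2
    have c7 := c5.trans c3
    have c8 := c4.trans c2
    rw [abs_le] at c1 c7 c8 ⊢
    constructor <;> nlinarith [c1.1, c1.2, c7.1, c7.2, c8.1, c8.2]
  refine (Sm_le (by linarith) key).trans ?_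
  rw [Sm_add, Sm_add, Sm_mul, Sm_mul]
  have s1 := (Sm_one_le (by linarith : 0 ≤ x ^ ν)).trans (hb1 x hx)
  have s2 := (ext (fun n => 1 / (n : ℝ)) (fun n => by positivity)).trans (Sm_inv_le hx)
  have s3 : Sm Q (x ^ ν) ≤ 2 * el x ^ 2 := (ext Q hQ0).trans (dq_sum hx)
  have s2' : Sm (fun n => 1 / (n : ℝ)) (x ^ ν) ≤ el x ^ 2 := by nlinarith
  have t2 : C2 * x / el x ^ (B + 2) * Sm (fun n => 1 / (n : ℝ)) (x ^ ν) ≤ C2 * x / el x ^ (B + 2) * el x ^ 2 := by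
    gcongr
  have t3 : C3 * x / el x ^ (B + 2) * Sm Q (x ^ ν) ≤ C3 * x / el x ^ (B + 2) * (2 * el x ^ 2) := by
    gcongr
  have u2 : C2 * x / el x ^ (B + 2) * el x ^ 2 = C2 * x / el x ^ B := by rw [pow_add]; field_simp
  have u3 : C3 * x / el x ^ (B + 2) * (2 * el x ^ 2) = 2 * C3 * x / el x ^ B := by rw [pow_add]; field_simp
  rw [u2] at t2
  rw [u3] at t3
  have : (C1 + C2 + 2 * C3) * x / el x ^ B = C1 * x / el x ^ B + C2 * x / el x ^ B + 2 * C3 * x / el x ^ B := by ring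
  rw [this]
  change Sm (fun _ => 1) (x ^ ν) + _ + C3 * x / el x ^ (B + 2) * Sm Q (x ^ ν) ≤ _
  linarith

lemma R_aa (K : ℕ) {ν : ℝ} (h0 : 0 < ν) (hK : (1 : ℝ) / (K + 1) < 1 - ν) : Rcond ν (aa K) := by
  intro B hB
  obtain ⟨N, hN⟩ := exists_nat_ge B
  obtain ⟨C, hC, hb⟩ := R_nat K N h0 hK
  refine ⟨C, fun x hx => ?_⟩
  have hx1 : 1 ≤ x := by linarith
  have hl : 0 < Real.log x := Real.log_pos (by linarith)
  have e1 := one_le_el hx1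
  have h := hb x hx1
  have hc : Real.log x ^ B ≤ el x ^ N := by
    calc Real.log x ^ B ≤ el x ^ B := Real.rpow_le_rpow hl.le log_le_el hB.le
      _ ≤ el x ^ (N : ℝ) := Real.rpow_le_rpow_of_exponent_le e1 hN
      _ = _ := Real.rpow_natCast _ _
  have hp : 0 < Real.log x ^ B := Real.rpow_pos_of_pos hl B
  simp only [sum_filter]
  refine (show _ ≤ C * x / el x ^ N from h).trans ?_
  rw [Real.rpow_neg hl.le, ← div_eq_mul_inv]
  gcongr

end BS

theorem bombieri_sieve_stmt1 (ν : ℝ) (hν : ν ∈ Set.Ioo (0 : ℝ) 1) :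
    ∃ (a : ℕ → ℝ) (ξ : ℕ → ℝ), (∀ n, 0 ≤ a n ∧ a n ≤ 2) ∧ Rcond ν a ∧
      (∀ k : ℕ, 1 ≤ k → ξ k < 1) ∧
      ∀ k : ℕ, 1 ≤ k → Tendsto (fun x : ℝ => Tquot a k x) atTop (nhds (ξ k)) := by
  obtain ⟨h0, h1⟩ := hν
  obtain ⟨n, hn⟩ := exists_nat_one_div_lt (sub_pos.2 h1)
  have hK : (1 : ℝ) / (((n + 1 : ℕ) : ℝ) + 1) < 1 - ν := by
    refine lt_of_le_of_lt ?_ hn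
    push_cast
    gcongr
    linarith
  refine ⟨BS.aa (n + 1), fun k => 1 - BS.dd (n + 1) (k - 1), BS.aa_bd (n + 1), BS.R_aa (n + 1) h0 hK, ?_, ?_⟩
  · intro k _
    have := BS.dd_pos (n + 1) (k - 1) (by omega)
    linarith
  · intro k hk
    obtain ⟨j, rfl⟩ : ∃ j, k = j + 1 := ⟨k - 1, by omega⟩
    exact BS.tend_T (n + 1) j (by omega)
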